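/- For every odd positive integer k there is a constant C_k > 0 such that for every positive integer f and every weighted graph G on n vertices, there exists an f-EFT (2k−1)-emulator H of G with |E(H)| ≤ C_k·(n^{1+1/k} + n^{1+1/(k+2)}·f^{k/(k+2)} + n^{1+1/(k+1)}·f^{1/2} + f·n). -/

import Mathlib

open SimpleGraph
open scoped ENNReal

noncomputable section

/-- Weighted distance in a graph: the infimum, over all walks from `u` to `v`,
of the total weight of the walk's edges (`⊤` if there is no walk). -/
def wdist {V : Type} (G : SimpleGraph V) (w : Sym2 V → ℝ≥0∞) (u v : V) : ℝ≥0∞ :=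
  ⨅ p : G.Walk u v, (p.edges.map w).sum

/-- Distance in a graph `H` whose edge `(x, y)` is (re)weighted to `δ x y`. -/
def emulDist {V : Type} (H : SimpleGraph V) (δ : V → V → ℝ≥0∞) (u v : V) : ℝ≥0∞ :=
  ⨅ p : H.Walk u v, (p.darts.map (fun d => δ d.toProd.1 d.toProd.2)).sum

/-- `H` is an `f`-edge-fault-tolerant `t`-emulator of the weighted graph `(G, w)`:
for every fault set `F ⊆ E(G)` with `|F| ≤ f`, the graph `H` with every edge `(x,y)`
reweighted to `dist_{G∖F}(x,y)` approximates all distances of `G ∖ F` within factor `t`. -/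
def IsEFTEmulator {V : Type} (G : SimpleGraph V) (w : Sym2 V → ℝ≥0∞)
    (H : SimpleGraph V) (f : ℕ) (t : ℝ≥0∞) : Prop :=
  ∀ F : Finset (Sym2 V), ↑F ⊆ G.edgeSet → F.card ≤ f →
    ∀ u v : V,
      wdist (G.deleteEdges ↑F) w u v ≤ emulDist H (wdist (G.deleteEdges ↑F) w) u v ∧
      emulDist H (wdist (G.deleteEdges ↑F) w) u v ≤ t * wdist (G.deleteEdges ↑F) w u v

/-- `e` is the last edge of the list `l` in the order given by the ranking `π`. -/
def IsLastEdge {V : Type} (π : Sym2 V → ℕ) (l : List (Sym2 V)) (e : Sym2 V) : Prop :=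
  e ∈ l ∧ ∀ e' ∈ l, π e' ≤ π e

/-- The cycle `p` is blocked by the unordered pair `b` of edges: both members of `b`
lie on `p` and one of them is the last edge of `p` in the order `π`. -/
def CycleBlockedBy {V : Type} {H : SimpleGraph V} (π : Sym2 V → ℕ) {u : V}
    (p : H.Walk u u) (b : Sym2 (Sym2 V)) : Prop :=
  ∃ e1 e2 : Sym2 V, b = s(e1, e2) ∧ e1 ∈ p.edges ∧ e2 ∈ p.edges ∧ IsLastEdge π p.edges e1

/-- `B` is a `2k` double-blocking set for `H` with edge order `π`: it consists of
unordered pairs of distinct edges of `H`, every cycle with at most `2k` edges is blocked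
by a member of `B`, and every cycle with at most `k+1` edges is blocked by two
distinct members of `B`. -/
def IsDoubleBlockingSet {V : Type} (H : SimpleGraph V) (π : Sym2 V → ℕ) (k : ℕ)
    (B : Finset (Sym2 (Sym2 V))) : Prop :=
  (∀ b ∈ B, ¬ b.IsDiag ∧ ∀ e ∈ b, e ∈ H.edgeSet) ∧
  (∀ (u : V) (p : H.Walk u u), p.IsCycle → p.length ≤ 2 * k →
      ∃ b ∈ B, CycleBlockedBy π p b) ∧
  (∀ (u : V) (p : H.Walk u u), p.IsCycle → p.length ≤ k + 1 →
      ∃ b1 ∈ B, ∃ b2 ∈ B, b1 ≠ b2 ∧ CycleBlockedBy π p b1 ∧ CycleBlockedBy π p b2)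

/-- The number of pairs of `B` containing the edge `e`. -/
def edgeBlockCount {V : Type} (B : Finset (Sym2 (Sym2 V))) (e : Sym2 V) : ℕ :=
  {b ∈ (B : Set (Sym2 (Sym2 V))) | e ∈ b}.ncard

/-- The `i`-th edge of the vertex sequence `v`. -/
def edgeOf {V : Type} {k : ℕ} (v : Fin (k + 1) → V) (i : Fin k) : Sym2 V :=
  s(v i.castSucc, v i.succ)

/-- The average degree `2|E(H)|/n` of a graph on `n` vertices. -/
def avgDeg {V : Type} [Fintype V] (H : SimpleGraph V) : ℝ :=
  2 * (H.edgeSet.ncard : ℝ) / (Fintype.card V : ℝ)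

end
noncomputable section

/-- `v` is a SCUM `k`-path (for odd `k`), viewed as an oriented sequence of `k+1`
distinct pairwise-adjacent vertices: it is simple, its middle edge (the edge with
0-indexed position `(k-1)/2`, i.e. the index `j` with `2j+1 = k`) is the last edge
of the path in the order `π`, and the two oriented subpaths starting from the middle
edge and going towards either endpoint are chain-unblocked with respect to `B`. -/
def IsSCUM {V : Type} (H : SimpleGraph V) (π : Sym2 V → ℕ) (B : Finset (Sym2 (Sym2 V)))
    (k : ℕ) (v : Fin (k + 1) → V) : Prop :=
  Function.Injective v ∧
  (∀ i : Fin k, H.Adj (v i.castSucc) (v i.succ)) ∧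
  (∀ i j : Fin k, 2 * (j : ℕ) + 1 = k → π (edgeOf v i) ≤ π (edgeOf v j)) ∧
  (∀ (i : Fin k) (j : Fin (k + 1)), 2 * (i : ℕ) + 1 ≤ k → (j : ℕ) + 1 ≤ (i : ℕ) →
      ∀ e' : Sym2 V, s(edgeOf v i, e') ∈ B → v j ∉ e') ∧
  (∀ (i : Fin k) (j : Fin (k + 1)), k ≤ 2 * (i : ℕ) + 1 → (i : ℕ) + 2 ≤ (j : ℕ) →
      ∀ e' : Sym2 V, s(edgeOf v i, e') ∈ B → v j ∉ e')

/-- The number of (oriented) SCUM `k`-paths of `H`. -/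
def scumCount {V : Type} (H : SimpleGraph V) (π : Sym2 V → ℕ)
    (B : Finset (Sym2 (Sym2 V))) (k : ℕ) : ℕ :=
  {v : Fin (k + 1) → V | IsSCUM H π B k v}.ncard

/-- The number of (oriented, aligned) SCUM `k`-path meets of `H`: pairs of distinct
SCUM `k`-paths sharing both endpoints. -/
def scumMeetCount {V : Type} (H : SimpleGraph V) (π : Sym2 V → ℕ)
    (B : Finset (Sym2 (Sym2 V))) (k : ℕ) : ℕ :=
  {vv : (Fin (k + 1) → V) × (Fin (k + 1) → V) |
    IsSCUM H π B k vv.1 ∧ IsSCUM H π B k vv.2 ∧ vv.1 ≠ vv.2 ∧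
    vv.1 0 = vv.2 0 ∧ vv.1 (Fin.last k) = vv.2 (Fin.last k)}.ncard

/-- The oriented path given by the vertex sequence `a` is chain-unblocked with
respect to `B`: for any edge `e` of the path and any vertex `x` strictly following
`e` along the path, no pair `{e, e'} ∈ B` has `e'` incident on `x`. -/
def ChainUnblockedSeq {V : Type} (B : Finset (Sym2 (Sym2 V))) {L : ℕ}
    (a : Fin (L + 1) → V) : Prop :=
  ∀ (i : Fin L) (j : Fin (L + 1)), (i : ℕ) + 2 ≤ (j : ℕ) →
    ∀ e' : Sym2 V, s(edgeOf a i, e') ∈ B → a j ∉ e'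

/-- The walk `p` is blocked: some pair of `B` has both its edges on `p`. -/
def PathBlocked {V : Type} {H : SimpleGraph V} (B : Finset (Sym2 (Sym2 V)))
    {u v : V} (p : H.Walk u v) : Prop :=
  ∃ b ∈ B, ∀ e ∈ b, e ∈ p.edges

/-- The walk `p` is double-blocked: two distinct pairs of `B` have both their edges on `p`. -/
def PathDoubleBlocked {V : Type} {H : SimpleGraph V} (B : Finset (Sym2 (Sym2 V)))
    {u v : V} (p : H.Walk u v) : Prop :=
  ∃ b1 ∈ B, ∃ b2 ∈ B, b1 ≠ b2 ∧ (∀ e ∈ b1, e ∈ p.edges) ∧ (∀ e ∈ b2, e ∈ p.edges)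

/-- The subgraph of `H` consisting of the edge `e` together with all edges
preceding it in the order `π`. -/
def subEdges {V : Type} (H : SimpleGraph V) (π : Sym2 V → ℕ) (e : Sym2 V) : SimpleGraph V :=
  SimpleGraph.fromEdgeSet {e' ∈ H.edgeSet | π e' ≤ π e}

/-- `e` is a core edge of `H` (with respect to edge order `π` and degree threshold `d/4`):
`e` survives in the graph obtained from the subgraph of edges up to `e` by iteratively
deleting vertices of degree at most `d/4`; equivalently, there is a set `S` of vertices
containing both endpoints of `e` on which the subgraph of edges up to `e` induces
a graph of minimum degree greater than `d/4`. -/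
def IsCoreEdge {V : Type} (H : SimpleGraph V) (π : Sym2 V → ℕ) (d : ℝ) (e : Sym2 V) : Prop :=
  e ∈ H.edgeSet ∧
  ∃ S : Set V, (∀ x ∈ e, x ∈ S) ∧
    ∀ v ∈ S, d / 4 < ({u ∈ S | (subEdges H π e).Adj v u}.ncard : ℝ)

end

section Determination

/-- The restriction of the family of coordinates `ev · z` to the index set `A`. -/
noncomputable def viewOn {J Z V : Type} (ev : J → Z → V) (A : Set J) (z : Z) : J → Option V :=
  open Classical in fun j => if j ∈ A then some (ev j z) else none

lemma viewOn_eq_iff {J Z V : Type} {ev : J → Z → V} {A : Set J} {z z' : Z} :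
    viewOn ev A z = viewOn ev A z' ↔ ∀ j ∈ A, ev j z = ev j z' := by
  constructor
  · intro h j hj
    have := congrFun h j
    simpa [viewOn, hj] using this
  · intro h
    funext j
    by_cases hj : j ∈ A
    · simp [viewOn, hj, h j hj]
    · simp [viewOn, hj]

/-- All members of `T` share the same coordinates in `A`. -/
def AgreeOn {J Z V : Type} (ev : J → Z → V) (T : Finset Z) (A : Set J) : Prop :=
  ∀ z ∈ T, ∀ y ∈ T, ∀ j ∈ A, ev j z = ev j y

/-- Once the coordinates in `A` are fixed, the coordinates in `A'` of the members of `S`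
take at most `B` values. -/
def Determines {J Z V : Type} (ev : J → Z → V) (S : Finset Z) (A A' : Set J) (B : ℕ) : Prop :=
  open Classical in ∀ T ⊆ S, AgreeOn ev T A → (T.image (viewOn ev A')).card ≤ B

variable {J Z V : Type} {ev : J → Z → V} {S S' : Finset Z} {A A₁ A₂ A' : Set J} {B B₁ B₂ : ℕ}

lemma AgreeOn.mono (h : AgreeOn ev S A) (hS : S' ⊆ S) (hA : A' ⊆ A) : AgreeOn ev S' A' :=
  fun z hz z' hz' j hj => h z (hS hz) z' (hS hz') j (hA hj)

lemma Determines.of_code {β : Type}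
    (h : ∀ T ⊆ S, T.Nonempty → AgreeOn ev T A → ∃ (U : Finset β) (g : Z → β), (∀ z ∈ T, g z ∈ U) ∧
      (∀ z ∈ T, ∀ z' ∈ T, g z = g z' → ∀ j ∈ A', ev j z = ev j z') ∧ U.card ≤ B) :
    Determines ev S A A' B := by
  classical
  intro T hT hA
  rcases T.eq_empty_or_nonempty with rfl | hne
  · simp
  obtain ⟨U, g, hg, hinj, hU⟩ := h T hT hne hA
  refine le_trans ?_ hU
  have hex : ∀ y ∈ T.image (viewOn ev A'), ∃ z ∈ T, viewOn ev A' z = y := by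
    intro y hy
    simpa using hy
  have : Nonempty Z := ⟨hne.choose⟩
  choose! s hs hs' using hex
  refine Finset.card_le_card_of_injOn (fun y => g (s y)) (fun y hy => hg _ (hs y hy)) ?_
  intro y hy y' hy' hyy
  rw [← hs' y hy, ← hs' y' hy', viewOn_eq_iff]
  exact hinj _ (hs y hy) _ (hs y' hy') hyy

lemma Determines.mono (h : Determines ev S A A' B) (hS : S' ⊆ S) (hA : A ⊆ A₁)
    (hA' : A₂ ⊆ A') (hB : B ≤ B₁) : Determines ev S' A₁ A₂ B₁ := by
  classical
  refine Determines.of_code (β := J → Option V) fun T hT _ hTA =>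
    ⟨T.image (viewOn ev A'), viewOn ev A', fun z hz => Finset.mem_image_of_mem _ hz, ?_, ?_⟩
  · intro z _ z' _ hzz j hj
    exact viewOn_eq_iff.1 hzz j (hA' hj)
  · exact (h T (hT.trans hS) (hTA.mono subset_rfl hA)).trans hB

lemma Determines.trans (h₁ : Determines ev S A A₁ B₁) (h₂ : Determines ev S (A ∪ A₁) A₂ B₂) :
    Determines ev S A (A₁ ∪ A₂) (B₁ * B₂) := by
  classical
  intro T hT hTA
  have key := Finset.card_le_mul_card_image_of_maps_to (s := T.image (viewOn ev (A₁ ∪ A₂)))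
    (t := T.image (viewOn ev A₁))
    (f := fun y j => if j ∈ A₁ then y j else none) ?_ B₂ ?_
  · calc _ ≤ B₂ * (T.image (viewOn ev A₁)).card := key
      _ ≤ B₂ * B₁ := Nat.mul_le_mul_left _ (h₁ T hT hTA)
      _ = _ := mul_comm _ _
  · intro y hy
    obtain ⟨z, hz, rfl⟩ := Finset.mem_image.1 hy
    refine Finset.mem_image.2 ⟨z, hz, ?_⟩
    funext j
    by_cases hj : j ∈ A₁ <;> simp [viewOn, hj]
  · intro y hy
    obtain ⟨z₀, hz₀, rfl⟩ := Finset.mem_image.1 hy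
    set T' := T.filter (fun z => viewOn ev A₁ z = viewOn ev A₁ z₀) with hT'
    have hT'T : T' ⊆ T := Finset.filter_subset _ _
    have hag : AgreeOn ev T' (A ∪ A₁) := by
      intro z hz z' hz' j hj
      rcases hj with hj | hj
      · exact hTA z (hT'T hz) z' (hT'T hz') j hj
      · exact viewOn_eq_iff.1 ((Finset.mem_filter.1 hz).2.trans (Finset.mem_filter.1 hz').2.symm) j hj
    have hb := h₂ T' (hT'T.trans hT) hag
    have hex : ∀ y ∈ (T.image (viewOn ev (A₁ ∪ A₂))).filter
        (fun y => (fun j => if j ∈ A₁ then y j else none) = viewOn ev A₁ z₀),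
        ∃ z ∈ T', viewOn ev (A₁ ∪ A₂) z = y := by
      intro y hy
      obtain ⟨hy1, hy2⟩ := Finset.mem_filter.1 hy
      obtain ⟨z, hz, rfl⟩ := Finset.mem_image.1 hy1
      refine ⟨z, Finset.mem_filter.2 ⟨hz, ?_⟩, rfl⟩
      rw [← hy2]
      funext j
      by_cases hj : j ∈ A₁ <;> simp [viewOn, hj]
    have : Nonempty Z := ⟨z₀⟩
    choose! s hs hs' using hex
    refine le_trans (Finset.card_le_card_of_injOn (fun y => viewOn ev A₂ (s y))
      (fun y hy => Finset.mem_image_of_mem _ (hs y hy)) ?_) hb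
    intro y hy y' hy' hyy
    rw [← hs' y hy, ← hs' y' hy', viewOn_eq_iff]
    rintro j (hj | hj)
    · exact hag _ (hs y hy) _ (hs y' hy') j (Or.inr hj)
    · exact viewOn_eq_iff.1 hyy j hj

/-- A two-step determination, with the intermediate index sets given up to inclusion. -/
lemma Determines.step {A₃ A₄ : Set J} (h₁ : Determines ev S A A₁ B₁)
    (h₂ : Determines ev S A₃ A₂ B₂) (h₃ : A₃ ⊆ A ∪ A₁) (h₄ : A₄ ⊆ A₁ ∪ A₂) :
    Determines ev S A A₄ (B₁ * B₂) :=
  (h₁.trans (h₂.mono subset_rfl h₃ subset_rfl le_rfl)).mono subset_rfl subset_rfl h₄ le_rfl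

lemma Determines.biUnion {ι : Type} (s : Finset ι) (F : ι → Finset Z)
    (hS : ∀ z ∈ S, ∃ i ∈ s, z ∈ F i) (h : ∀ i ∈ s, Determines ev (F i) A A' B) :
    Determines ev S A A' (s.card * B) := by
  classical
  intro T hT hTA
  have hsub : T.image (viewOn ev A') ⊆
      s.biUnion (fun i => (T.filter (fun z => z ∈ F i)).image (viewOn ev A')) := by
    intro y hy
    obtain ⟨z, hz, rfl⟩ := Finset.mem_image.1 hy
    obtain ⟨i, hi, hzi⟩ := hS z (hT hz)
    exact Finset.mem_biUnion.2 ⟨i, hi, Finset.mem_image_of_mem _ (Finset.mem_filter.2 ⟨hz, hzi⟩)⟩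
  refine (Finset.card_le_card hsub).trans (Finset.card_biUnion_le_card_mul _ _ _ fun i hi => ?_)
  refine h i hi _ (fun z hz => (Finset.mem_filter.1 hz).2) (hTA.mono (Finset.filter_subset _ _) subset_rfl)

lemma Determines.one (h : ∀ T ⊆ S, AgreeOn ev T A → AgreeOn ev T A') :
    Determines ev S A A' 1 :=
  Determines.of_code (β := Unit) fun T hT _ hTA =>
    ⟨Finset.univ, fun _ => (), by simp, fun z hz z' hz' _ j hj => h T hT hTA z hz z' hz' j hj,
      by simp⟩

lemma Determines.self (hA : A' ⊆ A) : Determines ev S A A' 1 :=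
  Determines.one fun _ _ h => h.mono subset_rfl hA

lemma Determines.card_le (h : Determines ev S ∅ A B)
    (hS : ∀ z ∈ S, ∀ z' ∈ S, (∀ j ∈ A, ev j z = ev j z') → z = z') : S.card ≤ B := by
  classical
  have := h S subset_rfl (by intro z _ z' _ j hj; exact absurd hj (by simp))
  rwa [Finset.card_image_of_injOn] at this
  intro z hz z' hz' hzz
  exact hS z hz z' hz' (viewOn_eq_iff.1 hzz)

lemma Determines.of_agree (h : ∀ T ⊆ S, T.Nonempty → AgreeOn ev T A → Determines ev T A A' B) :
    Determines ev S A A' B := by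
  intro T hT hTA
  rcases T.eq_empty_or_nonempty with rfl | hne
  · simp
  · exact h T hT hne hTA T subset_rfl hTA

lemma Determines.comap {J' : Type} {A₁' : Set J'} (φ : J' → J) {A' : Set J'}
    (h : Determines (fun j => ev (φ j)) S A₁' A' B) (h₁ : ∀ j ∈ A₁', φ j ∈ A)
    (h₂ : ∀ j ∈ A₂, ∃ i ∈ A', φ i = j) : Determines ev S A A₂ B := by
  classical
  refine Determines.of_code (β := J' → Option V) fun T hT _ hTA =>
    ⟨T.image (viewOn (fun j => ev (φ j)) A'), viewOn (fun j => ev (φ j)) A',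
      fun z hz => Finset.mem_image_of_mem _ hz, ?_, ?_⟩
  · intro z _ z' _ hzz j hj
    obtain ⟨i, hi, rfl⟩ := h₂ j hj
    exact viewOn_eq_iff.1 hzz i hi
  · exact h T hT fun z hz z' hz' j hj => hTA z hz z' hz' _ (h₁ j hj)

/-- Extending the determined coordinates by coordinates which they determine. -/
lemma Determines.extend {A₃ A₄ : Set J} (h₁ : Determines ev S A A₁ B₁)
    (h₂ : Determines ev S A₃ A₂ B₂) (h₃ : A₃ ⊆ A₁) (h₄ : A₄ ⊆ A₁ ∪ A₂) :
    Determines ev S A A₄ (B₁ * B₂) :=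
  h₁.step h₂ (h₃.trans Set.subset_union_right) h₄

end Determination

section Blocking

/-- A graph with ranked edges in which the relation `R` on edges blocks every short closed walk
at its last edge, and doubly blocks every closed walk of length at most `k + 1`. -/
structure IsBlocked {V : Type} (H : SimpleGraph V) (π : Sym2 V → ℕ)
    (R : Sym2 V → Sym2 V → Prop) (k F : ℕ) : Prop where
  symm : ∀ e e', R e e' → R e' e
  irrefl : ∀ e, ¬ R e e
  inj : ∀ e ∈ H.edgeSet, ∀ e' ∈ H.edgeSet, π e = π e' → e = e'
  few : ∀ e ∈ H.edgeSet, ∃ s : Finset (Sym2 V), s.card ≤ F ∧ ∀ e', R e e' → e' ∈ s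
  single : ∀ u v, H.Adj u v → ∀ p : H.Walk u v, (∀ e ∈ p.edges, π e < π s(u, v)) →
    p.length ≤ 2 * k - 1 → ∃ e ∈ p.edges, R s(u, v) e
  double : ∀ u v, H.Adj u v → ∀ p : H.Walk u v, (∀ e ∈ p.edges, π e < π s(u, v)) →
    p.length ≤ k → ∃ e ∈ p.edges, ∃ e' ∈ p.edges, e ≠ e' ∧ R s(u, v) e ∧ R s(u, v) e'

variable {V : Type} {H : SimpleGraph V} {π : Sym2 V → ℕ} {R : Sym2 V → Sym2 V → Prop} {k F : ℕ}

lemma IsBlocked.few_pairs (h : IsBlocked H π R k F) {e : Sym2 V} (he : e ∈ H.edgeSet) :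
    ∃ s : Finset (V × V), s.card ≤ 2 * F ∧ ∀ a b, R e s(a, b) → (a, b) ∈ s := by
  classical
  obtain ⟨s, hs, hse⟩ := h.few e he
  refine ⟨s.biUnion (fun e' => {e'.out, e'.out.swap}), ?_, ?_⟩
  · refine (Finset.card_biUnion_le_card_mul _ _ 2 fun e' _ => Finset.card_le_two).trans ?_
    rw [mul_comm]
    exact Nat.mul_le_mul_left _ hs
  · intro a b hab
    refine Finset.mem_biUnion.2 ⟨_, hse _ hab, ?_⟩
    have : s((Quot.out s(a, b)).1, (Quot.out s(a, b)).2) = s(a, b) := Quot.out_eq s(a, b)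
    rcases Sym2.eq_iff.1 this with ⟨h1, h2⟩ | ⟨h1, h2⟩
    · simp only [Finset.mem_insert, Finset.mem_singleton]
      left
      ext <;> simp [h1, h2]
    · simp only [Finset.mem_insert, Finset.mem_singleton]
      right
      ext <;> simp [h1, h2]

/-- The `i`-th edge of a vertex sequence. -/
def stepEdge (a : ℕ → V) (i : ℕ) : Sym2 V := s(a i, a (i + 1))

lemma exists_walk_along {a : ℕ → V} {i : ℕ} (n : ℕ)
    (ha : ∀ l, i ≤ l → l < i + n → H.Adj (a l) (a (l + 1))) :
    ∃ p : H.Walk (a i) (a (i + n)), p.length = n ∧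
      ∀ e ∈ p.edges, ∃ l, i ≤ l ∧ l < i + n ∧ e = stepEdge a l := by
  induction n with
  | zero => exact ⟨Walk.nil, by simp, by simp⟩
  | succ n ih =>
    obtain ⟨p, hp, hpe⟩ := ih fun l h1 h2 => ha l h1 (by omega)
    refine ⟨p.append (Walk.cons (ha (i + n) (by omega) (by omega)) Walk.nil), by simp [hp], ?_⟩
    intro e he
    simp only [Walk.edges_append, Walk.edges_cons, Walk.edges_nil, List.mem_append,
      List.mem_singleton] at he
    rcases he with he | rfl
    · obtain ⟨l, h1, h2, h3⟩ := hpe e he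
      exact ⟨l, h1, by omega, h3⟩
    · exact ⟨i + n, by omega, by omega, rfl⟩

/-- Two arcs with common ends: the walk going around from one end of the `m`-th edge of the
first arc to the other end. -/
lemma exists_walk_around {a b : ℕ → V} {L m : ℕ} (ha : ∀ i < L, H.Adj (a i) (a (i + 1)))
    (hb : ∀ i < L, H.Adj (b i) (b (i + 1))) (h0 : a 0 = b 0) (hL : a L = b L) (hm : m < L) :
    ∃ p : H.Walk (a m) (a (m + 1)), p.length = 2 * L - 1 ∧ ∀ e ∈ p.edges,
      (∃ l < L, l ≠ m ∧ e = stepEdge a l) ∨ ∃ l < L, e = stepEdge b l := by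
  obtain ⟨p₁, hp₁, he₁⟩ := exists_walk_along (H := H) (a := a) (i := 0) m
    fun l _ h => ha l (by omega)
  obtain ⟨p₂, hp₂, he₂⟩ := exists_walk_along (H := H) (a := b) (i := 0) L
    fun l _ h => hb l (by omega)
  obtain ⟨p₃, hp₃, he₃⟩ := exists_walk_along (H := H) (a := a) (i := m + 1) (L - (m + 1))
    fun l _ h => ha l (by omega)
  refine ⟨(p₁.reverse.copy (by simp) rfl).append ((p₂.copy h0.symm (by simp [hL]) : H.Walk (a 0) (a L)).append
    (p₃.reverse.copy (by congr 1; omega) rfl)), ?_, ?_⟩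
  · simp [hp₁, hp₂, hp₃]
    omega
  · intro e he
    simp only [Walk.edges_append, Walk.edges_copy, Walk.edges_reverse, List.mem_append,
      List.mem_reverse] at he
    rcases he with he | he | he
    · obtain ⟨l, _, h2, h3⟩ := he₁ e he
      exact Or.inl ⟨l, by omega, by omega, h3⟩
    · obtain ⟨l, _, h2, h3⟩ := he₂ e he
      exact Or.inr ⟨l, by omega, h3⟩
    · obtain ⟨l, h1, h2, h3⟩ := he₃ e he
      exact Or.inl ⟨l, by omega, by omega, h3⟩

/-- Two arcs of length `L` with the same ends and otherwise disjoint, in matching positions. -/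
structure IsBubble (H : SimpleGraph V) (a b : ℕ → V) (L : ℕ) : Prop where
  adj_left : ∀ i < L, H.Adj (a i) (a (i + 1))
  adj_right : ∀ i < L, H.Adj (b i) (b (i + 1))
  inj_left : ∀ i ≤ L, ∀ j ≤ L, a i = a j → i = j
  inj_right : ∀ i ≤ L, ∀ j ≤ L, b i = b j → i = j
  align : ∀ i ≤ L, ∀ j ≤ L, a i = b j → i = j
  zero : a 0 = b 0
  last : a L = b L
  ne : ∀ i, 0 < i → i < L → a i ≠ b i
  two_le : 2 ≤ L

lemma IsBubble.symm {a b : ℕ → V} {L : ℕ} (h : IsBubble H a b L) : IsBubble H b a L :=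
  ⟨h.adj_right, h.adj_left, h.inj_right, h.inj_left,
    fun i hi j hj hij => (h.align j hj i hi hij.symm).symm, h.zero.symm, h.last.symm,
    fun i h1 h2 => (h.ne i h1 h2).symm, h.two_le⟩

lemma stepEdge_inj {a : ℕ → V} {L i j : ℕ} (hinj : ∀ i ≤ L, ∀ j ≤ L, a i = a j → i = j)
    (hi : i < L) (hj : j < L) (h : stepEdge a i = stepEdge a j) : i = j := by
  rcases Sym2.eq_iff.1 h with ⟨h1, _⟩ | ⟨h1, h2⟩
  · exact hinj i hi.le j hj.le h1
  · have := hinj _ hi.le _ hj h1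
    have := hinj _ hi _ hj.le h2
    omega

lemma IsBubble.stepEdge_ne {a b : ℕ → V} {L i j : ℕ} (h : IsBubble H a b L) (hi : i < L)
    (hj : j < L) : stepEdge a i ≠ stepEdge b j := by
  intro hij
  rcases Sym2.eq_iff.1 hij with ⟨h1, h2⟩ | ⟨h1, h2⟩
  · obtain rfl := h.align i hi.le j hj.le h1
    rcases Nat.eq_zero_or_pos i with rfl | h0
    · exact h.ne 1 one_pos h.two_le h2
    · exact h.ne i h0 hi h1
  · have := h.align _ hi.le _ hj h1
    have := h.align _ hi _ hj.le h2
    omega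

lemma stepEdge_mem {a : ℕ → V} {i : ℕ} (h : H.Adj (a i) (a (i + 1))) : stepEdge a i ∈ H.edgeSet :=
  h

section

variable {a b : ℕ → V} {L m : ℕ} (hB : IsBlocked H π R k F) (h : IsBubble H a b L) (hm : m < L)
  (ha : ∀ l < L, π (stepEdge a l) ≤ π (stepEdge a m))
  (hb : ∀ l < L, π (stepEdge b l) ≤ π (stepEdge a m))

include hB h hm ha hb

lemma IsBubble.exists_walk : ∃ p : H.Walk (a m) (a (m + 1)), p.length = 2 * L - 1 ∧
    (∀ e ∈ p.edges, (∃ l < L, l ≠ m ∧ e = stepEdge a l) ∨ ∃ l < L, e = stepEdge b l) ∧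
      ∀ e ∈ p.edges, π e < π s(a m, a (m + 1)) := by
  obtain ⟨p, hp, hpe⟩ := exists_walk_around h.adj_left h.adj_right h.zero h.last hm
  refine ⟨p, hp, hpe, fun e he => ?_⟩
  rcases hpe e he with ⟨l, hl, hlm, rfl⟩ | ⟨l, hl, rfl⟩
  · refine lt_of_le_of_ne (ha l hl) fun heq => hlm ?_
    exact stepEdge_inj h.inj_left hl hm
      (hB.inj _ (stepEdge_mem (h.adj_left l hl)) _ (stepEdge_mem (h.adj_left m hm)) heq)
  · refine lt_of_le_of_ne (hb l hl) fun heq => ?_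
    exact h.stepEdge_ne hm hl
      (hB.inj _ (stepEdge_mem (h.adj_right l hl)) _ (stepEdge_mem (h.adj_left m hm)) heq).symm

lemma IsBubble.exists_partner (hL : L ≤ k)
    (hc : ∀ l < L, ¬ R (stepEdge a m) (stepEdge a l)) :
    ∃ l < L, R (stepEdge a m) (stepEdge b l) := by
  obtain ⟨p, hp, hpe, hπ⟩ := h.exists_walk hB hm ha hb
  obtain ⟨e, he, hR⟩ := hB.single _ _ (h.adj_left m hm) p hπ (by omega)
  rcases hpe e he with ⟨l, hl, hlm, rfl⟩ | ⟨l, hl, rfl⟩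
  · exact absurd hR (hc l hl)
  · exact ⟨l, hl, hR⟩

lemma IsBubble.exists_partner_of_unique (hL : 2 * L ≤ k + 1)
    (hc : ∀ l < L, ∀ l' < L, R (stepEdge a m) (stepEdge a l) →
      R (stepEdge a m) (stepEdge a l') → l = l') :
    ∃ l < L, R (stepEdge a m) (stepEdge b l) := by
  obtain ⟨p, hp, hpe, hπ⟩ := h.exists_walk hB hm ha hb
  obtain ⟨e, he, e', he', hne, hR, hR'⟩ := hB.double _ _ (h.adj_left m hm) p hπ (by omega)
  rcases hpe e he with ⟨l, hl, hlm, rfl⟩ | ⟨l, hl, rfl⟩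
  · rcases hpe e' he' with ⟨l', hl', hlm', rfl⟩ | ⟨l', hl', rfl⟩
    · exact absurd (congrArg _ (hc l hl l' hl' hR hR')) hne
    · exact ⟨l', hl', hR'⟩
  · exact ⟨l, hl, hR⟩

lemma IsBubble.exists_partner_ne (hL : 2 * L ≤ k + 1)
    (hc : ∀ l < L, ¬ R (stepEdge a m) (stepEdge a l)) (i : ℕ) :
    ∃ l < L, l ≠ i ∧ R (stepEdge a m) (stepEdge b l) := by
  obtain ⟨p, hp, hpe, hπ⟩ := h.exists_walk hB hm ha hb
  obtain ⟨e, he, e', he', hne, hR, hR'⟩ := hB.double _ _ (h.adj_left m hm) p hπ (by omega)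
  rcases hpe e he with ⟨l, hl, hlm, rfl⟩ | ⟨l, hl, rfl⟩
  · exact absurd hR (hc l hl)
  rcases hpe e' he' with ⟨l', hl', hlm', rfl⟩ | ⟨l', hl', rfl⟩
  · exact absurd hR' (hc l' hl')
  by_cases hli : l = i
  · exact ⟨l', hl', fun h' => hne (by rw [hli, h']), hR'⟩
  · exact ⟨l, hl, hli, hR⟩

end

/-- An arc whose last edge, on any subarc, has few partners on that subarc: none, or at most one
if the arc is short. -/
def IsClean (π : Sym2 V → ℕ) (R : Sym2 V → Sym2 V → Prop) (k : ℕ) (a : ℕ → V) (L : ℕ) : Prop :=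
  (L ≤ k ∧ ∀ i j m, i ≤ m → m < j → j ≤ L →
    (∀ l, i ≤ l → l < j → π (stepEdge a l) ≤ π (stepEdge a m)) →
    ∀ l, i ≤ l → l < j → ¬ R (stepEdge a m) (stepEdge a l)) ∨
  (2 * L ≤ k + 1 ∧ ∀ m < L, ∀ l < L, ∀ l' < L, R (stepEdge a m) (stepEdge a l) →
    R (stepEdge a m) (stepEdge a l') → l = l')

lemma IsClean.shift {a : ℕ → V} {L : ℕ} (h : IsClean π R k a L) {i j : ℕ} (hij : i + j ≤ L) :
    IsClean π R k (fun l => a (i + l)) j := by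
  rcases h with ⟨hL, h⟩ | ⟨hL, h⟩
  · refine Or.inl ⟨by omega, fun i' j' m h1 h2 h3 hmax l hl1 hl2 => ?_⟩
    refine h (i + i') (i + j') (i + m) (by omega) (by omega) (by omega) ?_ (i + l) (by omega)
      (by omega)
    intro l hl1 hl2
    have := hmax (l - i) (by omega) (by omega)
    simp only [stepEdge] at this ⊢
    convert this using 4 <;> omega
  · exact Or.inr ⟨by omega, fun m hm l hl l' hl' hR hR' => by
      have := h (i + m) (by omega) (i + l) (by omega) (i + l') (by omega) hR hR'
      omega⟩

lemma IsBubble.exists_crossing_of_max {a b : ℕ → V} {L m : ℕ} (hB : IsBlocked H π R k F)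
    (h : IsBubble H a b L) (hm : m < L) (hca : IsClean π R k a L)
    (ha : ∀ l < L, π (stepEdge a l) ≤ π (stepEdge a m))
    (hb : ∀ l < L, π (stepEdge b l) ≤ π (stepEdge a m)) :
    ∃ l < L, ∃ l' < L, R (stepEdge a l) (stepEdge b l') := by
  rcases hca with ⟨hL, hc⟩ | ⟨hL, hc⟩
  · obtain ⟨l, hl, hR⟩ := h.exists_partner hB hm ha hb hL fun l hl =>
      hc 0 L m (by omega) hm le_rfl (fun l _ hl => ha l hl) l (by omega) hl
    exact ⟨m, hm, l, hl, hR⟩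
  · obtain ⟨l, hl, hR⟩ := h.exists_partner_of_unique hB hm ha hb hL (hc m hm)
    exact ⟨m, hm, l, hl, hR⟩

lemma exists_max_below (f : ℕ → ℕ) {L : ℕ} (hL : 0 < L) : ∃ m < L, ∀ l < L, f l ≤ f m := by
  obtain ⟨m, hm, h⟩ := Finset.exists_max_image (Finset.range L) f ⟨0, by simpa using hL⟩
  exact ⟨m, by simpa using hm, fun l hl => h l (by simpa using hl)⟩

lemma IsBubble.exists_crossing {a b : ℕ → V} {L : ℕ} (hB : IsBlocked H π R k F)
    (h : IsBubble H a b L) (hca : IsClean π R k a L) (hcb : IsClean π R k b L) :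
    ∃ l < L, ∃ l' < L, R (stepEdge a l) (stepEdge b l') := by
  have h2 := h.two_le
  obtain ⟨m, hm, ha⟩ := exists_max_below (fun l => π (stepEdge a l)) (L := L) (by omega)
  obtain ⟨m', hm', hb⟩ := exists_max_below (fun l => π (stepEdge b l)) (L := L) (by omega)
  rcases le_total (π (stepEdge b m')) (π (stepEdge a m)) with hle | hle
  · exact h.exists_crossing_of_max hB hm hca ha fun l hl => (hb l hl).trans hle
  · obtain ⟨l, hl, l', hl', hR⟩ := h.symm.exists_crossing_of_max hB hm' hcb hb
      fun l hl => (ha l hl).trans hle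
    exact ⟨l', hl', l, hl, hB.symm _ _ hR⟩

/-- Distinct clean arcs with the same ends contain a pair of related edges. -/
lemma exists_crossing {a b : ℕ → V} {L : ℕ} (hB : IsBlocked H π R k F)
    (haa : ∀ i < L, H.Adj (a i) (a (i + 1))) (hbb : ∀ i < L, H.Adj (b i) (b (i + 1)))
    (hai : ∀ i ≤ L, ∀ j ≤ L, a i = a j → i = j) (hbi : ∀ i ≤ L, ∀ j ≤ L, b i = b j → i = j)
    (hab : ∀ i ≤ L, ∀ j ≤ L, a i = b j → i = j)
    (hca : IsClean π R k a L) (hcb : IsClean π R k b L) {i j l : ℕ} (hil : i < l) (hlj : l < j)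
    (hjL : j ≤ L) (hi : a i = b i) (hj : a j = b j) (hl : a l ≠ b l) :
    ∃ m, i ≤ m ∧ m < j ∧ ∃ m', i ≤ m' ∧ m' < j ∧ R (stepEdge a m) (stepEdge b m') := by
  classical
  obtain ⟨i', hi'⟩ : ∃ i', i' = Nat.findGreatest (fun t => a t = b t) l := ⟨_, rfl⟩
  have hi1 : i ≤ i' := hi' ▸ Nat.le_findGreatest hil.le hi
  have hi2 : a i' = b i' := hi' ▸ Nat.findGreatest_spec (P := fun t => a t = b t) hil.le hi
  have hi3 : i' ≤ l := hi' ▸ Nat.findGreatest_le l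
  have hi4 : ∀ t, i' < t → t ≤ l → a t ≠ b t := fun t h1 h2 =>
    Nat.findGreatest_is_greatest (P := fun t => a t = b t) (hi' ▸ h1) h2
  have hex : ∃ t, l < t ∧ a t = b t := ⟨j, hlj, hj⟩
  obtain ⟨j', hj'⟩ : ∃ j', j' = Nat.find hex := ⟨_, rfl⟩
  have hj1 : j' ≤ j := hj' ▸ Nat.find_min' hex ⟨hlj, hj⟩
  have hj2 : l < j' ∧ a j' = b j' := hj' ▸ Nat.find_spec hex
  have hj3 : ∀ t, l < t → t < j' → a t ≠ b t := fun t h1 h2 h3 =>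
    Nat.find_min hex (hj' ▸ h2) ⟨h1, h3⟩
  have hil' : i' ≠ l := fun h => hl (h ▸ hi2)
  have hbub : IsBubble H (fun t => a (i' + t)) (fun t => b (i' + t)) (j' - i') := by
    refine ⟨fun t ht => haa _ (by omega), fun t ht => hbb _ (by omega), ?_, ?_, ?_, hi2, ?_, ?_, ?_⟩
    · intro s hs t ht hst
      have := hai _ (by omega) _ (by omega) hst
      omega
    · intro s hs t ht hst
      have := hbi _ (by omega) _ (by omega) hst
      omega
    · intro s hs t ht hst
      have := hab _ (by omega) _ (by omega) hst
      omega
    · have : i' + (j' - i') = j' := by omega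
      simpa [this] using hj2.2
    · intro t h1 h2
      by_cases h : i' + t ≤ l
      · exact hi4 _ (by omega) h
      · exact hj3 _ (by omega) (by omega)
    · omega
  obtain ⟨m, hm, m', hm', hR⟩ := hbub.exists_crossing hB (hca.shift (by omega))
    (hcb.shift (by omega))
  exact ⟨i' + m, by omega, by omega, i' + m', by omega, by omega, hR⟩

end Blocking

section Sequences

variable {V J Z : Type} {H : SimpleGraph V} {π : Sym2 V → ℕ} {R : Sym2 V → Sym2 V → Prop}
  {k F Δ : ℕ} {ev : J → Z → V} {S : Finset Z}

/-- Every vertex has at most `Δ` neighbours. -/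
def HasDegreeLE (H : SimpleGraph V) (Δ : ℕ) : Prop :=
  ∀ v, ∃ s : Finset V, s.card ≤ Δ ∧ ∀ u, H.Adj v u → u ∈ s

lemma HasDegreeLE.determines_of_adj (h : HasDegreeLE H Δ) {i j : J}
    (hS : ∀ z ∈ S, H.Adj (ev i z) (ev j z)) : Determines ev S {i} {j} Δ := by
  refine Determines.of_code (β := V) fun T hT hne hTA => ?_
  obtain ⟨z₀, hz₀⟩ := hne
  obtain ⟨s, hs, hs'⟩ := h (ev i z₀)
  refine ⟨s, ev j, fun z hz => hs' _ ?_, ?_, hs⟩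
  · rw [← hTA z hz z₀ hz₀ i rfl]
    exact hS z (hT hz)
  · rintro z _ z' _ hzz _ rfl
    exact hzz

/-- Revealing a walk step by step. -/
lemma HasDegreeLE.determines_walk (h : HasDegreeLE H Δ) (γ : ℕ → J) (m : ℕ)
    (hS : ∀ z ∈ S, ∀ i < m, H.Adj (ev (γ i) z) (ev (γ (i + 1)) z)) :
    Determines ev S {γ 0} (γ '' Set.Iic m) (Δ ^ m) := by
  induction m with
  | zero =>
    rw [pow_zero]
    refine Determines.self ?_
    rintro _ ⟨i, hi, rfl⟩
    obtain rfl : i = 0 := by simpa using hi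
    rfl
  | succ m ih =>
    rw [pow_succ]
    refine (ih fun z hz i hi => hS z hz i (by omega)).extend
      (h.determines_of_adj (i := γ m) (j := γ (m + 1)) fun z hz => hS z hz m (by omega)) ?_ ?_
    · rintro _ rfl
      exact ⟨m, Set.mem_Iic.2 le_rfl, rfl⟩
    · rintro _ ⟨i, hi, rfl⟩
      rcases Nat.lt_or_ge m i with him | him
      · obtain rfl : i = m + 1 := le_antisymm hi him
        exact Or.inr rfl
      · exact Or.inl ⟨i, him, rfl⟩

/-- Any two distinct members of `S` with common coordinates at two indices contain related
edges between these indices. -/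
def CrossesOn (R : Sym2 V → Sym2 V → Prop) (ev : J → Z → V) (S : Finset Z) (γ : ℕ → J)
    (L : ℕ) : Prop :=
  ∀ z ∈ S, ∀ z' ∈ S, ∀ i l j, i < l → l < j → j ≤ L → ev (γ i) z = ev (γ i) z' →
    ev (γ j) z = ev (γ j) z' → ev (γ l) z ≠ ev (γ l) z' →
    ∃ m, i ≤ m ∧ m < j ∧ ∃ m', i ≤ m' ∧ m' < j ∧
      R s(ev (γ m) z, ev (γ (m + 1)) z) s(ev (γ m') z', ev (γ (m' + 1)) z')

lemma CrossesOn.shift {γ : ℕ → J} {L : ℕ} (h : CrossesOn R ev S γ L) {S' : Finset Z} (hS : S' ⊆ S)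
    {a n : ℕ} (hn : a + n ≤ L) : CrossesOn R ev S' (fun i => γ (a + i)) n := by
  intro z hz z' hz' i l j hil hlj hj h1 h2 h3
  obtain ⟨m, hm1, hm2, m', hm1', hm2', hR⟩ :=
    h z (hS hz) z' (hS hz') (a + i) (a + l) (a + j) (by omega) (by omega) (by omega) h1 h2 h3
  refine ⟨m - a, by omega, by omega, m' - a, by omega, by omega, ?_⟩
  have e1 : a + (m - a) = m := by omega
  have e2 : a + (m - a + 1) = m + 1 := by omega
  have e3 : a + (m' - a) = m' := by omega
  have e4 : a + (m' - a + 1) = m' + 1 := by omega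
  simpa only [e1, e2, e3, e4] using hR

/-- The ends of a crossing family of sequences of length `L ≤ n` determine the intermediate
coordinates up to `C * F ^ (L - 1)` choices. -/
def IsInterpolationConst (n C : ℕ) : Prop :=
    ∀ {V J Z : Type} {H : SimpleGraph V} {π : Sym2 V → ℕ} {R : Sym2 V → Sym2 V → Prop}
      {k F : ℕ} {ev : J → Z → V}, IsBlocked H π R k F → 1 ≤ F →
      ∀ (L : ℕ), L ≤ n → ∀ (S : Finset Z) (γ : ℕ → J),
        (∀ z ∈ S, ∀ i < L, H.Adj (ev (γ i) z) (ev (γ (i + 1)) z)) → CrossesOn R ev S γ L →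
        Determines ev S {γ 0, γ L} (γ '' Set.Iic L) (C * F ^ (L - 1))

theorem exists_isInterpolationConst (n : ℕ) : ∃ C : ℕ, 1 ≤ C ∧ IsInterpolationConst n C := by
  classical
  unfold IsInterpolationConst
  induction n with
  | zero =>
    refine ⟨1, le_rfl, fun hB hF L hL S γ hadj hc => ?_⟩
    obtain rfl : L = 0 := by omega
    simp only [mul_one, zero_le, Nat.sub_eq_zero_of_le, pow_zero]
    refine Determines.self ?_
    rintro _ ⟨i, hi, rfl⟩
    obtain rfl : i = 0 := by simpa using hi
    simp
  | succ n ih =>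
    obtain ⟨C, hC1, hC⟩ := ih
    refine ⟨(1 + 2 * (n + 1) * (n + 1)) * (C * C), Nat.one_le_iff_ne_zero.2 (by positivity), ?_⟩
    intro V J Z H π R k F ev hB hF L hL S γ hadj hc
    rcases Nat.lt_or_ge L 2 with hL2 | hL2
    · refine (Determines.self ?_).mono subset_rfl subset_rfl subset_rfl ?_
      · rintro _ ⟨i, hi, rfl⟩
        have hi' : i ≤ L := hi
        rcases (by omega : i = 0 ∨ i = L) with rfl | rfl <;> simp
      · exact Nat.one_le_iff_ne_zero.2 (by positivity)
    refine Determines.of_agree fun T hT hTne hTA => ?_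
    obtain ⟨z₀, hz₀⟩ := hTne
    have hed : ∀ i < L, s(ev (γ i) z₀, ev (γ (i + 1)) z₀) ∈ H.edgeSet :=
      fun i hi => hadj z₀ (hT hz₀) i hi
    have hfew : ∀ i, ∃ s : Finset (V × V), i < L → s.card ≤ 2 * F ∧
        ∀ a b, R s(ev (γ i) z₀, ev (γ (i + 1)) z₀) s(a, b) → (a, b) ∈ s := by
      intro i
      by_cases hi : i < L
      · obtain ⟨s, hs⟩ := hB.few_pairs (hed i hi)
        exact ⟨s, fun _ => hs⟩
      · exact ⟨∅, fun h => absurd h hi⟩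
    choose s hs using hfew
    set I : Finset (ℕ × V × V) := Finset.range L ×ˢ (Finset.range L).biUnion s with hI
    have hIcard : I.card ≤ L * (L * (2 * F)) := by
      rw [hI, Finset.card_product, Finset.card_range]
      refine Nat.mul_le_mul_left _ ((Finset.card_biUnion_le_card_mul _ _ (2 * F) ?_).trans ?_)
      · intro i hi
        exact (hs i (by simpa using hi)).1
      · simp
    have hsplit : Determines ev T {γ 0, γ L} (γ '' Set.Iic L)
        ((Finset.insertNone I).card * (C * C * F ^ (L - 2))) := by
      obtain ⟨P, hP0, hP1⟩ : ∃ P : Option (ℕ × V × V) → Z → Prop,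
          (∀ z, P none z ↔ ∀ i ≤ L, ev (γ i) z = ev (γ i) z₀) ∧
          ∀ i a b z, P (some (i, a, b)) z ↔ ev (γ i) z = a ∧ ev (γ (i + 1)) z = b :=
        ⟨fun o z => match o with
          | none => ∀ i ≤ L, ev (γ i) z = ev (γ i) z₀
          | some (i, a, b) => ev (γ i) z = a ∧ ev (γ (i + 1)) z = b,
          fun _ => Iff.rfl, fun _ _ _ _ => Iff.rfl⟩
      refine Determines.biUnion (Finset.insertNone I) (fun o => T.filter fun z => P o z) ?_ ?_
      · intro z hz
        by_cases hsame : ∀ i ≤ L, ev (γ i) z = ev (γ i) z₀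
        · exact ⟨none, by simp, Finset.mem_filter.2 ⟨hz, (hP0 z).2 hsame⟩⟩
        · push Not at hsame
          obtain ⟨l, hlL, hl⟩ := hsame
          have h0 : ev (γ 0) z₀ = ev (γ 0) z := hTA z₀ hz₀ z hz _ (by simp)
          have h1 : ev (γ L) z₀ = ev (γ L) z := hTA z₀ hz₀ z hz _ (by simp)
          have hl0 : l ≠ 0 := fun h => hl (h ▸ h0.symm)
          have hl1 : l ≠ L := fun h => hl (h ▸ h1.symm)
          obtain ⟨m, _, hm, m', _, hm', hR⟩ := hc z₀ (hT hz₀) z (hT hz) 0 l L (by omega) (by omega)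
            le_rfl h0 h1 (Ne.symm hl)
          refine ⟨some (m', ev (γ m') z, ev (γ (m' + 1)) z), ?_, Finset.mem_filter.2 ⟨hz, (hP1 _ _ _ z).2 ⟨rfl, rfl⟩⟩⟩
          rw [Finset.some_mem_insertNone]
          refine Finset.mem_product.2 ⟨Finset.mem_range.2 hm', Finset.mem_biUnion.2
            ⟨m, Finset.mem_range.2 hm, (hs m hm).2 _ _ hR⟩⟩
      · rintro (_ | ⟨i, a, b⟩) ho
        · refine (Determines.one ?_).mono subset_rfl subset_rfl subset_rfl
            (Nat.one_le_iff_ne_zero.2 (by positivity))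
          rintro T' hT' - z hz z' hz' _ ⟨i, hi, rfl⟩
          exact ((hP0 z).1 (Finset.mem_filter.1 (hT' hz)).2 i hi).trans
            ((hP0 z').1 (Finset.mem_filter.1 (hT' hz')).2 i hi).symm
        · have hiL : i < L := by
            have := (Finset.mem_product.1 (Finset.some_mem_insertNone.1 ho)).1
            simpa using this
          set T' := T.filter fun z => P (some (i, a, b)) z with hT'
          have hT'S : T' ⊆ S := (Finset.filter_subset _ _).trans hT
          have d1 : Determines ev T' {γ 0, γ L} {γ 0, γ L, γ i, γ (i + 1)} 1 := by
            refine Determines.one fun T'' hT'' hag z hz z' hz' j hj => ?_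
            have h1 := (hP1 _ _ _ z).1 (Finset.mem_filter.1 (hT'' hz)).2
            have h2 := (hP1 _ _ _ z').1 (Finset.mem_filter.1 (hT'' hz')).2
            rcases hj with rfl | rfl | rfl | rfl
            · exact hag z hz z' hz' _ (by simp)
            · exact hag z hz z' hz' _ (by simp)
            · exact h1.1.trans h2.1.symm
            · exact h1.2.trans h2.2.symm
          have d2 := hC (ev := ev) hB hF i (by omega) T' γ
            (fun z hz t ht => hadj z (hT'S hz) t (by omega))
            (by simpa using hc.shift hT'S (a := 0) (n := i) (by omega))
          have d3 := hC (ev := ev) hB hF (L - (i + 1)) (by omega) T' (fun t => γ (i + 1 + t))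
            (fun z hz t ht => hadj z (hT'S hz) _ (by omega))
            (hc.shift hT'S (by omega))
          have d4 := (d1.extend d2 (A₄ := {γ 0, γ L, γ i, γ (i + 1)} ∪ γ '' Set.Iic i)
            (by intro j; simp; tauto) subset_rfl).extend d3 (A₄ := γ '' Set.Iic L) ?_ ?_
          · refine d4.mono subset_rfl subset_rfl subset_rfl ?_
            have : F ^ (i - 1) * F ^ (L - (i + 1) - 1) ≤ F ^ (L - 2) := by
              rw [← pow_add]
              exact Nat.pow_le_pow_right hF (by omega)
            calc 1 * (C * F ^ (i - 1)) * (C * F ^ (L - (i + 1) - 1))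
                = C * C * (F ^ (i - 1) * F ^ (L - (i + 1) - 1)) := by ring
              _ ≤ _ := Nat.mul_le_mul_left _ this
          · have : i + 1 + (L - (i + 1)) = L := by omega
            intro j
            simp [this]
            tauto
          · rintro _ ⟨t, ht, rfl⟩
            have ht' : t ≤ L := ht
            rcases Nat.lt_or_ge i t with h' | h'
            · exact Or.inr ⟨t - (i + 1), by simp; omega, congrArg γ (by omega)⟩
            · exact Or.inl (Or.inr ⟨t, h', rfl⟩)
    refine hsplit.mono subset_rfl subset_rfl subset_rfl ?_
    rw [Finset.card_insertNone]
    have hp : F ^ (L - 1) = F * F ^ (L - 2) := by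
      rw [← pow_succ']
      congr 1
      omega
    have h1 : I.card + 1 ≤ (1 + 2 * (n + 1) * (n + 1)) * F := by
      have : L * (L * (2 * F)) ≤ (n + 1) * ((n + 1) * (2 * F)) := by gcongr
      nlinarith
    calc (I.card + 1) * (C * C * F ^ (L - 2))
        ≤ (1 + 2 * (n + 1) * (n + 1)) * F * (C * C * F ^ (L - 2)) := Nat.mul_le_mul_right _ h1
      _ = _ := by rw [hp]; ring

/-- Families of clean arcs in matching positions cross. -/
lemma IsBlocked.crossesOn (hB : IsBlocked H π R k F) {γ : ℕ → J} {L : ℕ}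
    (hadj : ∀ z ∈ S, ∀ i < L, H.Adj (ev (γ i) z) (ev (γ (i + 1)) z))
    (hal : ∀ z ∈ S, ∀ z' ∈ S, ∀ i ≤ L, ∀ j ≤ L, ev (γ i) z = ev (γ j) z' → i = j)
    (hcl : ∀ z ∈ S, IsClean π R k (fun i => ev (γ i) z) L) : CrossesOn R ev S γ L :=
  fun z hz z' hz' _ _ _ hil hlj hj h1 h2 h3 =>
    exists_crossing hB (a := fun i => ev (γ i) z) (b := fun i => ev (γ i) z') (hadj z hz)
      (hadj z' hz') (hal z hz z hz) (hal z' hz' z' hz') (hal z hz z' hz') (hcl z hz) (hcl z' hz')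
      hil hlj hj h1 h2 h3

end Sequences

section Chains

variable {V Z : Type} {H : SimpleGraph V} {π : Sym2 V → ℕ} {R : Sym2 V → Sym2 V → Prop}
  {r F Δ C : ℕ}

/-- A path with `2 * r + 1` edges whose ranks increase towards the middle edge, such that no edge
is related to an edge meeting an earlier vertex (as seen from the middle). -/
structure IsChainPath (H : SimpleGraph V) (π : Sym2 V → ℕ) (R : Sym2 V → Sym2 V → Prop) (r : ℕ)
    (u : ℕ → V) : Prop where
  adj : ∀ i < 2 * r + 1, H.Adj (u i) (u (i + 1))
  inj : ∀ i ≤ 2 * r + 1, ∀ j ≤ 2 * r + 1, u i = u j → i = j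
  up : ∀ i j, i < j → j ≤ r → π (stepEdge u i) < π (stepEdge u j)
  down : ∀ i j, r ≤ i → i < j → j < 2 * r + 1 → π (stepEdge u j) < π (stepEdge u i)
  free_left : ∀ i j, j < i → i ≤ r → ∀ e, R (stepEdge u i) e → u j ∉ e
  free_right : ∀ i j, r ≤ i → i + 2 ≤ j → j ≤ 2 * r + 1 → ∀ e, R (stepEdge u i) e → u j ∉ e

lemma stepEdge_mirror (u : ℕ → V) {i n : ℕ} (hi : i < n) :
    stepEdge (fun i => u (n - i)) i = stepEdge u (n - 1 - i) := by
  have h1 : n - i = n - 1 - i + 1 := by omega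
  have h2 : n - (i + 1) = n - 1 - i := by omega
  simp only [stepEdge, h1, h2]
  exact Sym2.eq_swap

lemma left_mem_stepEdge (u : ℕ → V) (i : ℕ) : u i ∈ stepEdge u i := Sym2.mem_mk_left _ _

lemma right_mem_stepEdge (u : ℕ → V) (i : ℕ) : u (i + 1) ∈ stepEdge u i := Sym2.mem_mk_right _ _

lemma IsChainPath.mirror {u : ℕ → V} (h : IsChainPath H π R r u) :
    IsChainPath H π R r (fun i => u (2 * r + 1 - i)) where
  adj i hi := by
    have := h.adj (2 * r - i) (by omega)
    have h1 : 2 * r + 1 - i = 2 * r - i + 1 := by omega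
    have h2 : 2 * r + 1 - (i + 1) = 2 * r - i := by omega
    simpa only [h1, h2] using this.symm
  inj i hi j hj hij := by
    have := h.inj _ (by omega) _ (by omega) hij
    omega
  up i j hij hj := by
    rw [stepEdge_mirror u (by omega), stepEdge_mirror u (by omega)]
    exact h.down _ _ (by omega) (by omega) (by omega)
  down i j hi hij hj := by
    rw [stepEdge_mirror u (by omega), stepEdge_mirror u (by omega)]
    exact h.up _ _ (by omega) (by omega)
  free_left i j hij hi e he := by
    rw [stepEdge_mirror u (by omega)] at he
    exact h.free_right _ _ (by omega) (by omega) (by omega) e he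
  free_right i j hi hij hj e he := by
    rw [stepEdge_mirror u (by omega)] at he
    exact h.free_left _ _ (by omega) (by omega) e he

/-- The last edge of a subpath has no related edge on that subpath. -/
lemma IsChainPath.not_related {u : ℕ → V} (hB : IsBlocked H π R (2 * r + 1) F)
    (h : IsChainPath H π R r u) {i j m l : ℕ} (him : i ≤ m) (hmj : m < j) (hj : j ≤ 2 * r + 1)
    (hmax : ∀ l, i ≤ l → l < j → π (stepEdge u l) ≤ π (stepEdge u m)) (hil : i ≤ l) (hlj : l < j) :
    ¬ R (stepEdge u m) (stepEdge u l) := by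
  intro hR
  rcases lt_trichotomy l m with hlm | rfl | hlm
  · rcases Nat.lt_or_ge r m with hm | hm
    · rcases Nat.lt_or_ge l r with hl | hl
      · exact absurd (hmax r (by omega) (by omega)) (not_le.2 (h.down r m le_rfl hm (by omega)))
      · exact absurd (hmax l hil hlj) (not_le.2 (h.down l m hl hlm (by omega)))
    · exact h.free_left m l hlm hm _ hR (left_mem_stepEdge u l)
  · exact hB.irrefl _ hR
  · rcases Nat.lt_or_ge m r with hm | hm
    · rcases Nat.lt_or_ge r l with hl | hl
      · exact absurd (hmax r (by omega) (by omega)) (not_le.2 (h.up m r hm le_rfl))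
      · exact absurd (hmax l hil hlj) (not_le.2 (h.up m l hlm hl))
    · exact h.free_right m (l + 1) hm (by omega) (by omega) _ hR (right_mem_stepEdge u l)

lemma IsChainPath.isClean {u : ℕ → V} (hB : IsBlocked H π R (2 * r + 1) F)
    (h : IsChainPath H π R r u) : IsClean π R (2 * r + 1) u (2 * r + 1) :=
  Or.inl ⟨le_rfl, fun _ _ _ him hmj hj hmax _ hil hlj => h.not_related hB him hmj hj hmax hil hlj⟩

/-- A family of pairs of chain paths, whose vertices are coloured by their position. The vertex
at position `i` of the path with label `b` is `ev (b, i)`. -/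
structure IsPairFamily (H : SimpleGraph V) (π : Sym2 V → ℕ) (R : Sym2 V → Sym2 V → Prop) (r : ℕ)
    (ev : Bool × ℕ → Z → V) (S : Finset Z) (c : V → ℕ) : Prop where
  path : ∀ b, ∀ z ∈ S, IsChainPath H π R r (fun i => ev (b, i) z)
  col : ∀ b, ∀ z ∈ S, ∀ i ≤ 2 * r + 1, c (ev (b, i) z) = i

variable {ev : Bool × ℕ → Z → V} {S S' : Finset Z} {c : V → ℕ}

lemma IsPairFamily.mono (h : IsPairFamily H π R r ev S c) (hS : S' ⊆ S) :
    IsPairFamily H π R r ev S' c :=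
  ⟨fun b z hz => h.path b z (hS hz), fun b z hz => h.col b z (hS hz)⟩

lemma IsPairFamily.swap (h : IsPairFamily H π R r ev S c) :
    IsPairFamily H π R r (fun j : Bool × ℕ => ev (!j.1, j.2)) S c :=
  ⟨fun b z hz => h.path (!b) z hz, fun b z hz => h.col (!b) z hz⟩

lemma IsPairFamily.mirror (h : IsPairFamily H π R r ev S c) :
    IsPairFamily H π R r (fun j : Bool × ℕ => ev (j.1, 2 * r + 1 - j.2)) S (fun v => 2 * r + 1 - c v) where
  path b z hz := (h.path b z hz).mirror
  col b z hz i hi := by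
    change 2 * r + 1 - c (ev (b, 2 * r + 1 - i) z) = i
    rw [h.col b z hz _ (by omega)]
    omega

/-- The coordinates `p, …, q` of the path with label `b`. -/
def Seg (b : Bool) (p q : ℕ) : Set (Bool × ℕ) := {j | j.1 = b ∧ p ≤ j.2 ∧ j.2 ≤ q}

lemma mem_Seg {b b' : Bool} {p q i : ℕ} : (b', i) ∈ Seg b p q ↔ b' = b ∧ p ≤ i ∧ i ≤ q := Iff.rfl

lemma IsPairFamily.determines_up (h : IsPairFamily H π R r ev S c) (hΔ : HasDegreeLE H Δ)
    (b : Bool) {p q : ℕ} (hpq : p ≤ q) (hq : q ≤ 2 * r + 1) :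
    Determines ev S (Seg b p p) (Seg b p q) (Δ ^ (q - p)) := by
  refine (hΔ.determines_walk (fun i => (b, p + i)) (q - p) fun z hz i hi =>
    (h.path b z hz).adj _ (by omega)).mono subset_rfl ?_ ?_ le_rfl
  · rintro _ rfl
    exact ⟨rfl, le_rfl, le_rfl⟩
  · rintro ⟨b', i⟩ ⟨rfl, h1, h2⟩
    exact ⟨i - p, Set.mem_Iic.2 (by simp only at h1 h2; omega),
      Prod.ext rfl (by simp only at h1 h2 ⊢; omega)⟩

lemma IsPairFamily.determines_down (h : IsPairFamily H π R r ev S c) (hΔ : HasDegreeLE H Δ)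
    (b : Bool) {p q : ℕ} (hpq : p ≤ q) (hq : q ≤ 2 * r + 1) :
    Determines ev S (Seg b q q) (Seg b p q) (Δ ^ (q - p)) := by
  refine ((h.mirror.determines_up hΔ b (p := 2 * r + 1 - q) (q := 2 * r + 1 - p) (by omega)
    (by omega)).comap (A := Seg b q q) (A₂ := Seg b p q) (fun j : Bool × ℕ => (j.1, 2 * r + 1 - j.2))
    ?_ ?_).mono subset_rfl subset_rfl subset_rfl
    (le_of_eq (by congr 1; omega))
  · rintro ⟨b', i⟩ ⟨rfl, h1, h2⟩
    simp only [mem_Seg, true_and] at h1 h2 ⊢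
    omega
  · rintro ⟨b', i⟩ ⟨rfl, h1, h2⟩
    simp only at h1 h2
    exact ⟨(b', 2 * r + 1 - i), by simp only [mem_Seg, true_and]; omega,
      Prod.ext rfl (by simp only; omega)⟩

lemma determines_other {b : Bool} {p q : ℕ}
    (hS : ∀ z ∈ S, ∀ i, p ≤ i → i ≤ q → ev (b, i) z = ev (!b, i) z) :
    Determines ev S (Seg b p q) (Seg (!b) p q) 1 := by
  refine Determines.one ?_
  rintro T hT hA z hz z' hz' ⟨b', i⟩ ⟨rfl, h1, h2⟩
  rw [← hS z (hT hz) i h1 h2, ← hS z' (hT hz') i h1 h2]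
  exact hA z hz z' hz' _ ⟨rfl, h1, h2⟩

lemma IsPairFamily.determines_between (h : IsPairFamily H π R r ev S c)
    (hB : IsBlocked H π R (2 * r + 1) F) (hF : 1 ≤ F) (hC : IsInterpolationConst (2 * r + 1) C)
    (b : Bool) {p q : ℕ} (hpq : p ≤ q) (hq : q ≤ 2 * r + 1) :
    Determines ev S (Seg b p p ∪ Seg b q q) (Seg b p q) (C * F ^ (q - p - 1)) := by
  have hadj : ∀ z ∈ S, ∀ i < q - p, H.Adj (ev (b, p + i) z) (ev (b, p + i + 1) z) :=
    fun z hz i hi => (h.path b z hz).adj _ (by omega)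
  refine (hC hB hF (q - p) (by omega) S (fun i => (b, p + i)) hadj
    (hB.crossesOn hadj ?_ ?_)).mono subset_rfl ?_ ?_ le_rfl
  · intro z hz z' hz' i hi j hj hij
    have h1 := h.col b z hz (p + i) (by omega)
    have h2 := h.col b z' hz' (p + j) (by omega)
    have : c (ev (b, p + i) z) = c (ev (b, p + j) z') := congrArg c hij
    omega
  · intro z hz
    exact ((h.path b z hz).isClean hB).shift (by omega)
  · rintro _ (rfl | rfl)
    · exact Or.inl ⟨rfl, le_rfl, le_rfl⟩
    · exact Or.inr ⟨rfl, by simp only; omega, by simp only; omega⟩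
  · rintro ⟨b', i⟩ ⟨rfl, h1, h2⟩
    exact ⟨i - p, Set.mem_Iic.2 (by simp only at h1 h2; omega),
      Prod.ext rfl (by simp only at h1 h2 ⊢; omega)⟩

/-- Two paths which meet at position `a`, but not at position `a + 1`: the vertex at position
`a + 1` of the first and the vertex at position `m` of the second nearly determine the second
path between these positions. -/
lemma IsPairFamily.determines_bent (h : IsPairFamily H π R r ev S c)
    (hB : IsBlocked H π R (2 * r + 1) F) (hF : 1 ≤ F) (hC : IsInterpolationConst (2 * r + 1) C)
    (b : Bool) {a m : ℕ} (ham : a < m) (hm : m ≤ r)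
    (heq : ∀ z ∈ S, ev (b, a) z = ev (!b, a) z)
    (hne : ∀ z ∈ S, ev (b, a + 1) z ≠ ev (!b, a + 1) z) :
    Determines ev S (Seg b (a + 1) (a + 1) ∪ Seg (!b) m m) (Seg (!b) a m) (C * F ^ (m - a)) := by
  refine Determines.of_agree fun T hT _ hTA => ?_
  set γ : ℕ → Bool × ℕ := fun i => if i = 0 then (b, a + 1) else (!b, a + (i - 1)) with hγ
  have hγ0 : γ 0 = (b, a + 1) := rfl
  have hγs : ∀ i, γ (i + 1) = (!b, a + i) := fun i => by simp [hγ]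
  have hadj : ∀ z ∈ T, ∀ i < m - a + 1, H.Adj (ev (γ i) z) (ev (γ (i + 1)) z) := by
    intro z hz i hi
    rcases i with _ | i
    · rw [hγ0, hγs, add_zero, ← heq z (hT hz)]
      exact ((h.path b z (hT hz)).adj a (by omega)).symm
    · rw [hγs, hγs]
      exact (h.path (!b) z (hT hz)).adj (a + i) (by omega)
  have hal : ∀ z ∈ T, ∀ z' ∈ T, ∀ i, a + i ≤ m → ev (b, a + 1) z ≠ ev (!b, a + i) z' := by
    intro z hz z' hz' i hi heq'
    have h1 := h.col b z (hT hz) (a + 1) (by omega)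
    have h2 := h.col (!b) z' (hT hz') (a + i) (by omega)
    rw [heq', h2] at h1
    refine hne z' (hT hz') ?_
    rw [← h1, ← heq', h1]
    exact hTA z' hz' z hz _ (Or.inl ⟨rfl, le_rfl, le_rfl⟩)
  refine (hC hB hF (m - a + 1) (by omega) T γ hadj
    (hB.crossesOn hadj ?_ ?_)).mono subset_rfl ?_ ?_ le_rfl
  · rintro z hz z' hz' (_ | i) hi (_ | j) hj hij
    · rfl
    · rw [hγ0, hγs] at hij
      exact absurd hij (hal z hz z' hz' j (by omega))
    · rw [hγ0, hγs] at hij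
      exact absurd hij.symm (hal z' hz' z hz i (by omega))
    · rw [hγs, hγs] at hij
      have h1 := h.col (!b) z (hT hz) (a + i) (by omega)
      have h2 := h.col (!b) z' (hT hz') (a + j) (by omega)
      rw [hij] at h1
      omega
  · intro z hz
    set y : ℕ → V := fun i => ev (!b, i) z with hy
    have hpath : IsChainPath H π R r y := h.path (!b) z (hT hz)
    have he0 : y a ∈ stepEdge (fun i => ev (γ i) z) 0 := by
      have := right_mem_stepEdge (fun i => ev (γ i) z) 0
      rwa [hγs] at this
    have hes : ∀ i, stepEdge (fun i => ev (γ i) z) (i + 1) = stepEdge y (a + i) := by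
      intro i
      simp only [stepEdge]
      rw [hγs, hγs]
      rfl
    have hss : ∀ i j, i ≤ r - a → j < i → ¬ R (stepEdge y (a + i)) (stepEdge y (a + j)) :=
      fun i j hi hj hR => hpath.free_left (a + i) (a + j) (by omega) (by omega) _ hR
        (left_mem_stepEdge y _)
    have hss' : ∀ i j, i < m - a → j < m - a →
        ¬ R (stepEdge y (a + i)) (stepEdge y (a + j)) := by
      intro i j hi hj hR
      rcases lt_trichotomy i j with hij | rfl | hij
      · exact hss j i (by omega) hij (hB.symm _ _ hR)
      · exact hB.irrefl _ hR
      · exact hss i j (by omega) hij hR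
    have h0s : ∀ i, i + 1 < m - a → ¬ R (stepEdge y (a + (i + 1)))
        (stepEdge (fun i => ev (γ i) z) 0) := fun i hi hR =>
      hpath.free_left (a + (i + 1)) a (by omega) (by omega) _ hR he0
    refine Or.inr ⟨by omega, ?_⟩
    rintro (_ | i) hi (_ | j) hj (_ | l) hl hR hR'
    · rfl
    · exact absurd hR (hB.irrefl _)
    · exact absurd hR' (hB.irrefl _)
    · rw [hes] at hR hR'
      rcases j with _ | j
      · rcases l with _ | l
        · rfl
        · exact absurd (hB.symm _ _ hR') (h0s l (by omega))
      · exact absurd (hB.symm _ _ hR) (h0s j (by omega))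
    · rfl
    · rw [hes] at hR'
      rw [hes] at hR'
      exact absurd hR' (hss' _ _ (by omega) (by omega))
    · rw [hes, hes] at hR
      exact absurd hR (hss' _ _ (by omega) (by omega))
    · rw [hes, hes] at hR
      exact absurd hR (hss' _ _ (by omega) (by omega))
  · rintro _ (rfl | rfl)
    · exact Or.inl ⟨rfl, le_rfl, le_rfl⟩
    · rw [hγs]
      exact Or.inr ⟨rfl, by simp only; omega, by simp only; omega⟩
  · rintro ⟨b', i⟩ ⟨rfl, h1, h2⟩
    simp only at h1 h2
    exact ⟨i - a + 1, Set.mem_Iic.2 (by omega), by rw [hγs]; exact Prod.ext rfl (by simp only; omega)⟩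

end Chains

section Patterns

variable {V Z : Type} {H : SimpleGraph V} {π : Sym2 V → ℕ} {R : Sym2 V → Sym2 V → Prop}
  {r F Δ C : ℕ} {ev : Bool × ℕ → Z → V} {S S' : Finset Z} {c : V → ℕ} {I : ℕ → Prop}

/-- In every pair of the family the two paths meet exactly at the positions in `I`. -/
def HasPattern (ev : Bool × ℕ → Z → V) (S : Finset Z) (r : ℕ) (I : ℕ → Prop) : Prop :=
  ∀ b, ∀ z ∈ S, ∀ i ≤ 2 * r + 1, ev (b, i) z = ev (!b, i) z ↔ I i

lemma HasPattern.swap (h : HasPattern ev S r I) :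
    HasPattern (fun j : Bool × ℕ => ev (!j.1, j.2)) S r I :=
  fun b => h (!b)

lemma HasPattern.mirror (h : HasPattern ev S r I) :
    HasPattern (fun j : Bool × ℕ => ev (j.1, 2 * r + 1 - j.2)) S r (fun i => I (2 * r + 1 - i)) :=
  fun b z hz i _ => h b z hz (2 * r + 1 - i) (by omega)

lemma HasPattern.determines_other (h : HasPattern ev S r I) (b : Bool) {p q : ℕ}
    (hq : q ≤ 2 * r + 1) (hI : ∀ i, p ≤ i → i ≤ q → I i) :
    Determines ev S (Seg b p q) (Seg (!b) p q) 1 :=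
  _root_.determines_other fun z hz i h1 h2 => (h b z hz i (by omega)).2 (hI i h1 h2)

/-- Transport of a statement about determination along the mirror map. -/
lemma Determines.of_mirror {A A' A₁ A₂ : Set (Bool × ℕ)} {B : ℕ}
    (h : Determines (fun j : Bool × ℕ => ev (j.1, 2 * r + 1 - j.2)) S A A' B)
    (h₁ : ∀ b i, (b, i) ∈ A → (b, 2 * r + 1 - i) ∈ A₁)
    (h₂ : ∀ b i, (b, i) ∈ A₂ → i ≤ 2 * r + 1 ∧ (b, 2 * r + 1 - i) ∈ A') :
    Determines ev S A₁ A₂ B := by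
  refine Determines.comap (fun j : Bool × ℕ => (j.1, 2 * r + 1 - j.2)) h ?_ ?_
  · rintro ⟨b, i⟩ hi
    exact h₁ b i hi
  · rintro ⟨b, i⟩ hi
    obtain ⟨h3, h4⟩ := h₂ b i hi
    exact ⟨_, h4, Prod.ext rfl (by simp only; omega)⟩

section

variable (h : IsPairFamily H π R r ev S c) (hP : HasPattern ev S r I)
  (hB : IsBlocked H π R (2 * r + 1) F) (hF : 1 ≤ F) (hC : IsInterpolationConst (2 * r + 1) C) (hΔ : HasDegreeLE H Δ)

include h hP hB hF hC hΔ

lemma IsPairFamily.determines_left_end (hC1 : 1 ≤ C) {p : ℕ} (hp : p ≤ r) (h0 : I 0) (hIp : I p) :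
    ∃ A B, ((A = p ∧ B = 0 ∧ ∀ i ≤ p, I i) ∨ (2 ≤ p ∧ A + 1 = p ∧ B = p)) ∧
      Determines ev S (Seg true p p) (Seg true 0 p ∪ Seg false 0 p) (C * (Δ ^ A * F ^ B)) := by
  classical
  by_cases hall : ∀ i ≤ p, I i
  · refine ⟨p, 0, Or.inl ⟨rfl, rfl, hall⟩, ?_⟩
    have d := (h.determines_down hΔ true (p := 0) (q := p) (by omega) (by omega)).extend
      (hP.determines_other true (p := 0) (q := p) (by omega) fun i _ => hall i) subset_rfl subset_rfl
    refine d.mono subset_rfl subset_rfl subset_rfl ?_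
    simp only [Nat.sub_zero, mul_one, pow_zero]
    exact Nat.le_mul_of_pos_left _ hC1
  · push Not at hall
    obtain ⟨a, ha1, ha2, ha3⟩ : ∃ a, (∀ i ≤ a, I i) ∧ ¬ I (a + 1) ∧ a + 1 < p := by
      have hs := Nat.find_spec hall
      have hm := fun n => Nat.find_min (m := n) hall
      have hn0 : Nat.find hall ≠ 0 := fun hn => hs.2 (by rw [hn]; exact h0)
      have hnp : Nat.find hall ≠ p := fun hn => hs.2 (by rw [hn]; exact hIp)
      refine ⟨Nat.find hall - 1, fun i hi => ?_, ?_, by omega⟩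
      · by_contra hI
        exact hm i (by omega) ⟨by omega, hI⟩
      · rw [Nat.sub_add_cancel (by omega)]
        exact hs.2
    refine ⟨p - 1, p, Or.inr ⟨by omega, by omega, rfl⟩, ?_⟩
    have d1 := h.determines_down hΔ true (p := a + 1) (q := p) (by omega) (by omega)
    have d2 := d1.extend (hP.determines_other true (p := p) (q := p) (by omega)
      fun i h1 h2 => le_antisymm h1 h2 ▸ hIp) (by grind [mem_Seg]) subset_rfl
    have d3 := d2.extend (h.determines_bent hB hF hC true (a := a) (m := p) (by omega) (by omega)
      (fun z hz => (hP true z hz a (by omega)).2 (ha1 a le_rfl))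
      (fun z hz => mt (hP true z hz (a + 1) (by omega)).1 ha2)) (by grind [mem_Seg]) subset_rfl
    have d4 := d3.extend (h.determines_down hΔ false (p := 0) (q := a) (by omega) (by omega))
      (by grind [mem_Seg]) subset_rfl
    have d5 := d4.extend (hP.determines_other false (p := 0) (q := a) (by omega)
      fun i _ => ha1 i) (by grind [mem_Seg]) (A₄ := Seg true 0 p ∪ Seg false 0 p)
      (by grind [mem_Seg])
    refine d5.mono subset_rfl subset_rfl subset_rfl ?_
    have e1 : Δ ^ (p - (a + 1)) * Δ ^ (a - 0) = Δ ^ (p - 1) := by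
      rw [← pow_add]
      congr 1
      omega
    have e2 : F ^ (p - a) ≤ F ^ p := Nat.pow_le_pow_right hF (by omega)
    calc Δ ^ (p - (a + 1)) * 1 * (C * F ^ (p - a)) * Δ ^ (a - 0) * 1
        = C * (Δ ^ (p - (a + 1)) * Δ ^ (a - 0) * F ^ (p - a)) := by ring
      _ ≤ C * (Δ ^ (p - 1) * F ^ p) := by rw [e1]; gcongr

lemma IsPairFamily.determines_right_end (hC1 : 1 ≤ C) {q : ℕ} (hq : r + 1 ≤ q) (hq' : q ≤ 2 * r + 1)
    (h0 : I (2 * r + 1)) (hIq : I q) :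
    ∃ A B, ((A + q = 2 * r + 1 ∧ B = 0 ∧ ∀ i, q ≤ i → i ≤ 2 * r + 1 → I i) ∨
        (q + 2 ≤ 2 * r + 1 ∧ A + 1 + q = 2 * r + 1 ∧ B + q = 2 * r + 1)) ∧
      Determines ev S (Seg true q q) (Seg true q (2 * r + 1) ∪ Seg false q (2 * r + 1))
        (C * (Δ ^ A * F ^ B)) := by
  obtain ⟨A, B, hAB, d⟩ := h.mirror.determines_left_end hP.mirror hB hF hC hΔ hC1
    (p := 2 * r + 1 - q) (by omega) h0
    (by rwa [show 2 * r + 1 - (2 * r + 1 - q) = q by omega])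
  refine ⟨A, B, ?_, d.of_mirror ?_ ?_⟩
  · rcases hAB with ⟨h1, h2, h3⟩ | ⟨h1, h2, h3⟩
    · refine Or.inl ⟨by omega, h2, fun i hi hi' => ?_⟩
      have := h3 (2 * r + 1 - i) (by omega)
      rwa [show 2 * r + 1 - (2 * r + 1 - i) = i by omega] at this
    · exact Or.inr ⟨by omega, by omega, by omega⟩
  · intro b i hi
    grind [mem_Seg]
  · intro b i hi
    grind [mem_Seg]

lemma IsPairFamily.determines_left_half {p : ℕ} (hp : p < r) (hIp : I p) (hIp' : ¬ I (p + 1)) :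
    Determines ev S (Seg true r r ∪ Seg false r r) (Seg true p r ∪ Seg false p r)
      (C * (Δ ^ (r - p - 1) * F ^ (r - p))) := by
  have d0 : Determines ev S (Seg true r r ∪ Seg false r r) (Seg true r r ∪ Seg false r r) 1 :=
    Determines.self subset_rfl
  have d1 := d0.extend (h.determines_down hΔ true (p := p + 1) (q := r) (by omega) (by omega))
    (by grind [mem_Seg]) subset_rfl
  have d2 := d1.extend (h.determines_bent hB hF hC true (a := p) (m := r) (by omega) (by omega)
    (fun z hz => (hP true z hz p (by omega)).2 hIp)
    (fun z hz => mt (hP true z hz (p + 1) (by omega)).1 hIp')) (by grind [mem_Seg]) subset_rfl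
  have d3 := d2.extend (hP.determines_other false (p := p) (q := p) (by omega)
    fun i h1 h2 => le_antisymm h1 h2 ▸ hIp) (by grind [mem_Seg])
    (A₄ := Seg true p r ∪ Seg false p r) (by grind [mem_Seg])
  refine d3.mono subset_rfl subset_rfl subset_rfl (le_of_eq ?_)
  rw [show r - (p + 1) = r - p - 1 by omega]
  ring

lemma IsPairFamily.determines_right_half {q : ℕ} (hq : r + 1 < q) (hq' : q ≤ 2 * r + 1)
    (hIq : I q) (hIq' : ¬ I (q - 1)) :
    Determines ev S (Seg true (r + 1) (r + 1) ∪ Seg false (r + 1) (r + 1))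
      (Seg true (r + 1) q ∪ Seg false (r + 1) q)
      (C * (Δ ^ (q - r - 2) * F ^ (q - r - 1))) := by
  have d := h.mirror.determines_left_half hP.mirror hB hF hC hΔ
    (p := 2 * r + 1 - q) (by omega)
    (by rwa [show 2 * r + 1 - (2 * r + 1 - q) = q by omega])
    (by rwa [show 2 * r + 1 - (2 * r + 1 - q + 1) = q - 1 by omega])
  refine (d.of_mirror ?_ ?_).mono subset_rfl subset_rfl subset_rfl (le_of_eq ?_)
  · intro b i hi
    grind [mem_Seg]
  · intro b i hi
    grind [mem_Seg]
  · rw [show r - (2 * r + 1 - q) - 1 = q - r - 2 by omega,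
      show r - (2 * r + 1 - q) = q - r - 1 by omega]

end

lemma IsPairFamily.determines_partner (h : IsPairFamily H π R r ev S c)
    (hB : IsBlocked H π R (2 * r + 1) F) {i : ℕ}
    (hR : ∀ z ∈ S, R s(ev (true, r) z, ev (true, r + 1) z) s(ev (false, i) z, ev (false, i + 1) z)) :
    Determines ev S (Seg true r (r + 1)) (Seg false i (i + 1)) (2 * F) := by
  refine Determines.of_code (β := V × V) fun T hT hne hTA => ?_
  obtain ⟨z₀, hz₀⟩ := hne
  obtain ⟨s, hs, hs'⟩ := hB.few_pairs (H.mem_edgeSet.2 ((h.path true z₀ (hT hz₀)).adj r (by omega)))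
  refine ⟨s, fun z => (ev (false, i) z, ev (false, i + 1) z), fun z hz => hs' _ _ ?_, ?_, hs⟩
  · have := hR z (hT hz)
    rwa [hTA z hz z₀ hz₀ (true, r) ⟨rfl, by simp, by simp⟩,
      hTA z hz z₀ hz₀ (true, r + 1) ⟨rfl, by simp, by simp⟩] at this
  · rintro z _ z' _ hzz ⟨b, t⟩ ⟨rfl, h1, h2⟩
    simp only [Prod.mk.injEq] at hzz h1 h2
    rcases (by omega : t = i ∨ t = i + 1) with rfl | rfl
    · exact hzz.1
    · exact hzz.2

variable [Fintype V]

lemma determines_vertex (ev : Bool × ℕ → Z → V) (S : Finset Z) (b : Bool) (i : ℕ) :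
    Determines ev S ∅ (Seg b i i) (Fintype.card V) := by
  refine Determines.of_code (β := V) fun T _ _ _ => ⟨Finset.univ, ev (b, i), by simp, ?_, by simp⟩
  rintro z _ z' _ hzz ⟨b', t⟩ ⟨rfl, h1, h2⟩
  obtain rfl : t = i := le_antisymm h2 h1
  exact hzz

lemma IsPairFamily.determines_middle_edge (h : IsPairFamily H π R r ev S c)
    (hΔ : HasDegreeLE H Δ) :
    Determines ev S ∅ (Seg true r (r + 1)) (Fintype.card V * Δ) := by
  have := (determines_vertex ev S true r).extend
    (h.determines_up hΔ true (p := r) (q := r + 1) (by omega) (by omega)) subset_rfl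
    (A₄ := Seg true r (r + 1)) (by grind [mem_Seg])
  simpa using this

section

variable (h : IsPairFamily H π R r ev S c) (hP : HasPattern ev S r I)
  (hB : IsBlocked H π R (2 * r + 1) F) (hF : 1 ≤ F) (hC : IsInterpolationConst (2 * r + 1) C) (hΔ : HasDegreeLE H Δ)

include h hP hB hF hC hΔ

lemma IsPairFamily.determines_middle_left {p q i : ℕ} (hpr : p < r) (hrq : r + 1 ≤ q)
    (hq : q ≤ 2 * r + 1) (hIp : I p) (hIq : I q) (hIp' : ¬ I (p + 1)) (hpi : p ≤ i) (hir : i < r)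
    (hR : ∀ z ∈ S, R s(ev (true, r) z, ev (true, r + 1) z) s(ev (false, i) z, ev (false, i + 1) z)) :
    ∃ A B, (p < i ∧ A = i - p + (q - r - 1) ∧ B = 2 * (r - p) + (q - r - 1) - (i - p) ∨
        A = 1 + (q - r - 1) ∧ B = 2 * (r - p) + (q - r - 1) - 1) ∧
      Determines ev S ∅ (Seg true p q ∪ Seg false p q)
        (2 * C ^ 2 * Fintype.card V * (Δ ^ A * F ^ B)) := by
  have d2 := (h.determines_middle_edge hΔ).extend (h.determines_partner hB hR) subset_rfl subset_rfl
  have d3 := d2.extend (h.determines_up hΔ true (p := r + 1) (q := q) (by omega) (by omega))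
    (by grind [mem_Seg]) subset_rfl
  have d4 := d3.extend (hP.determines_other true (p := q) (q := q) (by omega)
      fun i h1 h2 => le_antisymm h1 h2 ▸ hIq) (by grind [mem_Seg]) subset_rfl
  have d5 := d4.extend (h.determines_between hB hF hC false (p := i + 1) (q := q) (by omega)
    (by omega)) (by grind [mem_Seg]) subset_rfl
  rcases Nat.eq_or_lt_of_le hpi with rfl | hpi
  · refine ⟨_, _, Or.inr ⟨rfl, rfl⟩, ?_⟩
    have d6 := d5.extend (hP.determines_other false (p := p) (q := p) (by omega)
      fun i h1 h2 => le_antisymm h1 h2 ▸ hIp) (by grind [mem_Seg]) subset_rfl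
    have d7 := d6.extend (h.determines_between hB hF hC true (p := p) (q := r) (by omega)
      (by omega)) (by grind [mem_Seg]) (A₄ := Seg true p q ∪ Seg false p q) (by grind [mem_Seg])
    refine d7.mono subset_rfl subset_rfl subset_rfl (le_of_eq ?_)
    rw [show q - r - 1 = q - (r + 1) by omega,
      show 2 * (r - p) + (q - (r + 1)) - 1 = 1 + (q - (p + 1) - 1) + (r - p - 1) by omega,
      pow_add, pow_add, pow_add]
    ring
  · refine ⟨_, _, Or.inl ⟨hpi, rfl, rfl⟩, ?_⟩
    have d6 := d5.extend (h.determines_down hΔ false (p := p + 1) (q := i) (by omega) (by omega))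
      (by grind [mem_Seg]) subset_rfl
    have d7 := d6.extend (h.determines_bent hB hF hC false (a := p) (m := r) (by omega) (by omega)
      (fun z hz => (hP false z hz p (by omega)).2 hIp)
      (fun z hz => mt (hP false z hz (p + 1) (by omega)).1 hIp')) (by grind [mem_Seg]) subset_rfl
    have d8 := d7.extend (hP.determines_other true (p := p) (q := p) (by omega)
      fun i h1 h2 => le_antisymm h1 h2 ▸ hIp) (by grind [mem_Seg])
      (A₄ := Seg true p q ∪ Seg false p q) (by grind [mem_Seg])
    refine d8.mono subset_rfl subset_rfl subset_rfl (le_of_eq ?_)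
    rw [show q - r - 1 = q - (r + 1) by omega,
      show 2 * (r - p) + (q - (r + 1)) - (i - p) = 1 + (q - (i + 1) - 1) + (r - p) by omega,
      show i - p = 1 + (i - (p + 1)) by omega, pow_add, pow_add, pow_add, pow_add]
    ring

lemma IsPairFamily.determines_middle_right {p q i : ℕ} (hpr : p ≤ r) (hrq : r + 1 < q)
    (hq : q ≤ 2 * r + 1) (hIp : I p) (hIq : I q) (hIq' : ¬ I (q - 1)) (hri : r < i) (hiq : i < q)
    (hR : ∀ z ∈ S, R s(ev (true, r) z, ev (true, r + 1) z) s(ev (false, i) z, ev (false, i + 1) z)) :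
    ∃ A B, (i + 1 < q ∧ A = q - i - 1 + (r - p) ∧ B = 2 * (q - r - 1) + (r - p) - (q - i - 1) ∨
        A = 1 + (r - p) ∧ B = 2 * (q - r - 1) + (r - p) - 1) ∧
      Determines ev S ∅ (Seg true p q ∪ Seg false p q)
        (2 * C ^ 2 * Fintype.card V * (Δ ^ A * F ^ B)) := by
  have hR' : ∀ z ∈ S, R s(ev (true, 2 * r + 1 - r) z, ev (true, 2 * r + 1 - (r + 1)) z)
      s(ev (false, 2 * r + 1 - (2 * r - i)) z, ev (false, 2 * r + 1 - (2 * r - i + 1)) z) := by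
    intro z hz
    rw [show 2 * r + 1 - r = r + 1 by omega, show 2 * r + 1 - (r + 1) = r by omega,
      show 2 * r + 1 - (2 * r - i) = i + 1 by omega,
      show 2 * r + 1 - (2 * r - i + 1) = i by omega, Sym2.eq_swap,
      Sym2.eq_swap (a := ev (false, i + 1) z)]
    exact hR z hz
  obtain ⟨A, B, hAB, d⟩ := h.mirror.determines_middle_left hP.mirror hB hF hC hΔ
    (p := 2 * r + 1 - q) (q := 2 * r + 1 - p) (i := 2 * r - i) (by omega) (by omega) (by omega)
    (by rwa [show 2 * r + 1 - (2 * r + 1 - q) = q by omega])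
    (by rwa [show 2 * r + 1 - (2 * r + 1 - p) = p by omega])
    (by rwa [show 2 * r + 1 - (2 * r + 1 - q + 1) = q - 1 by omega]) (by omega) (by omega) hR'
  refine ⟨A, B, by omega, d.of_mirror ?_ ?_⟩
  · intro b i hi
    simp at hi
  · intro b i hi
    grind [mem_Seg]

lemma IsPairFamily.determines_middle_mid {p q : ℕ} (hpr : p < r) (hrq : r + 1 < q)
    (hq : q ≤ 2 * r + 1) (hIp : I p) (hIq : I q) (hIp' : ¬ I (p + 1)) (hIq' : ¬ I (q - 1))
    (hR : ∀ z ∈ S, R s(ev (true, r) z, ev (true, r + 1) z) s(ev (false, r) z, ev (false, r + 1) z)) :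
    Determines ev S ∅ (Seg true p q ∪ Seg false p q)
      (2 * C ^ 2 * Fintype.card V * (Δ ^ (q - p - 2) * F ^ (q - p))) := by
  have d2 := (h.determines_middle_edge hΔ).extend (h.determines_partner hB hR) subset_rfl subset_rfl
  have d3 := d2.extend (h.determines_left_half hP hB hF hC hΔ hpr hIp hIp')
    (by grind [mem_Seg]) subset_rfl
  have d4 := d3.extend (h.determines_right_half hP hB hF hC hΔ hrq hq hIq hIq')
    (by grind [mem_Seg]) (A₄ := Seg true p q ∪ Seg false p q) (by grind [mem_Seg])
  refine d4.mono subset_rfl subset_rfl subset_rfl (le_of_eq ?_)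
  rw [show q - p - 2 = 1 + (r - p - 1) + (q - r - 2) by omega,
    show q - p = 1 + (r - p) + (q - r - 1) by omega, pow_add, pow_add, pow_add, pow_add]
  ring

end

end Patterns

section PairCount

variable {V Z W : Type} {H : SimpleGraph V} {π : Sym2 V → ℕ} {R : Sym2 V → Sym2 V → Prop}
  {r F Δ C : ℕ} {ev : Bool × ℕ → Z → V} {S S' : Finset Z} {c : V → ℕ} {I : ℕ → Prop}

/-- The two positions around the middle edge between which the pattern `I` has a gap. -/
structure IsMiddleGap (I : ℕ → Prop) (r p q : ℕ) : Prop where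
  le : p ≤ r
  ge : r + 1 ≤ q
  q_le : q ≤ 2 * r + 1
  left : I p
  right : I q
  gap : ∀ t, p < t → t < q → ¬ I t

lemma exists_isMiddleGap (h0 : I 0) (hk : I (2 * r + 1)) : ∃ p q, IsMiddleGap I r p q := by
  classical
  have hex : ∃ q, r + 1 ≤ q ∧ I q := ⟨2 * r + 1, by omega, hk⟩
  refine ⟨Nat.findGreatest I r, Nat.find hex, Nat.findGreatest_le r, (Nat.find_spec hex).1,
    Nat.find_min' hex ⟨by omega, hk⟩, Nat.findGreatest_spec (Nat.zero_le r) h0,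
    (Nat.find_spec hex).2, fun t h1 h2 => ?_⟩
  rcases Nat.lt_or_ge r t with h | h
  · exact fun hI => Nat.find_min hex h2 ⟨h, hI⟩
  · exact Nat.findGreatest_is_greatest h1 h

lemma pow_mul_pow_le {A B A' B' : ℕ} (hF : 1 ≤ F) (hFΔ : F ≤ Δ) (hA : A ≤ A')
    (hAB : A + B ≤ A' + B') : Δ ^ A * F ^ B ≤ Δ ^ A' * F ^ B' := by
  rcases Nat.le_total B B' with h | h
  · exact Nat.mul_le_mul (Nat.pow_le_pow_right (hF.trans hFΔ) hA) (Nat.pow_le_pow_right hF h)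
  · obtain ⟨d, rfl⟩ := Nat.exists_eq_add_of_le h
    calc Δ ^ A * F ^ (B' + d) = Δ ^ A * F ^ d * F ^ B' := by rw [pow_add]; ring
      _ ≤ Δ ^ A * Δ ^ d * F ^ B' := by gcongr
      _ = Δ ^ (A + d) * F ^ B' := by rw [pow_add]
      _ ≤ Δ ^ A' * F ^ B' :=
        Nat.mul_le_mul_right _ (Nat.pow_le_pow_right (hF.trans hFΔ) (by omega))

lemma pow_mul_pow_le_sum {A B : ℕ} (hF : 1 ≤ F) (hFΔ : F ≤ Δ) (hr : 1 ≤ r)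
    (h : (A ≤ 2 * r ∧ A + B ≤ 3 * r + 1) ∨ (A ≤ 2 * r - 1 ∧ A + B ≤ 4 * r)) :
    Δ ^ A * F ^ B ≤ Δ ^ (2 * r) * F ^ (r + 1) + Δ ^ (2 * r - 1) * F ^ (2 * r + 1) := by
  rcases h with ⟨h1, h2⟩ | ⟨h1, h2⟩
  · exact le_add_right (pow_mul_pow_le hF hFΔ h1 (by omega))
  · exact le_add_left (pow_mul_pow_le hF hFΔ h1 (by omega))

variable [Fintype V]

lemma IsPairFamily.exists_determines_middle (h : IsPairFamily H π R r ev S c)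
    (hP : HasPattern ev S r I) (hB : IsBlocked H π R (2 * r + 1) F) (hF : 1 ≤ F)
    (hC : IsInterpolationConst (2 * r + 1) C) (hC1 : 1 ≤ C) (hΔ : HasDegreeLE H Δ) {p q : ℕ}
    (hg : IsMiddleGap I r p q)
    (hR : (p = r ∧ q = r + 1) ∨ ∃ i, p ≤ i ∧ i < q ∧ (p = r ∨ q = r + 1 → i ≠ r) ∧
      ∀ z ∈ S, R s(ev (true, r) z, ev (true, r + 1) z) s(ev (false, i) z, ev (false, i + 1) z)) :
    ∃ A B, ((p = r ∧ q = r + 1 ∧ A = 1 ∧ B = 0) ∨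
        (p < r ∧ r + 1 < q ∧ A = q - p - 2 ∧ B = q - p) ∨
        (∃ i, p < i ∧ i < r ∧ A = i - p + (q - r - 1) ∧ B = 2 * (r - p) + (q - r - 1) - (i - p)) ∨
        (p < r ∧ A = 1 + (q - r - 1) ∧ B = 2 * (r - p) + (q - r - 1) - 1) ∨
        (∃ i, r < i ∧ i + 1 < q ∧ A = q - i - 1 + (r - p) ∧
          B = 2 * (q - r - 1) + (r - p) - (q - i - 1)) ∨
        (r + 1 < q ∧ A = 1 + (r - p) ∧ B = 2 * (q - r - 1) + (r - p) - 1)) ∧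
      Determines ev S ∅ (Seg true p q ∪ Seg false p q)
        (2 * C ^ 2 * Fintype.card V * (Δ ^ A * F ^ B)) := by
  obtain ⟨hpr, hrq, hq, hIp, hIq, hgap⟩ := hg
  rcases hR with ⟨rfl, rfl⟩ | ⟨i, hpi, hiq, hne, hR⟩
  · refine ⟨1, 0, Or.inl ⟨rfl, rfl, rfl, rfl⟩, ?_⟩
    have d := (h.determines_middle_edge hΔ).extend
      (hP.determines_other true (p := p) (q := p + 1) hq fun i h1 h2 => by
        rcases (by omega : i = p ∨ i = p + 1) with rfl | rfl <;> assumption) subset_rfl subset_rfl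
    refine d.mono subset_rfl subset_rfl subset_rfl ?_
    simp only [pow_one, pow_zero, mul_one]
    refine Nat.mul_le_mul_right _ (Nat.le_mul_of_pos_left _ ?_)
    positivity
  · rcases lt_trichotomy i r with hir | rfl | hir
    · obtain ⟨A, B, hAB, d⟩ := h.determines_middle_left hP hB hF hC hΔ (p := p) (q := q)
        (by omega) hrq hq hIp hIq (hgap _ (by omega) (by omega)) hpi hir hR
      refine ⟨A, B, ?_, d⟩
      rcases hAB with ⟨h1, h2, h3⟩ | ⟨h1, h2⟩
      · exact Or.inr (Or.inr (Or.inl ⟨i, h1, hir, h2, h3⟩))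
      · exact Or.inr (Or.inr (Or.inr (Or.inl ⟨by omega, h1, h2⟩)))
    · have hp : p ≠ i := fun h => hne (Or.inl h) rfl
      have hq1 : q ≠ i + 1 := fun h => hne (Or.inr h) rfl
      exact ⟨_, _, Or.inr (Or.inl ⟨by omega, by omega, rfl, rfl⟩),
        h.determines_middle_mid hP hB hF hC hΔ (by omega) (by omega) hq hIp hIq
          (hgap _ (by omega) (by omega)) (hgap _ (by omega) (by omega)) hR⟩
    · obtain ⟨A, B, hAB, d⟩ := h.determines_middle_right hP hB hF hC hΔ (p := p) (q := q)
        hpr (by omega) hq hIp hIq (hgap _ (by omega) (by omega)) hir hiq hR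
      refine ⟨A, B, ?_, d⟩
      rcases hAB with ⟨h1, h2, h3⟩ | ⟨h1, h2⟩
      · exact Or.inr (Or.inr (Or.inr (Or.inr (Or.inl ⟨i, hir, h1, h2, h3⟩))))
      · exact Or.inr (Or.inr (Or.inr (Or.inr (Or.inr ⟨by omega, h1, h2⟩))))

lemma IsPairFamily.card_le (h : IsPairFamily H π R r ev S c)
    (hP : HasPattern ev S r I) (hB : IsBlocked H π R (2 * r + 1) F) (hF : 1 ≤ F)
    (hC : IsInterpolationConst (2 * r + 1) C) (hC1 : 1 ≤ C) (hΔ : HasDegreeLE H Δ)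
    (hFΔ : F ≤ Δ) (hr : 1 ≤ r) (h0 : I 0) (hk : I (2 * r + 1)) (hI : ∃ i ≤ 2 * r + 1, ¬ I i)
    {p q : ℕ} (hg : IsMiddleGap I r p q)
    (hR : (p = r ∧ q = r + 1) ∨ ∃ i, p ≤ i ∧ i < q ∧ (p = r ∨ q = r + 1 → i ≠ r) ∧
      ∀ z ∈ S, R s(ev (true, r) z, ev (true, r + 1) z) s(ev (false, i) z, ev (false, i + 1) z))
    (hsep : ∀ z ∈ S, ∀ z' ∈ S, (∀ b, ∀ i ≤ 2 * r + 1, ev (b, i) z = ev (b, i) z') → z = z') :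
    S.card ≤ 2 * C ^ 4 * Fintype.card V *
      (Δ ^ (2 * r) * F ^ (r + 1) + Δ ^ (2 * r - 1) * F ^ (2 * r + 1)) := by
  obtain ⟨A, B, hAB, d⟩ := h.exists_determines_middle hP hB hF hC hC1 hΔ hg hR
  obtain ⟨A₁, B₁, hAB₁, d₁⟩ := h.determines_left_end hP hB hF hC hΔ hC1 hg.le h0 hg.left
  obtain ⟨A₂, B₂, hAB₂, d₂⟩ := h.determines_right_end hP hB hF hC hΔ hC1 hg.ge hg.q_le hk hg.right
  obtain ⟨hpr, hrq, hq, -, -, -⟩ := hg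
  have d' := (d.extend d₁ (by grind [mem_Seg]) subset_rfl).extend d₂ (by grind [mem_Seg])
    (A₄ := Seg true 0 (2 * r + 1) ∪ Seg false 0 (2 * r + 1)) (by grind [mem_Seg])
  refine (d'.card_le fun z hz z' hz' hzz => hsep z hz z' hz' fun b i hi => hzz (b, i) ?_).trans ?_
  · grind [mem_Seg]
  · have hall : ¬ ((∀ i ≤ p, I i) ∧ (∀ i, q ≤ i → i ≤ 2 * r + 1 → I i) ∧ p = r ∧ q = r + 1) := by
      rintro ⟨h1, h2, rfl, rfl⟩
      obtain ⟨i, hi, hIi⟩ := hI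
      rcases Nat.lt_or_ge p i with h | h
      · exact hIi (h2 i h hi)
      · exact hIi (h1 i h)
    have harith : ((A + A₁ + A₂ ≤ 2 * r ∧ A + A₁ + A₂ + (B + B₁ + B₂) ≤ 3 * r + 1) ∨
        (A + A₁ + A₂ ≤ 2 * r - 1 ∧ A + A₁ + A₂ + (B + B₁ + B₂) ≤ 4 * r)) := by
      rcases hAB₁ with ⟨h1, h2, h3⟩ | ⟨h1, h2, h3⟩ <;> rcases hAB₂ with ⟨h4, h5, h6⟩ | ⟨h4, h5, h6⟩
      · have hall' : ¬ (p = r ∧ q = r + 1) := fun hh => hall ⟨h3, h6, hh.1, hh.2⟩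
        rcases hAB with h7 | h7 | ⟨i, h7⟩ | h7 | ⟨i, h7⟩ | h7 <;> omega
      all_goals
        clear hall
        rcases hAB with h7 | h7 | ⟨i, h7⟩ | h7 | ⟨i, h7⟩ | h7 <;> omega
    calc 2 * C ^ 2 * Fintype.card V * (Δ ^ A * F ^ B) * (C * (Δ ^ A₁ * F ^ B₁)) *
          (C * (Δ ^ A₂ * F ^ B₂))
        = 2 * C ^ 4 * Fintype.card V * (Δ ^ (A + A₁ + A₂) * F ^ (B + B₁ + B₂)) := by
          simp only [pow_add]
          ring
      _ ≤ _ := Nat.mul_le_mul_left _ (pow_mul_pow_le_sum hF hFΔ hr harith)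

end PairCount

section PathCount

variable {V W : Type} {H : SimpleGraph V} {π : Sym2 V → ℕ} {R : Sym2 V → Sym2 V → Prop}
  {r F Δ C : ℕ} {c : V → ℕ}

lemma IsChainPath.rank_le_middle {x : ℕ → V} (h : IsChainPath H π R r x) {l : ℕ}
    (hl : l < 2 * r + 1) : π (stepEdge x l) ≤ π (stepEdge x r) := by
  rcases lt_trichotomy l r with h1 | rfl | h1
  · exact (h.up l r h1 le_rfl).le
  · exact le_rfl
  · exact (h.down r l le_rfl h1 hl).le

lemma stepEdge_shift (a : ℕ → V) (p l : ℕ) :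
    stepEdge (fun i => a (p + i)) l = stepEdge a (p + l) := rfl

/-- The middle edge of one of two chain paths meeting around it has a partner on the other one. -/
lemma IsChainPath.exists_partner (hB : IsBlocked H π R (2 * r + 1) F) {x y : ℕ → V}
    (hx : IsChainPath H π R r x) (hy : IsChainPath H π R r y)
    (hcx : ∀ i ≤ 2 * r + 1, c (x i) = i) (hcy : ∀ i ≤ 2 * r + 1, c (y i) = i)
    (hπ : π (stepEdge y r) ≤ π (stepEdge x r)) {p q : ℕ}
    (hg : IsMiddleGap (fun i => x i = y i) r p q) :
    (p = r ∧ q = r + 1) ∨ ∃ i, p ≤ i ∧ i < q ∧ (p = r ∨ q = r + 1 → i ≠ r) ∧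
      R (stepEdge x r) (stepEdge y i) := by
  obtain ⟨hp, hq, hq', hl, hr, hgap⟩ := hg
  by_cases htriv : p = r ∧ q = r + 1
  · exact Or.inl htriv
  right
  have hbub : IsBubble H (fun i => x (p + i)) (fun i => y (p + i)) (q - p) :=
    { adj_left := fun i hi => hx.adj (p + i) (by omega)
      adj_right := fun i hi => hy.adj (p + i) (by omega)
      inj_left := fun i hi j hj hij => by
        have := hx.inj _ (by omega) _ (by omega) hij
        omega
      inj_right := fun i hi j hj hij => by
        have := hy.inj _ (by omega) _ (by omega) hij
        omega
      align := fun i hi j hj hij => by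
        have h1 := hcx (p + i) (by omega)
        have h2 := hcy (p + j) (by omega)
        rw [show x (p + i) = y (p + j) from hij, h2] at h1
        omega
      zero := hl
      last := by
        have : p + (q - p) = q := by omega
        simpa only [this] using hr
      ne := fun i h1 h2 => hgap (p + i) (by omega) (by omega)
      two_le := by omega }
  have hm : r - p < q - p := by omega
  have hpr : p + (r - p) = r := by omega
  have ha : ∀ l < q - p, π (stepEdge (fun i => x (p + i)) l) ≤
      π (stepEdge (fun i => x (p + i)) (r - p)) := fun l hl => by
    rw [stepEdge_shift, stepEdge_shift, hpr]
    exact hx.rank_le_middle (by omega)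
  have hb : ∀ l < q - p, π (stepEdge (fun i => y (p + i)) l) ≤
      π (stepEdge (fun i => x (p + i)) (r - p)) := fun l hl => by
    rw [stepEdge_shift, stepEdge_shift, hpr]
    exact (hy.rank_le_middle (by omega)).trans hπ
  have hc : ∀ l < q - p, ¬ R (stepEdge (fun i => x (p + i)) (r - p))
      (stepEdge (fun i => x (p + i)) l) := fun l hl => by
    rw [stepEdge_shift, stepEdge_shift, hpr]
    exact hx.not_related hB hp (by omega) hq' (fun l _ h2 => hx.rank_le_middle (by omega))
      (by omega) (by omega)
  by_cases hside : p = r ∨ q = r + 1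
  · obtain ⟨l, hl, hli, hR⟩ := hbub.exists_partner_ne hB hm ha hb (by omega) hc (r - p)
    rw [stepEdge_shift, stepEdge_shift, hpr] at hR
    exact ⟨p + l, by omega, by omega, by omega, hR⟩
  · obtain ⟨l, hl, hR⟩ := hbub.exists_partner hB hm ha hb (by omega) hc
    rw [stepEdge_shift, stepEdge_shift, hpr] at hR
    exact ⟨p + l, by omega, by omega, by omega, hR⟩

variable {u : W → ℕ → V} {P : Finset W}

open Classical in
/-- Pairs of distinct chain paths with the same ends, the first one having the later middle edge. -/
noncomputable def meetingPairs (π : Sym2 V → ℕ) (r : ℕ) (u : W → ℕ → V) (P : Finset W) :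
    Finset (W × W) :=
  {z ∈ P ×ˢ P | u z.1 0 = u z.2 0 ∧ u z.1 (2 * r + 1) = u z.2 (2 * r + 1) ∧ z.1 ≠ z.2 ∧
    π (stepEdge (u z.2) r) ≤ π (stepEdge (u z.1) r)}

variable [Fintype V]

lemma card_meetingPairs_le (hB : IsBlocked H π R (2 * r + 1) F) (hF : 1 ≤ F)
    (hC : IsInterpolationConst (2 * r + 1) C) (hC1 : 1 ≤ C) (hΔ : HasDegreeLE H Δ)
    (hFΔ : F ≤ Δ) (hr : 1 ≤ r) (hP : ∀ x ∈ P, IsChainPath H π R r (u x))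
    (hc : ∀ x ∈ P, ∀ i ≤ 2 * r + 1, c (u x i) = i)
    (hsep : ∀ x ∈ P, ∀ y ∈ P, (∀ i ≤ 2 * r + 1, u x i = u y i) → x = y) :
    (meetingPairs π r u P).card ≤ 2 ^ (2 * r + 2) * (2 * r + 1) *
      (2 * C ^ 4 * Fintype.card V *
        (Δ ^ (2 * r) * F ^ (r + 1) + Δ ^ (2 * r - 1) * F ^ (2 * r + 1))) := by
  classical
  set ev : Bool × ℕ → W × W → V := fun j z => cond j.1 (u z.1 j.2) (u z.2 j.2) with hev
  let cls : Finset ℕ × ℕ → Finset (W × W) := fun a =>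
    {z ∈ meetingPairs π r u P | (∀ i ≤ 2 * r + 1, u z.1 i = u z.2 i ↔ i ∈ a.1) ∧
      ∀ p q, IsMiddleGap (fun i => u z.1 i = u z.2 i) r p q → (p = r ∧ q = r + 1) ∨
        (p ≤ a.2 ∧ a.2 < q ∧ (p = r ∨ q = r + 1 → a.2 ≠ r) ∧
          R (stepEdge (u z.1) r) (stepEdge (u z.2) a.2))}
  have hsub : meetingPairs π r u P ⊆
      ((Finset.range (2 * r + 2)).powerset ×ˢ Finset.range (2 * r + 1)).biUnion cls := by
    intro z hz
    have hz' := hz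
    simp only [meetingPairs, Finset.mem_filter, Finset.mem_product] at hz'
    obtain ⟨⟨h1, h2⟩, h3, h4, h5, h6⟩ := hz'
    have hpat : ∀ i ≤ 2 * r + 1, u z.1 i = u z.2 i ↔
        i ∈ (Finset.range (2 * r + 2)).filter (fun i => u z.1 i = u z.2 i) := fun i hi => by
      simp only [Finset.mem_filter, Finset.mem_range]
      exact ⟨fun h => ⟨by omega, h⟩, fun h => h.2⟩
    obtain ⟨p, q, hg⟩ := exists_isMiddleGap (I := fun i => u z.1 i = u z.2 i) (r := r) h3 h4
    have huniq : ∀ p' q', IsMiddleGap (fun i => u z.1 i = u z.2 i) r p' q' → p' = p ∧ q' = q := by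
      intro p' q' hg'
      obtain ⟨a1, a2, a3, a4, a5, a6⟩ := hg
      obtain ⟨b1, b2, b3, b4, b5, b6⟩ := hg'
      constructor
      · rcases lt_trichotomy p' p with h | h | h
        · exact absurd a4 (b6 p h (by omega))
        · exact h
        · exact absurd b4 (a6 p' h (by omega))
      · rcases lt_trichotomy q' q with h | h | h
        · exact absurd b5 (a6 q' (by omega) h)
        · exact h
        · exact absurd a5 (b6 q (by omega) h)
    have := (hP _ h1).exists_partner hB (hP _ h2) (hc _ h1) (hc _ h2) h6 hg
    rw [Finset.mem_biUnion]
    rcases this with h | ⟨o, ho1, ho2, ho3, ho4⟩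
    · refine ⟨(_, 0), Finset.mem_product.2 ⟨Finset.mem_powerset.2 (Finset.filter_subset _ _),
        Finset.mem_range.2 (by omega)⟩, Finset.mem_filter.2 ⟨hz, hpat, fun p' q' hg' => ?_⟩⟩
      obtain ⟨rfl, rfl⟩ := huniq p' q' hg'
      exact Or.inl h
    · refine ⟨(_, o), Finset.mem_product.2 ⟨Finset.mem_powerset.2 (Finset.filter_subset _ _),
        Finset.mem_range.2 (by have := hg.q_le; omega)⟩,
        Finset.mem_filter.2 ⟨hz, hpat, fun p' q' hg' => ?_⟩⟩
      obtain ⟨rfl, rfl⟩ := huniq p' q' hg'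
      exact Or.inr ⟨ho1, ho2, ho3, ho4⟩
  refine (Finset.card_le_card hsub).trans ((Finset.card_biUnion_le_card_mul _ _
    (2 * C ^ 4 * Fintype.card V *
      (Δ ^ (2 * r) * F ^ (r + 1) + Δ ^ (2 * r - 1) * F ^ (2 * r + 1))) ?_).trans ?_)
  · rintro ⟨I, o⟩ -
    rcases (cls (I, o)).eq_empty_or_nonempty with hem | ⟨z₀, hz₀⟩
    · rw [hem]
      simp
    have hmem : ∀ z ∈ cls (I, o), z.1 ∈ P ∧ z.2 ∈ P ∧ u z.1 0 = u z.2 0 ∧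
        u z.1 (2 * r + 1) = u z.2 (2 * r + 1) ∧ z.1 ≠ z.2 := fun z hz => by
      have := (Finset.mem_filter.1 hz).1
      simp only [meetingPairs, Finset.mem_filter, Finset.mem_product] at this
      tauto
    have hpat : ∀ z ∈ cls (I, o), ∀ i ≤ 2 * r + 1, u z.1 i = u z.2 i ↔ i ∈ I := fun z hz =>
      (Finset.mem_filter.1 hz).2.1
    obtain ⟨-, -, h0, hk, -⟩ := hmem z₀ hz₀
    have h0I := (hpat z₀ hz₀ 0 (by omega)).1 h0
    have hkI := (hpat z₀ hz₀ (2 * r + 1) le_rfl).1 hk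
    obtain ⟨p, q, hg⟩ := exists_isMiddleGap (I := (· ∈ I)) h0I hkI
    have hgz : ∀ z ∈ cls (I, o), IsMiddleGap (fun i => u z.1 i = u z.2 i) r p q := fun z hz =>
      ⟨hg.le, hg.ge, hg.q_le, (hpat z hz p (by have := hg.le; omega)).2 hg.left,
        (hpat z hz q hg.q_le).2 hg.right, fun t h1 h2 h =>
          hg.gap t h1 h2 ((hpat z hz t (by have := hg.q_le; omega)).1 h)⟩
    refine IsPairFamily.card_le (ev := ev) (c := c) (I := (· ∈ I)) ⟨?_, ?_⟩ ?_ hB hF hC hC1 hΔ hFΔ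
      hr h0I hkI ?_ hg ?_ ?_
    · rintro (_ | _) z hz
      · exact hP _ (hmem z hz).2.1
      · exact hP _ (hmem z hz).1
    · rintro (_ | _) z hz
      · exact hc _ (hmem z hz).2.1
      · exact hc _ (hmem z hz).1
    · rintro (_ | _) z hz i hi
      · exact eq_comm.trans (hpat z hz i hi)
      · exact hpat z hz i hi
    · by_contra! hcon
      obtain ⟨h1, h2, -, -, h5⟩ := hmem z₀ hz₀
      exact h5 (hsep _ h1 _ h2 fun i hi => (hpat z₀ hz₀ i hi).2 (hcon i hi))
    · have hR := fun z (hz : z ∈ cls (I, o)) => (Finset.mem_filter.1 hz).2.2 p q (hgz z hz)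
      by_cases ht : p = r ∧ q = r + 1
      · exact Or.inl ht
      · right
        have hR' := fun z (hz : z ∈ cls (I, o)) => (hR z hz).resolve_left ht
        exact ⟨o, (hR' z₀ hz₀).1, (hR' z₀ hz₀).2.1, (hR' z₀ hz₀).2.2.1,
          fun z hz => (hR' z hz).2.2.2⟩
    · intro z hz z' hz' h
      exact Prod.ext (hsep _ (hmem z hz).1 _ (hmem z' hz').1 (h true))
        (hsep _ (hmem z hz).2.1 _ (hmem z' hz').2.1 (h false))
  · rw [Finset.card_product, Finset.card_powerset, Finset.card_range, Finset.card_range]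

/-- The number of properly coloured chain paths. -/
lemma card_chainPaths_le (hB : IsBlocked H π R (2 * r + 1) F) (hF : 1 ≤ F)
    (hC : IsInterpolationConst (2 * r + 1) C) (hC1 : 1 ≤ C) (hΔ : HasDegreeLE H Δ)
    (hFΔ : F ≤ Δ) (hr : 1 ≤ r) (hP : ∀ x ∈ P, IsChainPath H π R r (u x))
    (hc : ∀ x ∈ P, ∀ i ≤ 2 * r + 1, c (u x i) = i)
    (hsep : ∀ x ∈ P, ∀ y ∈ P, (∀ i ≤ 2 * r + 1, u x i = u y i) → x = y) :
    P.card ^ 2 ≤ Fintype.card V ^ 2 * (P.card + 2 * (2 ^ (2 * r + 2) * (2 * r + 1) *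
      (2 * C ^ 4 * Fintype.card V *
        (Δ ^ (2 * r) * F ^ (r + 1) + Δ ^ (2 * r - 1) * F ^ (2 * r + 1))))) := by
  classical
  let g : W → V × V := fun x => (u x 0, u x (2 * r + 1))
  have h1 : P.card ^ 2 ≤ Fintype.card V ^ 2 * ((P ×ˢ P).filter fun z => g z.1 = g z.2).card := by
    have hcard : P.card = ∑ a : V × V, (P.filter fun x => g x = a).card :=
      Finset.card_eq_sum_card_fiberwise fun x _ => Finset.mem_univ _
    have hpairs : ((P ×ˢ P).filter fun z => g z.1 = g z.2).card =
        ∑ a : V × V, (P.filter fun x => g x = a).card ^ 2 := by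
      rw [Finset.card_eq_sum_card_fiberwise (f := fun z => g z.1) (t := Finset.univ)
        fun x _ => Finset.mem_univ _]
      refine Finset.sum_congr rfl fun a _ => ?_
      rw [sq, ← Finset.card_product]
      congr 1
      ext ⟨x, y⟩
      simp only [Finset.mem_filter, Finset.mem_product]
      constructor
      · rintro ⟨⟨⟨hx, hy⟩, h⟩, rfl⟩
        exact ⟨⟨hx, rfl⟩, hy, h.symm⟩
      · rintro ⟨⟨hx, rfl⟩, hy, h⟩
        exact ⟨⟨⟨hx, hy⟩, h.symm⟩, rfl⟩
    have := sq_sum_le_card_mul_sum_sq (s := (Finset.univ : Finset (V × V)))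
      (f := fun a => (P.filter fun x => g x = a).card)
    rw [hpairs, hcard]
    simpa [Finset.card_univ, Fintype.card_prod, sq] using this
  refine h1.trans (Nat.mul_le_mul_left _ ?_)
  have h2 : ((P ×ˢ P).filter fun z => g z.1 = g z.2) ⊆
      P.image (fun x => (x, x)) ∪ (meetingPairs π r u P ∪ (meetingPairs π r u P).image Prod.swap) := by
    rintro ⟨x, y⟩ hz
    simp only [Finset.mem_filter, Finset.mem_product, g, Prod.mk.injEq] at hz
    obtain ⟨⟨hx, hy⟩, h3, h4⟩ := hz
    simp only [Finset.mem_union, Finset.mem_image, meetingPairs, Finset.mem_filter,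
      Finset.mem_product, Prod.exists, Prod.swap_prod_mk, Prod.mk.injEq]
    by_cases hxy : x = y
    · exact Or.inl ⟨x, hx, rfl, hxy⟩
    · rcases Nat.le_total (π (stepEdge (u y) r)) (π (stepEdge (u x) r)) with h | h
      · exact Or.inr (Or.inl ⟨⟨hx, hy⟩, h3, h4, hxy, h⟩)
      · exact Or.inr (Or.inr ⟨y, x, ⟨⟨hy, hx⟩, h3.symm, h4.symm, Ne.symm hxy, h⟩, rfl, rfl⟩)
  have h3 := card_meetingPairs_le hB hF hC hC1 hΔ hFΔ hr hP hc hsep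
  calc _ ≤ _ := Finset.card_le_card h2
    _ ≤ P.card + ((meetingPairs π r u P).card + (meetingPairs π r u P).card) := by
        refine (Finset.card_union_le _ _).trans (Nat.add_le_add Finset.card_image_le ?_)
        exact (Finset.card_union_le _ _).trans (Nat.add_le_add le_rfl Finset.card_image_le)
    _ ≤ _ := by omega

end PathCount

section ChainCount

variable {V : Type} {H : SimpleGraph V} {π : Sym2 V → ℕ} {R : Sym2 V → Sym2 V → Prop}
  {r F D a b : ℕ} {Lev : ℕ → Finset (Sym2 V)}

/-- A chain path restricted to the edges with index between `a` and `b`, where the edge at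
distance `d` from the ends lies in `Lev d`. -/
structure IsPartialChain (π : Sym2 V → ℕ) (R : Sym2 V → Sym2 V → Prop) (r : ℕ)
    (Lev : ℕ → Finset (Sym2 V)) (a b : ℕ) (x : ℕ → V) : Prop where
  lev : ∀ i, a ≤ i → i ≤ b → stepEdge x i ∈ Lev (min i (2 * r - i))
  inj : ∀ i j, a ≤ i → i ≤ b + 1 → a ≤ j → j ≤ b + 1 → x i = x j → i = j
  up : ∀ i j, a ≤ i → i < j → j ≤ r → π (stepEdge x i) < π (stepEdge x j)
  down : ∀ i j, r ≤ i → i < j → j ≤ b → π (stepEdge x j) < π (stepEdge x i)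
  free_left : ∀ i j, a ≤ j → j < i → i ≤ r → ∀ e, R (stepEdge x i) e → x j ∉ e
  free_right : ∀ i j, r ≤ i → i + 2 ≤ j → j ≤ b + 1 → ∀ e, R (stepEdge x i) e → x j ∉ e

lemma IsPartialChain.isChainPath {x : ℕ → V} (h : IsPartialChain π R r Lev 0 (2 * r) x)
    (hLev : ∀ j, ∀ e ∈ Lev j, e ∈ H.edgeSet) : IsChainPath H π R r x where
  adj i hi := hLev _ _ (h.lev i (by omega) (by omega))
  inj i hi j hj := h.inj i j (by omega) (by omega) (by omega) (by omega)
  up i j h1 h2 := h.up i j (by omega) h1 h2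
  down i j h1 h2 h3 := h.down i j h1 h2 (by omega)
  free_left i j h1 h2 := h.free_left i j (by omega) h1 h2
  free_right i j h1 h2 h3 := h.free_right i j h1 h2 (by omega)

/-- Reversal of a vertex sequence of length `n + 1`. -/
def revSeq (n : ℕ) (d : V) (x : ℕ → V) (i : ℕ) : V := if i ≤ n then x (n - i) else d

lemma stepEdge_revSeq (d : V) (x : ℕ → V) {n i : ℕ} (hi : i < n) :
    stepEdge (revSeq n d x) i = stepEdge x (n - 1 - i) := by
  rw [← stepEdge_mirror x hi, stepEdge, stepEdge, revSeq, revSeq, if_pos (by omega),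
    if_pos (by omega)]

lemma IsPartialChain.rev {x : ℕ → V} (h : IsPartialChain π R r Lev a b x) (d : V)
    (ha : a ≤ 2 * r) (hb : b ≤ 2 * r) :
    IsPartialChain π R r Lev (2 * r - b) (2 * r - a) (revSeq (2 * r + 1) d x) where
  lev i h1 h2 := by
    rw [stepEdge_revSeq _ _ (by omega)]
    have := h.lev (2 * r - i) (by omega) (by omega)
    rwa [show 2 * r - (2 * r - i) = i by omega, min_comm] at this
  inj i j h1 h2 h3 h4 hij := by
    rw [revSeq, revSeq, if_pos (by omega), if_pos (by omega)] at hij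
    have := h.inj _ _ (by omega) (by omega) (by omega) (by omega) hij
    omega
  up i j h1 h2 h3 := by
    rw [stepEdge_revSeq _ _ (by omega), stepEdge_revSeq _ _ (by omega)]
    exact h.down _ _ (by omega) (by omega) (by omega)
  down i j h1 h2 h3 := by
    rw [stepEdge_revSeq _ _ (by omega), stepEdge_revSeq _ _ (by omega)]
    exact h.up _ _ (by omega) (by omega) (by omega)
  free_left i j h1 h2 h3 e he := by
    rw [stepEdge_revSeq _ _ (by omega)] at he
    rw [revSeq, if_pos (by omega)]
    exact h.free_right _ _ (by omega) (by omega) (by omega) e he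
  free_right i j h1 h2 h3 e he := by
    rw [stepEdge_revSeq _ _ (by omega)] at he
    rw [revSeq, if_pos (by omega)]
    exact h.free_left _ _ (by omega) (by omega) (by omega) e he

lemma stepEdge_update_of_lt (x : ℕ → V) {v : V} {i : ℕ} (h : a < i) :
    stepEdge (Function.update x a v) i = stepEdge x i := by
  rw [stepEdge, stepEdge, Function.update_of_ne (by omega), Function.update_of_ne (by omega)]

lemma stepEdge_update_self (x : ℕ → V) {v : V} :
    stepEdge (Function.update x a v) a = s(v, x (a + 1)) := by
  rw [stepEdge, Function.update_self, Function.update_of_ne (by omega)]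

lemma IsPartialChain.update {x : ℕ → V} (h : IsPartialChain π R r Lev (a + 1) b x) (ha : a + 1 ≤ r)
    {v : V} (hv : s(x (a + 1), v) ∈ Lev a)
    (hπ : π s(x (a + 1), v) < π (stepEdge x (a + 1)))
    (hinj : ∀ i, a + 1 ≤ i → i ≤ b + 1 → v ≠ x i)
    (hfree : ∀ i, a + 1 ≤ i → i ≤ r → ∀ e, R (stepEdge x i) e → v ∉ e) :
    IsPartialChain π R r Lev a b (Function.update x a v) where
  lev i h1 h2 := by
    rcases h1.eq_or_lt with rfl | h1
    · rw [stepEdge_update_self, Sym2.eq_swap, min_eq_left (by omega)]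
      exact hv
    · rw [stepEdge_update_of_lt _ h1]
      exact h.lev i h1 h2
  inj i j h1 h2 h3 h4 hij := by
    rcases h1.eq_or_lt with rfl | h1 <;> rcases h3.eq_or_lt with rfl | h3
    · rfl
    · rw [Function.update_self, Function.update_of_ne (by omega)] at hij
      exact absurd hij (hinj j h3 h4)
    · rw [Function.update_self, Function.update_of_ne (by omega)] at hij
      exact absurd hij.symm (hinj i h1 h2)
    · rw [Function.update_of_ne (by omega), Function.update_of_ne (by omega)] at hij
      exact h.inj i j h1 h2 h3 h4 hij
  up i j h1 h2 h3 := by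
    rw [stepEdge_update_of_lt _ (by omega : a < j)]
    rcases h1.eq_or_lt with rfl | h1
    · rw [stepEdge_update_self, Sym2.eq_swap]
      rcases Nat.eq_or_lt_of_le (show a + 1 ≤ j by omega) with rfl | h4
      · exact hπ
      · exact hπ.trans (h.up _ _ le_rfl h4 h3)
    · rw [stepEdge_update_of_lt _ h1]
      exact h.up i j h1 h2 h3
  down i j h1 h2 h3 := by
    rw [stepEdge_update_of_lt _ (by omega), stepEdge_update_of_lt _ (by omega)]
    exact h.down i j h1 h2 h3
  free_left i j h1 h2 h3 e he := by
    rw [stepEdge_update_of_lt _ (by omega)] at he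
    rcases h1.eq_or_lt with rfl | h1
    · rw [Function.update_self]
      exact hfree i h2 h3 e he
    · rw [Function.update_of_ne (by omega)]
      exact h.free_left i j h1 h2 h3 e he
  free_right i j h1 h2 h3 e he := by
    rw [stepEdge_update_of_lt _ (by omega)] at he
    rw [Function.update_of_ne (by omega)]
    exact h.free_right i j h1 h2 h3 e he

lemma exists_extensions [DecidableEq (ℕ → V)] {T : Finset (ℕ → V)} {d : V} {i : ℕ}
    (hT : ∀ x ∈ T, x i = d) (N : (ℕ → V) → Finset V) (hN : ∀ x ∈ T, D ≤ (N x).card) :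
    T.card * D ≤ (T.biUnion fun x => (N x).image (Function.update x i)).card := by
  rw [Finset.card_biUnion]
  · rw [← smul_eq_mul]
    refine Finset.card_nsmul_le_sum _ _ _ fun x hx => ?_
    rw [Finset.card_image_of_injective _ (Function.update_injective x i)]
    exact hN x hx
  · intro x hx y hy hxy
    refine Finset.disjoint_left.2 ?_
    intro z hz hz'
    obtain ⟨v, -, rfl⟩ := Finset.mem_image.1 hz
    obtain ⟨v', -, h⟩ := Finset.mem_image.1 hz'
    apply hxy
    funext j
    by_cases hj : j = i
    · rw [hj, hT x hx, hT y hy]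
    · have := congrFun h j
      rw [Function.update_of_ne hj, Function.update_of_ne hj] at this
      exact this.symm

/-- A finite set of partial chain paths, constant outside of the relevant positions. -/
def IsPartialSet (π : Sym2 V → ℕ) (R : Sym2 V → Sym2 V → Prop) (r : ℕ)
    (Lev : ℕ → Finset (Sym2 V)) (d : V) (a b : ℕ) (T : Finset (ℕ → V)) : Prop :=
  ∀ x ∈ T, IsPartialChain π R r Lev a b x ∧ ∀ i, i < a ∨ b + 1 < i → x i = d

section Extend

variable [Fintype V] {k M : ℕ} {d : V} {T : Finset (ℕ → V)}

open Classical in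
/-- Every edge of `Lev (j + 1)` is at both ends adjacent to `M` earlier edges of `Lev j`. -/
def IsLeveled (π : Sym2 V → ℕ) (Lev : ℕ → Finset (Sym2 V)) (M : ℕ) : Prop :=
  ∀ j, ∀ e ∈ Lev (j + 1), ∀ v ∈ e, M ≤ {u | s(v, u) ∈ Lev j ∧ π s(v, u) < π e}.toFinset.card

variable (hB : IsBlocked H π R k F) (hLev : ∀ j, ∀ e ∈ Lev j, e ∈ H.edgeSet)
  (hM : IsLeveled π Lev (D + (2 * r + 1 + r * (2 * F))))

include hB hLev hM

lemma IsPartialSet.exists_extend (hT : IsPartialSet π R r Lev d (a + 1) b T) (ha : a + 1 ≤ r)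
    (hb : r ≤ b) (hb' : b ≤ 2 * r) :
    ∃ T', IsPartialSet π R r Lev d a b T' ∧ T.card * D ≤ T'.card := by
  classical
  have hforb : ∀ x ∈ T, ∃ s : Finset V, s.card ≤ 2 * r + 1 + r * (2 * F) ∧
      (∀ i, a + 1 ≤ i → i ≤ b + 1 → x i ∈ s) ∧
      ∀ i, a + 1 ≤ i → i ≤ r → ∀ v e, R (stepEdge x i) e → v ∈ e → v ∈ s := by
    intro x hx
    have hmem : ∀ i, a + 1 ≤ i → i ≤ r → stepEdge x i ∈ H.edgeSet := fun i h1 h2 =>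
      hLev _ _ ((hT x hx).1.lev i h1 (by omega))
    have hs : ∀ i, ∃ s : Finset V, s.card ≤ 2 * F ∧
        (a + 1 ≤ i → i ≤ r → ∀ v e, R (stepEdge x i) e → v ∈ e → v ∈ s) := by
      intro i
      by_cases hi : a + 1 ≤ i ∧ i ≤ r
      · obtain ⟨s, hs, hs'⟩ := hB.few_pairs (hmem i hi.1 hi.2)
        refine ⟨s.image Prod.fst, Finset.card_image_le.trans hs, fun _ _ v e he hv => ?_⟩
        obtain ⟨v', rfl⟩ := hv
        exact Finset.mem_image.2 ⟨_, hs' _ _ he, rfl⟩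
      · exact ⟨∅, by simp, fun h1 h2 => absurd ⟨h1, h2⟩ hi⟩
    choose s hs hs' using hs
    refine ⟨(Finset.Icc (a + 1) (b + 1)).image x ∪ (Finset.Icc (a + 1) r).biUnion s, ?_, ?_, ?_⟩
    · refine (Finset.card_union_le _ _).trans (Nat.add_le_add (Finset.card_image_le.trans ?_)
        ((Finset.card_biUnion_le_card_mul _ _ (2 * F) fun i _ => hs i).trans ?_))
      · rw [Nat.card_Icc]
        omega
      · rw [Nat.card_Icc]
        exact Nat.mul_le_mul_right _ (by omega)
    · exact fun i h1 h2 => Finset.mem_union_left _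
        (Finset.mem_image_of_mem _ (Finset.mem_Icc.2 ⟨h1, h2⟩))
    · exact fun i h1 h2 v e he hv => Finset.mem_union_right _
        (Finset.mem_biUnion.2 ⟨i, Finset.mem_Icc.2 ⟨h1, h2⟩, hs' i h1 h2 v e he hv⟩)
  choose! s hs hs1 hs2 using hforb
  refine ⟨T.biUnion fun x => ({u | s(x (a + 1), u) ∈ Lev a ∧
    π s(x (a + 1), u) < π (stepEdge x (a + 1))}.toFinset \ s x).image (Function.update x a), ?_,
    exists_extensions (d := d) (fun x hx => (hT x hx).2 a (Or.inl (by omega))) _ fun x hx => ?_⟩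
  · intro y hy
    obtain ⟨x, hx, hy⟩ := Finset.mem_biUnion.1 hy
    obtain ⟨v, hv, rfl⟩ := Finset.mem_image.1 hy
    rw [Finset.mem_sdiff, Set.mem_toFinset] at hv
    obtain ⟨⟨hv1, hv2⟩, hv3⟩ := hv
    refine ⟨(hT x hx).1.update ha hv1 hv2 ?_ ?_, fun i hi => ?_⟩
    · rintro i h1 h2 rfl
      exact hv3 (hs1 x hx i h1 h2)
    · exact fun i h1 h2 e he hve => hv3 (hs2 x hx i h1 h2 v e he hve)
    · rw [Function.update_of_ne (by omega)]
      exact (hT x hx).2 i (by omega)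
  · have h1 := (hT x hx).1.lev (a + 1) le_rfl (by omega)
    rw [min_eq_left (by omega)] at h1
    have h2 := hM a _ h1 _ (left_mem_stepEdge x (a + 1))
    have h3 := Finset.le_card_sdiff (s x) {u | s(x (a + 1), u) ∈ Lev a ∧
      π s(x (a + 1), u) < π (stepEdge x (a + 1))}.toFinset
    have h4 := hs x hx
    omega

lemma IsPartialSet.exists_extend_zero (hT : IsPartialSet π R r Lev d a b T) (ha : a ≤ r)
    (hb : r ≤ b) (hb' : b ≤ 2 * r) :
    ∃ T', IsPartialSet π R r Lev d 0 b T' ∧ T.card * D ^ a ≤ T'.card := by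
  induction a generalizing T with
  | zero => exact ⟨T, hT, by simp⟩
  | succ a ih =>
    obtain ⟨T₁, hT₁, h₁⟩ := hT.exists_extend hB hLev hM ha hb hb'
    obtain ⟨T₂, hT₂, h₂⟩ := ih hT₁ (by omega)
    refine ⟨T₂, hT₂, le_trans ?_ h₂⟩
    calc T.card * D ^ (a + 1) = T.card * D * D ^ a := by ring
      _ ≤ _ := Nat.mul_le_mul_right _ h₁

/-- Chain paths exist in abundance. -/
lemma exists_chainPaths (d : V) : ∃ P : Finset (ℕ → V), (∀ x ∈ P, IsChainPath H π R r x) ∧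
    (∀ x ∈ P, ∀ y ∈ P, (∀ i ≤ 2 * r + 1, x i = y i) → x = y) ∧
    (Lev r).card * D ^ (2 * r) ≤ P.card := by
  classical
  let ini : Sym2 V → ℕ → V := fun e =>
    Function.update (Function.update (fun _ => d) r e.out.1) (r + 1) e.out.2
  have hini : ∀ e, stepEdge (ini e) r = e := fun e => by
    simp only [stepEdge, ini, Function.update_self]
    rw [Function.update_of_ne (by omega), Function.update_self]
    exact Quot.out_eq e
  have hT₀ : IsPartialSet π R r Lev d r r ((Lev r).image ini) := by
    intro x hx
    obtain ⟨e, he, rfl⟩ := Finset.mem_image.1 hx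
    have hne : ini e r ≠ ini e (r + 1) := by
      have h1 := hini e ▸ hLev _ _ he
      exact H.ne_of_adj h1
    refine ⟨⟨?_, ?_, ?_, ?_, ?_, ?_⟩, ?_⟩
    · intro i h1 h2
      obtain rfl : i = r := by omega
      rw [hini, min_eq_left (by omega)]
      exact he
    · intro i j h1 h2 h3 h4 hij
      rcases h1.eq_or_lt with rfl | h1 <;> rcases h3.eq_or_lt with rfl | h3
      · rfl
      · obtain rfl : j = r + 1 := by omega
        exact absurd hij hne
      · obtain rfl : i = r + 1 := by omega
        exact absurd hij.symm hne
      · omega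
    all_goals try (intros; omega)
    intro i hi
    simp only [ini]
    rw [Function.update_of_ne (by omega), Function.update_of_ne (by omega)]
  obtain ⟨T₁, hT₁, h₁⟩ := hT₀.exists_extend_zero hB hLev hM le_rfl le_rfl (by omega)
  have hrev : IsPartialSet π R r Lev d r (2 * r) (T₁.image (revSeq (2 * r + 1) d)) := by
    intro y hy
    obtain ⟨x, hx, rfl⟩ := Finset.mem_image.1 hy
    refine ⟨?_, fun i hi => ?_⟩
    · have := (hT₁ x hx).1.rev d (by omega) (by omega)
      rwa [show 2 * r - r = r by omega, Nat.sub_zero] at this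
    · rw [revSeq]
      split_ifs with h
      · exact (hT₁ x hx).2 _ (by omega)
      · rfl
  obtain ⟨T₂, hT₂, h₂⟩ := hrev.exists_extend_zero hB hLev hM le_rfl (by omega) le_rfl
  refine ⟨T₂, fun x hx => (hT₂ x hx).1.isChainPath hLev, fun x hx y hy h => ?_, ?_⟩
  · funext i
    rcases Nat.lt_or_ge (2 * r + 1) i with hi | hi
    · rw [(hT₂ x hx).2 i (by omega), (hT₂ y hy).2 i (by omega)]
    · exact h i hi
  · rw [Finset.card_image_of_injOn] at h₁ h₂
    · calc (Lev r).card * D ^ (2 * r) = (Lev r).card * D ^ r * D ^ r := by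
            rw [two_mul, pow_add, mul_assoc]
        _ ≤ T₁.card * D ^ r := Nat.mul_le_mul_right _ h₁
        _ ≤ _ := h₂
    · intro x hx y hy h
      funext i
      rcases Nat.lt_or_ge (2 * r + 1) i with hi | hi
      · rw [(hT₁ x hx).2 i (by omega), (hT₁ y hy).2 i (by omega)]
      · have := congrFun h (2 * r + 1 - i)
        rwa [revSeq, revSeq, if_pos (by omega), if_pos (by omega),
          show 2 * r + 1 - (2 * r + 1 - i) = i by omega] at this
    · intro e _ e' _ h
      rw [← hini e, ← hini e', h]

end Extend

end ChainCount

section Levels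

variable {V : Type} [Fintype V] {π : Sym2 V → ℕ} {E : Finset (Sym2 V)} {M : ℕ}

open Classical in
/-- Iteratively discard the edges which at one of their ends are preceded by fewer than `M`
edges. -/
noncomputable def levels (π : Sym2 V → ℕ) (E : Finset (Sym2 V)) (M : ℕ) : ℕ → Finset (Sym2 V)
  | 0 => E
  | j + 1 => {e ∈ levels π E M j |
      ∀ v ∈ e, M ≤ {u | s(v, u) ∈ levels π E M j ∧ π s(v, u) < π e}.toFinset.card}

lemma isLeveled_levels : IsLeveled π (levels π E M) M := by
  classical
  intro j e he v hv
  rw [levels, Finset.mem_filter] at he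
  convert he.2 v hv

lemma levels_subset (j : ℕ) : levels π E M j ⊆ E := by
  classical
  induction j with
  | zero => exact subset_rfl
  | succ j ih =>
    rw [levels]
    exact (Finset.filter_subset _ _).trans ih

lemma card_le_card_levels (hπ : ∀ e ∈ E, ∀ e' ∈ E, π e = π e' → e = e') (j : ℕ) :
    E.card ≤ (levels π E M j).card + j * (Fintype.card V * M) := by
  classical
  induction j with
  | zero => simp [levels]
  | succ j ih =>
    set L := levels π E M j with hL
    let bad : V → Finset (Sym2 V) := fun v => {e ∈ L | v ∈ e ∧
      ¬ M ≤ {u | s(v, u) ∈ L ∧ π s(v, u) < π e}.toFinset.card}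
    have hbad : ∀ v, (bad v).card ≤ M := by
      intro v
      rcases (bad v).eq_empty_or_nonempty with h | h
      · rw [h]
        simp
      obtain ⟨e, he, hmax⟩ := (bad v).exists_max_image π h
      have he' := Finset.mem_filter.1 he
      have hsub : bad v ⊆ insert e
          ({u | s(v, u) ∈ L ∧ π s(v, u) < π e}.toFinset.image fun u => s(v, u)) := by
        intro e' he₁
        have he₁' := Finset.mem_filter.1 he₁
        rw [Finset.mem_insert]
        by_cases heq : e' = e
        · exact Or.inl heq
        right
        obtain ⟨u, rfl⟩ := he₁'.2.1
        refine Finset.mem_image.2 ⟨u, Set.mem_toFinset.2 ⟨he₁'.1, ?_⟩, rfl⟩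
        exact lt_of_le_of_ne (hmax _ he₁) fun h' =>
          heq (hπ _ (levels_subset j he₁'.1) _ (levels_subset j he'.1) h')
      have h1 := (Finset.card_le_card hsub).trans (Finset.card_insert_le _ _)
      have h2 : ({u | s(v, u) ∈ L ∧ π s(v, u) < π e}.toFinset.image fun u => s(v, u)).card ≤ _ :=
        Finset.card_image_le
      have h3 := he'.2.2
      omega
    have hsub : L ⊆ levels π E M (j + 1) ∪ Finset.univ.biUnion bad := by
      intro e he
      by_cases h : e ∈ levels π E M (j + 1)
      · exact Finset.mem_union_left _ h
      · rw [levels, Finset.mem_filter] at h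
        have h' : ¬ ∀ v ∈ e, M ≤ {u | s(v, u) ∈ L ∧ π s(v, u) < π e}.toFinset.card := by
          intro hh
          exact h ⟨he, fun v hv => by convert hh v hv⟩
        push Not at h'
        obtain ⟨v, hv, hlt⟩ := h'
        exact Finset.mem_union_right _ (Finset.mem_biUnion.2 ⟨v, Finset.mem_univ v,
          Finset.mem_filter.2 ⟨he, hv, not_le.2 hlt⟩⟩)
    have h1 := (Finset.card_le_card hsub).trans (Finset.card_union_le _ _)
    have h2 : (Finset.univ.biUnion bad).card ≤ Fintype.card V * M :=
      Finset.card_biUnion_le_card_mul _ _ M fun v _ => hbad v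
    rw [add_mul, one_mul]
    omega

/-- A random colouring of the vertices colours a positive proportion of the given sequences
properly. -/
lemma exists_coloring (P : Finset (ℕ → V)) {K : ℕ} (hK : 0 < K)
    (hinj : ∀ x ∈ P, ∀ i < K, ∀ j < K, x i = x j → i = j) :
    ∃ c : V → ℕ, ∃ P' ⊆ P, (∀ x ∈ P', ∀ i < K, c (x i) = i) ∧ P.card ≤ K ^ K * P'.card := by
  classical
  by_contra! hcon
  have hlt : ∀ c : V → Fin K,
      K ^ K * (P.filter fun x => ∀ i : Fin K, c (x i) = i).card < P.card := fun c =>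
    hcon (fun v => c v) _ (Finset.filter_subset _ _) fun x hx i hi =>
      congrArg Fin.val ((Finset.mem_filter.1 hx).2 ⟨i, hi⟩)
  have hge : ∀ x ∈ P, Fintype.card (V → Fin K) ≤
      (Finset.univ.filter fun c : V → Fin K => ∀ i : Fin K, c (x i) = i).card * K ^ K := by
    intro x hx
    let g : Fin K → V := fun i => x i
    have hg : Function.Injective g := fun i j h => Fin.ext (hinj x hx i i.2 j j.2 h)
    have hcard : Fintype.card (Fin K → Fin K) = K ^ K := by simp
    rw [← hcard, ← Finset.card_univ, ← Finset.card_univ, ← Finset.card_product]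
    refine Finset.card_le_card_of_injOn (fun c => (Function.extend g id c, fun i => c (g i)))
      (fun c _ => ?_) fun c _ c' _ h => ?_
    · simp only [Finset.coe_product, Set.mem_prod, Finset.mem_coe, Finset.mem_filter,
        Finset.mem_univ, true_and, and_true]
      exact fun i => hg.extend_apply _ _ i
    · funext v
      by_cases hv : ∃ i, g i = v
      · obtain ⟨i, rfl⟩ := hv
        exact congrFun (Prod.ext_iff.1 h).2 i
      · have := congrFun (Prod.ext_iff.1 h).1 v
        simp only at this
        rwa [Function.extend_apply' _ _ _ hv, Function.extend_apply' _ _ _ hv] at this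
  have hne : (Finset.univ : Finset (V → Fin K)).Nonempty := ⟨fun _ => ⟨0, hK⟩, Finset.mem_univ _⟩
  have h1 := Finset.sum_lt_sum_of_nonempty hne fun c _ => hlt c
  have h2 := Finset.sum_le_sum hge
  have h3 := Finset.sum_card_bipartiteAbove_eq_sum_card_bipartiteBelow
    (s := (Finset.univ : Finset (V → Fin K))) (t := P) fun c x => ∀ i : Fin K, c (x i) = i
  rw [← Finset.mul_sum] at h1
  rw [← Finset.sum_mul] at h2
  simp only [Finset.bipartiteAbove, Finset.bipartiteBelow] at h3
  rw [h3] at h1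
  simp only [Finset.sum_const, smul_eq_mul, Finset.card_univ] at h1 h2
  rw [mul_comm] at h1
  rw [mul_comm] at h2
  omega

lemma le_of_sq_le {N Q A B D X Y Z : ℕ} (hN : 0 < N) (hZ : 0 < Z) (hA : N * Z ≤ A * Q)
    (hQ : Q ^ 2 ≤ N ^ 2 * (Q + B * N * (D * X + D * Y))) :
    Z ≤ 2 * A * N ∨ Z ^ 2 ≤ 4 * A ^ 2 * B * N * (D * X) ∨ Z ^ 2 ≤ 4 * A ^ 2 * B * N * (D * Y) := by
  by_contra! hcon
  obtain ⟨h1, h2, h3⟩ := hcon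
  have hQ0 : 0 < Q := by
    rcases Nat.eq_zero_or_pos Q with rfl | h
    · have := Nat.mul_pos hN hZ
      omega
    · exact h
  have e1 : 2 * N ^ 2 < Q := by
    by_contra! h
    have : N * (2 * A * N) < N * Z := Nat.mul_lt_mul_of_pos_left h1 hN
    nlinarith [Nat.mul_le_mul_left A h]
  have e2 : 2 * N ^ 2 * Q < Q ^ 2 := by nlinarith
  have e3 : N ^ 2 * Z ^ 2 ≤ A ^ 2 * Q ^ 2 := by
    rw [← mul_pow, ← mul_pow]
    exact Nat.pow_le_pow_left hA 2
  have e4 : Q ^ 2 ≤ 2 * (N ^ 2 * (B * N * (D * X + D * Y))) := by nlinarith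
  have e5 : N ^ 2 * Z ^ 2 ≤ N ^ 2 * (2 * A ^ 2 * B * N * (D * X + D * Y)) := by
    refine e3.trans ((Nat.mul_le_mul_left _ e4).trans_eq ?_)
    ring
  have e6 := Nat.le_of_mul_le_mul_left e5 (by positivity)
  nlinarith

lemma pow_le_of_sq_le {Δ T a b : ℕ} (hΔ : 0 < Δ) {L : ℕ} (hab : 2 * a = L + b)
    (h : (Δ ^ a) ^ 2 ≤ Δ ^ L * T) : Δ ^ b ≤ T := by
  rw [← pow_mul, mul_comm a, hab, pow_add] at h
  exact Nat.le_of_mul_le_mul_left h (by positivity)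

end Levels

/-- The density bound for doubly blocked graphs whose maximum degree is comparable to their
average degree. -/
theorem exists_degree_bound (r : ℕ) (hr : 1 ≤ r) : ∃ K : ℕ, 1 ≤ K ∧
    ∀ (V : Type) [Fintype V] (H : SimpleGraph V) (π : Sym2 V → ℕ) (R : Sym2 V → Sym2 V → Prop)
      (F Δ : ℕ), IsBlocked H π R (2 * r + 1) F → 1 ≤ F → HasDegreeLE H Δ → K * F ≤ Δ →
      0 < Fintype.card V → Fintype.card V * Δ ≤ 5 * H.edgeSet.ncard →
      Δ ^ (2 * r + 1) ≤ K * Fintype.card V ∨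
      Δ ^ (2 * r + 2) ≤ K * Fintype.card V * F ^ (r + 1) ∨
      Δ ^ (2 * r + 3) ≤ K * Fintype.card V * F ^ (2 * r + 1) := by
  classical
  obtain ⟨C, hC1, hC⟩ := exists_isInterpolationConst (2 * r + 1)
  obtain ⟨A, hA⟩ : ∃ A, A = 10 * (20 * r) ^ (2 * r) * (2 * r + 2) ^ (2 * r + 2) := ⟨_, rfl⟩
  obtain ⟨B, hB⟩ : ∃ B, B = 2 * (2 ^ (2 * r + 2) * (2 * r + 1) * (2 * C ^ 4)) := ⟨_, rfl⟩
  refine ⟨20 * r * (4 * r + 2) + (2 * A + 4 * A ^ 2 * B), ?_, ?_⟩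
  · have : 1 ≤ r * (4 * r + 2) := Nat.mul_pos hr (by omega)
    nlinarith [Nat.zero_le (4 * A ^ 2 * B)]
  intro V _ H π R F Δ hH hF hΔ hK hN hE
  obtain ⟨d⟩ := Fintype.card_pos_iff.1 hN
  have hKF : 20 * r * (4 * r + 2) * F ≤ Δ := by nlinarith [Nat.zero_le ((2 * A + 4 * A ^ 2 * B) * F)]
  have hFΔ : F ≤ Δ := by
    have : 1 ≤ 20 * r * (4 * r + 2) := Nat.mul_pos (by omega) (by omega)
    nlinarith
  have hΔ0 : 0 < Δ := by omega
  set M := Δ / (10 * r) with hM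
  set G := 2 * r + 1 + r * (2 * F) with hG
  have hM1 : 10 * r * M ≤ Δ := Nat.mul_div_le _ _
  have hM2 : Δ < 10 * r * (M + 1) := Nat.lt_mul_div_succ _ (by omega)
  have hG1 : G + 1 ≤ (4 * r + 2) * F := by nlinarith
  have hGM : G ≤ M := by
    by_contra! h
    have : 10 * r * (M + 1) ≤ 10 * r * ((4 * r + 2) * F) := Nat.mul_le_mul_left _ (by omega)
    nlinarith
  obtain ⟨D, hD⟩ : ∃ D, M = D + G := ⟨M - G, by omega⟩
  have hD' : Δ ≤ 20 * r * D := by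
    have : 10 * r * (G + 1) ≤ 10 * r * ((4 * r + 2) * F) := Nat.mul_le_mul_left _ hG1
    rw [hD] at hM2
    nlinarith
  let E : Finset (Sym2 V) := H.edgeSet.toFinset
  have hEc : E.card = H.edgeSet.ncard := (Set.ncard_eq_toFinset_card' _).symm
  have hmemE : ∀ e ∈ E, e ∈ H.edgeSet := fun e he => Set.mem_toFinset.1 he
  have hlev := card_le_card_levels (M := M) (fun e he e' he' =>
    hH.inj e (hmemE e he) e' (hmemE e' he')) r
  have hlev2 : E.card ≤ 2 * (levels π E M r).card := by
    have : 10 * (r * (Fintype.card V * M)) ≤ 5 * E.card := by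
      rw [hEc]
      refine le_trans ?_ hE
      nlinarith [Nat.mul_le_mul_left (Fintype.card V) hM1]
    omega
  have hleveled : IsLeveled π (levels π E M) (D + (2 * r + 1 + r * (2 * F))) := by
    rw [← hG, ← hD]
    exact isLeveled_levels
  obtain ⟨P₀, hP₀, hsep, hcard⟩ := exists_chainPaths (r := r) (D := D) hH
    (fun j e he => hmemE e (levels_subset j he)) hleveled d
  obtain ⟨c, P, hPP, hc, hcol⟩ := exists_coloring P₀ (K := 2 * r + 2) (by omega)
    fun x hx i hi j hj => (hP₀ x hx).inj i (by omega) j (by omega)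
  have hup := card_chainPaths_le (u := fun x : ℕ → V => x) hH hF hC hC1 hΔ hFΔ hr
    (fun x hx => hP₀ x (hPP hx)) (fun x hx i hi => hc x hx i (by omega))
    fun x hx y hy => hsep x (hPP hx) y (hPP hy)
  have hlow : Fintype.card V * Δ ^ (2 * r + 1) ≤ A * P.card := by
    calc Fintype.card V * Δ ^ (2 * r + 1) = Fintype.card V * Δ * Δ ^ (2 * r) := by ring
      _ ≤ 5 * (2 * (levels π E M r).card) * (20 * r * D) ^ (2 * r) := by
        refine Nat.mul_le_mul (hE.trans ?_) (Nat.pow_le_pow_left hD' _)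
        rw [← hEc]
        omega
      _ = 10 * (20 * r) ^ (2 * r) * ((levels π E M r).card * D ^ (2 * r)) := by
        rw [mul_pow (20 * r) D]
        ring
      _ ≤ 10 * (20 * r) ^ (2 * r) * ((2 * r + 2) ^ (2 * r + 2) * P.card) :=
        Nat.mul_le_mul_left _ (hcard.trans hcol)
      _ = A * P.card := by
        rw [hA]
        ring
  have hup' : P.card ^ 2 ≤ Fintype.card V ^ 2 * (P.card + B * Fintype.card V *
      (1 * (Δ ^ (2 * r) * F ^ (r + 1)) + 1 * (Δ ^ (2 * r - 1) * F ^ (2 * r + 1)))) := by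
    refine hup.trans_eq ?_
    rw [hB]
    ring
  have hK1 : 2 * A ≤ 20 * r * (4 * r + 2) + (2 * A + 4 * A ^ 2 * B) :=
    le_add_left (Nat.le_add_right _ _)
  have hK2 : 4 * A ^ 2 * B ≤ 20 * r * (4 * r + 2) + (2 * A + 4 * A ^ 2 * B) :=
    le_add_left (Nat.le_add_left _ _)
  rcases le_of_sq_le hN (by positivity) hlow hup' with h | h | h
  · exact Or.inl (h.trans (Nat.mul_le_mul_right _ hK1))
  · right; left
    refine (pow_le_of_sq_le hΔ0 (L := 2 * r) (T := 4 * A ^ 2 * B * Fintype.card V * F ^ (r + 1))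
      (by omega) (h.trans_eq (by ring))).trans ?_
    exact Nat.mul_le_mul_right _ (Nat.mul_le_mul_right _ hK2)
  · right; right
    refine (pow_le_of_sq_le hΔ0 (L := 2 * r - 1)
      (T := 4 * A ^ 2 * B * Fintype.card V * F ^ (2 * r + 1))
      (by omega) (h.trans_eq (by ring))).trans ?_
    exact Nat.mul_le_mul_right _ (Nat.mul_le_mul_right _ hK2)

section DegreeSplit

variable {V V' : Type} {H : SimpleGraph V} {H' : SimpleGraph V'} {π : Sym2 V → ℕ}
  {R : Sym2 V → Sym2 V → Prop} {k F : ℕ}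

lemma IsBlocked.comap (h : IsBlocked H π R k F) (φ : H' →g H)
    (hφ : Set.InjOn (Sym2.map φ) H'.edgeSet) :
    IsBlocked H' (fun e => π (e.map φ))
      (fun e e' => R (e.map φ) (e'.map φ) ∧ e ∈ H'.edgeSet ∧ e' ∈ H'.edgeSet) k F where
  symm e e' h' := ⟨h.symm _ _ h'.1, h'.2.2, h'.2.1⟩
  irrefl e h' := h.irrefl _ h'.1
  inj e he e' he' hee := hφ he he' (h.inj _ (φ.map_mem_edgeSet he) _ (φ.map_mem_edgeSet he') hee)
  few e he := by
    classical
    rcases isEmpty_or_nonempty (Sym2 V') with _ | _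
    · exact ⟨∅, by simp, fun e' => isEmptyElim e'⟩
    obtain ⟨s, hs, hs'⟩ := h.few _ (φ.map_mem_edgeSet he)
    refine ⟨s.image (Function.invFunOn (Sym2.map φ) H'.edgeSet), Finset.card_image_le.trans hs,
      fun e' he' => Finset.mem_image.2 ⟨_, hs' _ he'.1, hφ.leftInvOn_invFunOn he'.2.2⟩⟩
  single u v huv p hp hl := by
    obtain ⟨e, he, hR⟩ := h.single _ _ (φ.map_adj huv) (p.map φ) (fun e he => by
      rw [Walk.edges_map, List.mem_map] at he
      obtain ⟨e, he, rfl⟩ := he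
      exact hp e he) (by rwa [Walk.length_map])
    rw [Walk.edges_map, List.mem_map] at he
    obtain ⟨e, he, rfl⟩ := he
    exact ⟨e, he, hR, huv, p.edges_subset_edgeSet he⟩
  double u v huv p hp hl := by
    obtain ⟨e, he, e', he', hne, hR, hR'⟩ := h.double _ _ (φ.map_adj huv) (p.map φ) (fun e he => by
      rw [Walk.edges_map, List.mem_map] at he
      obtain ⟨e, he, rfl⟩ := he
      exact hp e he) (by rwa [Walk.length_map])
    rw [Walk.edges_map, List.mem_map] at he he'
    obtain ⟨e, he, rfl⟩ := he
    obtain ⟨e', he', rfl⟩ := he'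
    exact ⟨e, he, e', he', fun h => hne (h ▸ rfl), ⟨hR, huv, p.edges_subset_edgeSet he⟩,
      hR', huv, p.edges_subset_edgeSet he'⟩

variable [Fintype V]

/-- Splitting the vertices of a graph into copies of degree at most `Δ`. -/
lemma exists_degree_split (H : SimpleGraph V) {Δ : ℕ} (hΔ : 0 < Δ) :
    ∃ (V' : Type) (_ : Fintype V') (H' : SimpleGraph V') (φ : H' →g H),
      Set.InjOn (Sym2.map φ) H'.edgeSet ∧ HasDegreeLE H' Δ ∧
      H'.edgeSet.ncard = H.edgeSet.ncard ∧ Fintype.card V ≤ Fintype.card V' ∧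
      Fintype.card V' * Δ ≤ Fintype.card V * Δ + 2 * H.edgeSet.ncard := by
  classical
  have hrank : ∀ v, ∃ ρ : V → ℕ, (∀ u, H.Adj v u → ρ u < H.degree v) ∧
      ∀ u u', H.Adj v u → H.Adj v u' → ρ u = ρ u' → u = u' := by
    intro v
    let e := (H.neighborFinset v).equivFin
    refine ⟨fun u => if h : u ∈ H.neighborFinset v then (e ⟨u, h⟩ : ℕ) else 0, fun u hu => ?_,
      fun u u' hu hu' h => ?_⟩
    · simp only [dif_pos ((H.mem_neighborFinset v u).2 hu)]
      exact (e _).2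
    · simp only [dif_pos ((H.mem_neighborFinset v u).2 hu),
        dif_pos ((H.mem_neighborFinset v u').2 hu')] at h
      exact congrArg Subtype.val (e.injective (Fin.ext h))
  choose ρ hρ hρi using hrank
  let H' : SimpleGraph (Σ v : V, Fin (H.degree v / Δ + 1)) :=
    { Adj := fun a b => H.Adj a.1 b.1 ∧ (a.2 : ℕ) = ρ a.1 b.1 / Δ ∧ (b.2 : ℕ) = ρ b.1 a.1 / Δ
      symm := ⟨fun a b h => ⟨h.1.symm, h.2.2, h.2.1⟩⟩
      loopless := ⟨fun a h => H.loopless.irrefl a.1 h.1⟩ }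
  let φ : H' →g H := ⟨Sigma.fst, fun h => h.1⟩
  have hfin : ∀ v (i j : Fin (H.degree v / Δ + 1)), (i : ℕ) = j → (⟨v, i⟩ : Σ v : V,
      Fin (H.degree v / Δ + 1)) = ⟨v, j⟩ := fun v i j h => by rw [Fin.ext h]
  have hinj : Set.InjOn (Sym2.map φ) H'.edgeSet := by
    intro e he e' he' hee
    induction e with | _ a b
    induction e' with | _ a' b'
    obtain ⟨v, i⟩ := a
    obtain ⟨w, j⟩ := b
    obtain ⟨v', i'⟩ := a'
    obtain ⟨w', j'⟩ := b'
    obtain ⟨h1, h2, h3⟩ := (show H'.Adj _ _ from he)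
    obtain ⟨h1', h2', h3'⟩ := (show H'.Adj _ _ from he')
    simp only at h1 h2 h3 h1' h2' h3'
    rcases Sym2.eq_iff.1 (show s(v, w) = s(v', w') from hee) with ⟨rfl, rfl⟩ | ⟨rfl, rfl⟩
    · rw [hfin v i i' (by omega), hfin w j j' (by omega)]
    · rw [hfin v i j' (by omega), hfin w j i' (by omega)]
      exact Sym2.eq_swap
  refine ⟨_, inferInstance, H', φ, hinj, ?_, ?_, ?_, ?_⟩
  · rintro ⟨v, i⟩
    refine ⟨Finset.univ.filter fun b => H'.Adj ⟨v, i⟩ b, ?_, fun u hu => by simpa using hu⟩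
    have : (Finset.Ico ((i : ℕ) * Δ) ((i : ℕ) * Δ + Δ)).card = Δ := by simp
    refine le_of_le_of_eq ?_ this
    refine Finset.card_le_card_of_injOn (fun b => ρ v b.1) (fun b hb => ?_) fun b hb b' hb' h => ?_
    · obtain ⟨h1, h2, h3⟩ := (Finset.mem_filter.1 hb).2
      simp only at h2
      simp only [Finset.coe_Ico, Set.mem_Ico]
      rw [h2]
      have h4 := Nat.div_mul_le_self (ρ v b.1) Δ
      have h5 := Nat.lt_div_mul_add hΔ (a := ρ v b.1)
      exact ⟨h4, h5⟩
    · obtain ⟨h1, h2, h3⟩ := (Finset.mem_filter.1 hb).2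
      obtain ⟨h1', h2', h3'⟩ := (Finset.mem_filter.1 hb').2
      obtain ⟨w, j⟩ := b
      obtain ⟨w', j'⟩ := b'
      obtain rfl := hρi v w w' h1 h1' h
      exact hfin w j j' (h3.trans h3'.symm)
  · rw [← hinj.ncard_image]
    congr 1
    ext e
    constructor
    · rintro ⟨e, he, rfl⟩
      exact φ.map_mem_edgeSet he
    · intro he
      induction e with | _ v w
      have hvw : H.Adj v w := he
      refine ⟨s(⟨v, ⟨ρ v w / Δ, ?_⟩⟩, ⟨w, ⟨ρ w v / Δ, ?_⟩⟩), ⟨hvw, rfl, rfl⟩, rfl⟩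
      · exact Nat.lt_succ_of_le (Nat.div_le_div_right (hρ v w hvw).le)
      · exact Nat.lt_succ_of_le (Nat.div_le_div_right (hρ w v hvw.symm).le)
  · exact Fintype.card_le_of_injective (fun v => ⟨v, 0⟩) fun v w h => congrArg Sigma.fst h
  · rw [Fintype.card_sigma, Set.ncard_eq_toFinset_card' H.edgeSet]
    have h2 := H.sum_degrees_eq_twice_card_edges
    have h3 : H.edgeSet.toFinset.card = H.edgeFinset.card := by
      congr 1
    rw [h3, ← h2, Finset.sum_mul]
    simp only [Fintype.card_fin]
    calc ∑ v, (H.degree v / Δ + 1) * Δ ≤ ∑ v, (Δ + H.degree v) := by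
          refine Finset.sum_le_sum fun v _ => ?_
          have := Nat.div_mul_le_self (H.degree v) Δ
          rw [add_mul, one_mul]
          omega
      _ = _ := by
          rw [Finset.sum_add_distrib]
          simp

end DegreeSplit

/-- The density bound for doubly blocked graphs. -/
theorem exists_edge_bound (r : ℕ) (hr : 1 ≤ r) : ∃ K : ℕ, 1 ≤ K ∧
    ∀ (V : Type) [Fintype V] (H : SimpleGraph V) (π : Sym2 V → ℕ) (R : Sym2 V → Sym2 V → Prop)
      (F : ℕ), IsBlocked H π R (2 * r + 1) F → 1 ≤ F → 0 < Fintype.card V →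
      H.edgeSet.ncard ≤ K * F * Fintype.card V ∨
      ∃ Δ, H.edgeSet.ncard ≤ 2 * Fintype.card V * Δ ∧
      (Δ ^ (2 * r + 1) ≤ K * Fintype.card V ∨
      Δ ^ (2 * r + 2) ≤ K * Fintype.card V * F ^ (r + 1) ∨
      Δ ^ (2 * r + 3) ≤ K * Fintype.card V * F ^ (2 * r + 1)) := by
  obtain ⟨K, hK, h⟩ := exists_degree_bound r hr
  refine ⟨5 * K, by omega, ?_⟩
  intro V _ H π R F hH hF hn
  obtain ⟨Δ, hΔ⟩ : ∃ Δ, Δ = H.edgeSet.ncard / Fintype.card V := ⟨_, rfl⟩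
  have hE1 : H.edgeSet.ncard < Fintype.card V * (Δ + 1) := hΔ ▸ Nat.lt_mul_div_succ _ hn
  have hE2 : Fintype.card V * Δ ≤ H.edgeSet.ncard := hΔ ▸ Nat.mul_div_le _ _
  by_cases hKF : K * F ≤ Δ
  swap
  · left
    have : Fintype.card V * (Δ + 1) ≤ Fintype.card V * (K * F) := Nat.mul_le_mul_left _ (by omega)
    nlinarith
  right
  have hΔ0 : 1 ≤ Δ := (Nat.mul_pos hK hF).trans_le hKF
  obtain ⟨V', _, H', φ, hφ, hdeg, hcard, hle, hle'⟩ := exists_degree_split H hΔ0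
  have hN : Fintype.card V' ≤ 5 * Fintype.card V := by
    refine Nat.le_of_mul_le_mul_right (c := Δ) ?_ hΔ0
    nlinarith
  have hb := h V' H' _ _ F Δ (hH.comap φ hφ) hF hdeg hKF (by omega) (by
    rw [hcard]
    nlinarith)
  have hKN : K * Fintype.card V' ≤ 5 * K * Fintype.card V := by nlinarith
  refine ⟨Δ, by nlinarith, ?_⟩
  rcases hb with hb | hb | hb
  · exact Or.inl (hb.trans hKN)
  · exact Or.inr (Or.inl (hb.trans (Nat.mul_le_mul_right _ hKN)))
  · exact Or.inr (Or.inr (hb.trans (Nat.mul_le_mul_right _ hKN)))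

section Greedy

variable {V : Type} {G H : SimpleGraph V} {w : Sym2 V → ℝ≥0∞} {δ D : V → V → ℝ≥0∞} {u v x : V}

lemma wdist_self : wdist G w u u = 0 :=
  nonpos_iff_eq_zero.1 ((iInf_le _ Walk.nil).trans (by simp))

lemma wdist_triangle : wdist G w u x ≤ wdist G w u v + wdist G w v x := by
  unfold wdist
  rw [ENNReal.iInf_add]
  refine le_iInf fun p => ?_
  rw [ENNReal.add_iInf]
  refine le_iInf fun q => (iInf_le _ (p.append q)).trans ?_
  simp

lemma wdist_comm_le : wdist G w u v ≤ wdist G w v u :=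
  le_iInf fun p => (iInf_le _ p.reverse).trans (by simp)

lemma wdist_comm : wdist G w u v = wdist G w v u := le_antisymm wdist_comm_le wdist_comm_le

lemma wdist_le_of_adj (h : G.Adj u v) : wdist G w u v ≤ w s(u, v) :=
  (iInf_le _ (Walk.cons h Walk.nil)).trans (by simp)

lemma emulDist_self : emulDist H δ u u = 0 :=
  nonpos_iff_eq_zero.1 ((iInf_le _ Walk.nil).trans (by simp))

lemma emulDist_triangle : emulDist H δ u x ≤ emulDist H δ u v + emulDist H δ v x := by
  unfold emulDist
  rw [ENNReal.iInf_add]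
  refine le_iInf fun p => ?_
  rw [ENNReal.add_iInf]
  refine le_iInf fun q => (iInf_le _ (p.append q)).trans ?_
  simp

lemma emulDist_comm_le (hδ : ∀ a b, δ a b = δ b a) : emulDist H δ u v ≤ emulDist H δ v u := by
  refine le_iInf fun p => (iInf_le _ p.reverse).trans ?_
  simp only [Walk.darts_reverse, List.map_reverse, List.map_map, List.sum_reverse]
  refine le_of_eq (congrArg List.sum (List.map_congr_left fun d _ => ?_))
  exact hδ _ _

lemma emulDist_comm (hδ : ∀ a b, δ a b = δ b a) : emulDist H δ u v = emulDist H δ v u :=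
  le_antisymm (emulDist_comm_le hδ) (emulDist_comm_le hδ)

lemma emulDist_le_of_adj (h : H.Adj u v) : emulDist H δ u v ≤ δ u v :=
  (iInf_le _ (Walk.cons h Walk.nil)).trans (by simp)

lemma le_sum_edges (h0 : ∀ a, D a a = 0) (htri : ∀ a b c, D a c ≤ D a b + D b c)
    {g : Sym2 V → ℝ≥0∞} (p : G.Walk u v) (hp : ∀ a b, s(a, b) ∈ p.edges → D a b ≤ g s(a, b)) :
    D u v ≤ (p.edges.map g).sum := by
  induction p with
  | nil => simp [h0]
  | @cons a b c h p ih =>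
    rw [Walk.edges_cons, List.map_cons, List.sum_cons]
    refine (htri a b c).trans (add_le_add (hp a b (by simp)) (ih fun a' b' h' => hp a' b' ?_))
    rw [Walk.edges_cons]
    exact List.mem_cons_of_mem _ h'

lemma le_length_mul (h0 : ∀ a, D a a = 0) (htri : ∀ a b c, D a c ≤ D a b + D b c)
    {W : ℝ≥0∞} (p : G.Walk u v) (hp : ∀ a b, s(a, b) ∈ p.edges → D a b ≤ W) :
    D u v ≤ p.length * W := by
  refine (le_sum_edges h0 htri (g := fun _ => W) p hp).trans (le_of_eq ?_)
  simp

lemma le_emulDist (h0 : ∀ a, δ a a = 0) (htri : ∀ a b c, δ a c ≤ δ a b + δ b c) :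
    δ u v ≤ emulDist H δ u v := by
  refine le_iInf fun p => ?_
  induction p with
  | nil => simp [h0]
  | @cons a b c h p ih =>
    rw [Walk.darts_cons, List.map_cons, List.sum_cons]
    exact (htri a b c).trans (add_le_add le_rfl ih)

lemma emulDist_le_mul_wdist {t : ℝ≥0∞} (ht : t ≠ 0) (ht' : t ≠ ⊤)
    (h : ∀ a b, G.Adj a b → emulDist H δ a b ≤ t * w s(a, b)) :
    emulDist H δ u v ≤ t * wdist G w u v := by
  rw [wdist, ENNReal.mul_iInf_of_ne ht ht']
  refine le_iInf fun p => ?_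
  rw [← List.sum_map_mul_left]
  exact le_sum_edges (fun _ => emulDist_self) (fun _ _ _ => emulDist_triangle) p
    fun a b hab => h a b (p.edges_subset_edgeSet hab)

lemma emulDist_anti {H' : SimpleGraph V} (h : H ≤ H') : emulDist H' δ u v ≤ emulDist H δ u v := by
  refine le_iInf fun p => (iInf_le _ (p.mapLe h)).trans (le_of_eq ?_)
  simp [Walk.mapLe, Walk.darts_map, List.map_map, Function.comp_def]

lemma exists_append_cons_of_mem_edges {e : Sym2 V} (p : H.Walk u v) (he : e ∈ p.edges) :
    ∃ (a b : V) (h : H.Adj a b) (q : H.Walk u a) (q' : H.Walk b v),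
      p = q.append (Walk.cons h q') ∧ e = s(a, b) := by
  induction p with
  | nil => simp at he
  | @cons a b c h p ih =>
    rw [Walk.edges_cons, List.mem_cons] at he
    rcases he with rfl | he
    · exact ⟨a, b, h, Walk.nil, p, rfl, rfl⟩
    · obtain ⟨a', b', h', q, q', rfl, rfl⟩ := ih he
      exact ⟨a', b', h', Walk.cons h q, q', rfl, rfl⟩

/-- A ranking of the pairs of vertices by their weight. -/
lemma exists_ranking [Fintype V] (w : Sym2 V → ℝ≥0∞) :
    ∃ π : Sym2 V → ℕ, Function.Injective π ∧ ∀ e e', π e ≤ π e' → w e ≤ w e' := by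
  classical
  let ι := Fintype.equivFin (Sym2 V)
  let σ := Tuple.sort (w ∘ ι.symm)
  refine ⟨fun e => σ.symm (ι e), fun e e' h => ι.injective (σ.symm.injective (Fin.ext h)),
    fun e e' h => ?_⟩
  have := Tuple.monotone_sort (w ∘ ι.symm) (show σ.symm (ι e) ≤ σ.symm (ι e') from h)
  simpa [σ] using this

/-- Greedy selection along a ranking. -/
lemma exists_greedy {X : Type} (π : X → ℕ) (B : Set X → X → Prop) :
    ∃ K : Set X, ∀ e, e ∈ K ↔ B {e' | e' ∈ K ∧ π e' < π e} e := by
  let wf : WellFounded fun a b : X => π a < π b := (measure π).wf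
  let P : X → Prop := wf.fix fun e rec => B {e' | ∃ h : π e' < π e, rec e' h} e
  refine ⟨{e | P e}, fun e => ?_⟩
  have h : P e = B {e' | ∃ _ : π e' < π e, P e'} e := wf.fix_eq _ e
  have h2 : {e' | ∃ _ : π e' < π e, P e'} = {e' | e' ∈ {e | P e} ∧ π e' < π e} := by
    ext e'
    simp [and_comm]
  rw [← h2, ← h]
  rfl

/-- The greedy emulator, together with the fault sets witnessing that its edges are necessary. -/
theorem exists_greedy_emulator [Fintype V] (G : SimpleGraph V) (w : Sym2 V → ℝ≥0∞) (f : ℕ) {k : ℕ}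
    (hk : 1 ≤ k) : ∃ (H : SimpleGraph V) (π : Sym2 V → ℕ) (Φ : Sym2 V → Finset (Sym2 V)),
      IsEFTEmulator G w H f ((2 * k - 1 : ℕ) : ℝ≥0∞) ∧ Function.Injective π ∧
      (∀ e, (Φ e).card ≤ f) ∧
      (∀ u v, H.Adj u v → ∀ p : H.Walk u v, (∀ e ∈ p.edges, π e < π s(u, v)) →
        p.length ≤ 2 * k - 1 → ∃ e ∈ p.edges, e ∈ Φ s(u, v)) ∧
      ∀ u v, H.Adj u v → ∀ p : H.Walk u v, (∀ e ∈ p.edges, π e < π s(u, v)) →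
        p.length ≤ k → ∃ e ∈ p.edges, ∃ e' ∈ p.edges, e ≠ e' ∧ e ∈ Φ s(u, v) ∧ e' ∈ Φ s(u, v) := by
  classical
  obtain ⟨π, hπ, hπw⟩ := exists_ranking w
  set t : ℝ≥0∞ := ((2 * k - 1 : ℕ) : ℝ≥0∞) with ht
  let bad : Finset (Sym2 V) → Set (Sym2 V) → Sym2 V → Prop := fun F K e =>
    F.card ≤ f ∧ e ∉ F ∧ ∀ u v, e = s(u, v) →
      t * w e < emulDist (fromEdgeSet K) (wdist (G.deleteEdges ↑F) w) u v
  obtain ⟨K, hK⟩ := exists_greedy π fun K e => e ∈ G.edgeSet ∧ ∃ F, bad F K e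
  let L : Sym2 V → Set (Sym2 V) := fun e => {e' | e' ∈ K ∧ π e' < π e}
  have hKG : ∀ e ∈ K, e ∈ G.edgeSet := fun e he => ((hK e).1 he).1
  have hadj : ∀ {a b}, (fromEdgeSet K).Adj a b ↔ s(a, b) ∈ K := fun {a b} =>
    ⟨fun h => ((fromEdgeSet_adj K).1 h).1,
      fun h => (fromEdgeSet_adj K).2 ⟨h, (hKG _ h : G.Adj a b).ne⟩⟩
  have hwit : ∀ e, ∃ F : Finset (Sym2 V), F.card ≤ f ∧ (e ∈ K → bad F (L e) e) := by
    intro e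
    by_cases he : e ∈ K
    · obtain ⟨-, F, hF⟩ := (hK e).1 he
      exact ⟨F, hF.1, fun _ => hF⟩
    · exact ⟨∅, by simp, fun h => absurd h he⟩
  choose Φ hΦ hbad using hwit
  have hdel : ∀ {F : Finset (Sym2 V)} {a b}, s(a, b) ∈ K → s(a, b) ∉ F →
      wdist (G.deleteEdges ↑F) w a b ≤ w s(a, b) := fun {F a b} h1 h2 =>
    wdist_le_of_adj (deleteEdges_adj.2 ⟨hKG _ h1, fun h => h2 (Finset.mem_coe.1 h)⟩)
  have hkey : ∀ u v, s(u, v) ∈ K → ∀ a b, ∀ p : (fromEdgeSet K).Walk a b,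
      (∀ e ∈ p.edges, π e < π s(u, v)) → (∀ e ∈ p.edges, e ∉ Φ s(u, v)) →
      wdist (G.deleteEdges ↑(Φ s(u, v))) w a b ≤ p.length * w s(u, v) ∧
      emulDist (fromEdgeSet (L s(u, v))) (wdist (G.deleteEdges ↑(Φ s(u, v))) w) a b ≤
        p.length * w s(u, v) := by
    intro u v huv a b p hp hpF
    have hmem : ∀ e ∈ p.edges, e ∈ K := fun e he => by
      have := p.edges_subset_edgeSet he
      rw [edgeSet_fromEdgeSet] at this
      exact this.1
    have h1 : ∀ a b, s(a, b) ∈ p.edges →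
        wdist (G.deleteEdges ↑(Φ s(u, v))) w a b ≤ w s(u, v) := fun a b hab =>
      (hdel (hmem _ hab) (hpF _ hab)).trans (hπw _ _ (hp _ hab).le)
    refine ⟨le_length_mul (fun _ => wdist_self) (fun _ _ _ => wdist_triangle) p h1,
      le_length_mul (fun _ => emulDist_self) (fun _ _ _ => emulDist_triangle) p fun a b hab => ?_⟩
    refine (emulDist_le_of_adj ?_).trans (h1 a b hab)
    exact (fromEdgeSet_adj _).2 ⟨⟨hmem _ hab, hp _ hab⟩, (hKG _ (hmem _ hab) : G.Adj a b).ne⟩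
  have hsingle : ∀ u v, (fromEdgeSet K).Adj u v → ∀ p : (fromEdgeSet K).Walk u v,
      (∀ e ∈ p.edges, π e < π s(u, v)) → p.length ≤ 2 * k - 1 →
      ∃ e ∈ p.edges, e ∈ Φ s(u, v) := by
    intro u v huv p hp hl
    by_contra! hcon
    have huv' := hadj.1 huv
    refine absurd ((hkey u v huv' u v p hp hcon).2.trans ?_) (not_le.2 ((hbad _ huv').2.2 u v rfl))
    gcongr
    rw [ht]
    exact_mod_cast hl
  refine ⟨fromEdgeSet K, π, Φ, ?_, hπ, hΦ, hsingle, ?_⟩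
  · intro F hFG hF u v
    refine ⟨le_emulDist (fun _ => wdist_self) (fun _ _ _ => wdist_triangle),
      emulDist_le_mul_wdist (by rw [ht]; exact_mod_cast (by omega)) (ENNReal.natCast_ne_top _) ?_⟩
    intro a b hab
    obtain ⟨hG, hnF⟩ := deleteEdges_adj.1 hab
    by_cases he : s(a, b) ∈ K
    · refine (emulDist_le_of_adj (hadj.2 he)).trans ((wdist_le_of_adj hab).trans ?_)
      refine le_mul_of_one_le_left zero_le ?_
      rw [ht]
      exact_mod_cast (by omega)
    · have hnb : ¬ bad F (L s(a, b)) s(a, b) := fun h => he ((hK _).2 ⟨hG, F, h⟩)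
      have : ∃ u v, s(a, b) = s(u, v) ∧ emulDist (fromEdgeSet (L s(a, b)))
          (wdist (G.deleteEdges ↑F) w) u v ≤ t * w s(a, b) := by
        by_contra! hcon
        exact hnb ⟨hF, fun h => hnF (Finset.mem_coe.2 h), hcon⟩
      obtain ⟨c, d, hcd, hle⟩ := this
      refine le_trans (emulDist_anti (fromEdgeSet_mono (show L s(a, b) ⊆ K from fun e he => he.1))) ?_
      rcases Sym2.eq_iff.1 hcd with ⟨rfl, rfl⟩ | ⟨rfl, rfl⟩
      · exact hle
      · rw [emulDist_comm fun _ _ => wdist_comm]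
        exact hle
  · intro u v huv p hp hl
    by_contra! hcon
    have huv' := hadj.1 huv
    have hsub := p.edges_bypass_subset_edges
    obtain ⟨e, he, heΦ⟩ := hsingle u v huv p.bypass (fun e he => hp e (hsub he))
      (p.length_bypass_le_length.trans (by omega))
    obtain ⟨a, b, hab, q, q', hq, rfl⟩ := exists_append_cons_of_mem_edges _ he
    have hnd := p.bypass_isPath.isTrail.edges_nodup
    have hlen := p.length_bypass_le_length.trans hl
    rw [hq] at hnd hlen hsub
    rw [Walk.edges_append, Walk.edges_cons] at hnd hsub
    rw [Walk.length_append, Walk.length_cons] at hlen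
    have hother : ∀ e ∈ p.edges, e ≠ s(a, b) → e ∉ Φ s(u, v) := fun e h1 h2 h3 =>
      hcon e h1 _ (hsub (by simp)) h2 h3 heΦ
    have hq1 := hkey u v huv' u a q (fun e he => hp e (hsub (by simp [he]))) fun e he =>
      hother e (hsub (by simp [he])) fun h => by
        subst h
        exact (List.disjoint_of_nodup_append hnd) he (by simp)
    have hq2 := hkey u v huv' b v q' (fun e he => hp e (hsub (by simp [he]))) fun e he =>
      hother e (hsub (by simp [he])) fun h => by
        subst h
        exact (List.nodup_cons.1 (List.nodup_append.1 hnd).2.1).1 he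
    have hbad' := hbad _ huv'
    set W := w s(u, v)
    set δ := wdist (G.deleteEdges ↑(Φ s(u, v))) w
    have hc : ∀ x y, δ x y = δ y x := fun _ _ => wdist_comm
    have hδ : δ a b ≤ q.length * W + (W + q'.length * W) := by
      calc δ a b ≤ δ a u + δ u b := wdist_triangle
        _ ≤ δ a u + (δ u v + δ v b) := by
          gcongr
          exact wdist_triangle
        _ = δ u a + (δ u v + δ b v) := by rw [hc a u, hc v b]
        _ ≤ _ := add_le_add hq1.1 (add_le_add (hdel huv' hbad'.2.1) hq2.1)
    have hmid : emulDist (fromEdgeSet (L s(u, v))) δ a b ≤ δ a b := by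
      have hmem := hsub (show s(a, b) ∈ q.edges ++ s(a, b) :: q'.edges by simp)
      exact emulDist_le_of_adj ((fromEdgeSet_adj _).2 ⟨⟨hadj.1 hab, hp _ hmem⟩, hab.ne⟩)
    refine absurd ?_ (not_le.2 (hbad'.2.2 u v rfl))
    calc emulDist (fromEdgeSet (L s(u, v))) δ u v
        ≤ emulDist (fromEdgeSet (L s(u, v))) δ u a + emulDist (fromEdgeSet (L s(u, v))) δ a v :=
          emulDist_triangle
      _ ≤ emulDist (fromEdgeSet (L s(u, v))) δ u a + (emulDist (fromEdgeSet (L s(u, v))) δ a b +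
          emulDist (fromEdgeSet (L s(u, v))) δ b v) := by
        gcongr
        exact emulDist_triangle
      _ ≤ q.length * W + ((q.length * W + (W + q'.length * W)) + q'.length * W) :=
        add_le_add hq1.2 (add_le_add (hmid.trans hδ) hq2.2)
      _ = ((2 * (q.length + q'.length) + 1 : ℕ) : ℝ≥0∞) * W := by
        push_cast
        ring
      _ ≤ t * W := by
        gcongr
        rw [ht]
        exact_mod_cast (by omega)

end Greedy

section Prune

open Classical in
lemma exists_card_le_of_forall_card_le {α : Type*} (S : Finset α) (Φ : α → Finset α) {f : ℕ}
    (hΦ : ∀ e, (Φ e).card ≤ f) :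
    ∃ T ⊆ S, S.card ≤ 2 * T.card ∧ ∀ e ∈ T, (S.filter fun e' => e ∈ Φ e').card ≤ 2 * f := by
  refine ⟨S.filter fun e => (S.filter fun e' => e ∈ Φ e').card ≤ 2 * f, Finset.filter_subset _ _,
    ?_, fun e he => (Finset.mem_filter.1 he).2⟩
  have h1 := Finset.card_filter_add_card_filter_not (s := S)
    fun e => (S.filter fun e' => e ∈ Φ e').card ≤ 2 * f
  have h2 : (S.filter fun e => ¬ (S.filter fun e' => e ∈ Φ e').card ≤ 2 * f).card * (2 * f + 1) ≤
      S.card * f :=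
    Finset.card_mul_le_card_mul (fun e e' => e ∈ Φ e')
      (fun e he => not_le.1 (Finset.mem_filter.1 he).2)
      fun e' _ => (Finset.card_le_card fun e he => (Finset.mem_filter.1 he).2).trans (hΦ e')
  nlinarith

open Classical in
lemma exists_isBlocked_le {V : Type} [Fintype V] (H : SimpleGraph V) (π : Sym2 V → ℕ)
    (Φ : Sym2 V → Finset (Sym2 V)) {k f : ℕ} (hπ : Function.Injective π)
    (hΦ : ∀ e, (Φ e).card ≤ f)
    (hsingle : ∀ u v, H.Adj u v → ∀ p : H.Walk u v, (∀ e ∈ p.edges, π e < π s(u, v)) →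
      p.length ≤ 2 * k - 1 → ∃ e ∈ p.edges, e ∈ Φ s(u, v))
    (hdouble : ∀ u v, H.Adj u v → ∀ p : H.Walk u v, (∀ e ∈ p.edges, π e < π s(u, v)) →
      p.length ≤ k → ∃ e ∈ p.edges, ∃ e' ∈ p.edges, e ≠ e' ∧ e ∈ Φ s(u, v) ∧ e' ∈ Φ s(u, v)) :
    ∃ (H' : SimpleGraph V) (R : Sym2 V → Sym2 V → Prop),
      H.edgeSet.ncard ≤ 2 * H'.edgeSet.ncard ∧ IsBlocked H' π R k (3 * f) := by
  obtain ⟨T, hTS, hcard, hT⟩ := exists_card_le_of_forall_card_le H.edgeFinset Φ hΦ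
  have hTH : ∀ e ∈ T, e ∈ H.edgeSet := fun e he => mem_edgeFinset.1 (hTS he)
  have hset : (fromEdgeSet (T : Set (Sym2 V))).edgeSet = T := by
    rw [edgeSet_fromEdgeSet]
    refine sdiff_eq_left.2 (Set.disjoint_left.2 fun e he => ?_)
    exact H.not_isDiag_of_mem_edgeSet (hTH e he)
  have hle : fromEdgeSet (T : Set (Sym2 V)) ≤ H := by
    rw [← edgeSet_subset_edgeSet, hset]
    exact hTH
  have hmem : ∀ {u v} (p : (fromEdgeSet (T : Set (Sym2 V))).Walk u v), ∀ e ∈ p.edges, e ∈ T :=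
    fun p e he => by
      have := p.edges_subset_edgeSet he
      rwa [hset] at this
  have hadj : ∀ {u v}, (fromEdgeSet (T : Set (Sym2 V))).Adj u v → s(u, v) ∈ T :=
    fun h => ((fromEdgeSet_adj _).1 h).1
  refine ⟨fromEdgeSet T, fun e e' => e ∈ T ∧ e' ∈ T ∧
    ((e' ∈ Φ e ∧ π e' < π e) ∨ (e ∈ Φ e' ∧ π e < π e')), ?_, ?_⟩
  · rw [hset, Set.ncard_coe_finset, ← coe_edgeFinset, Set.ncard_coe_finset]
    exact hcard
  · refine ⟨fun e e' h => ⟨h.2.1, h.1, h.2.2.symm⟩, fun e h => ?_,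
      fun e _ e' _ h => hπ h, fun e he => ?_, fun u v huv p hp hl => ?_, fun u v huv p hp hl => ?_⟩
    · rcases h.2.2 with h | h <;> exact lt_irrefl _ h.2
    · rw [hset] at he
      refine ⟨Φ e ∪ H.edgeFinset.filter fun e' => e ∈ Φ e', ?_, fun e' h => ?_⟩
      · have := Finset.card_union_le (Φ e) (H.edgeFinset.filter fun e' => e ∈ Φ e')
        have := hΦ e
        have : (H.edgeFinset.filter fun e' => e ∈ Φ e').card ≤ 2 * f := by convert hT e he
        omega
      · rw [Finset.mem_union, Finset.mem_filter]
        rcases h.2.2 with h' | h'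
        · exact Or.inl h'.1
        · exact Or.inr ⟨hTS h.2.1, h'.1⟩
    · obtain ⟨e, he, h⟩ := hsingle u v (hle huv) (p.mapLe hle)
        (by simpa [Walk.edges_mapLe_eq_edges] using hp) (by simpa using hl)
      rw [Walk.edges_mapLe_eq_edges] at he
      exact ⟨e, he, hadj huv, hmem p e he, Or.inl ⟨h, hp e he⟩⟩
    · obtain ⟨e, he, e', he', hne, h, h'⟩ := hdouble u v (hle huv) (p.mapLe hle)
        (by simpa [Walk.edges_mapLe_eq_edges] using hp) (by simpa using hl)
      rw [Walk.edges_mapLe_eq_edges] at he he'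
      exact ⟨e, he, e', he', hne, ⟨hadj huv, hmem p e he, Or.inl ⟨h, hp e he⟩⟩,
        hadj huv, hmem p e' he', Or.inl ⟨h', hp e' he'⟩⟩

end Prune

section Exponents

/-- Extracting an `m`-th root from `Δ ^ m ≤ K * n * F ^ a`, up to the factor `K`. -/
lemma mul_le_of_pow_le {Δ K n F m a : ℕ} (hm : 1 ≤ m) (hK : 1 ≤ K)
    (h : Δ ^ m ≤ K * n * F ^ a) :
    (n : ℝ) * Δ ≤ K * ((n : ℝ) ^ (1 + 1 / (m : ℝ)) * (F : ℝ) ^ ((a : ℝ) / m)) := by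
  have hm0 : (0 : ℝ) < m := by exact_mod_cast hm
  have hK1 : (1 : ℝ) ≤ K := by exact_mod_cast hK
  have h' : (Δ : ℝ) ^ m ≤ K * n * (F : ℝ) ^ a := by exact_mod_cast h
  have hroot : (Δ : ℝ) ≤ K * (n : ℝ) ^ (1 / (m : ℝ)) * (F : ℝ) ^ ((a : ℝ) / m) := by
    refine le_of_pow_le_pow_left₀ (by omega : m ≠ 0) (by positivity) (h'.trans ?_)
    rw [mul_pow, mul_pow, ← Real.rpow_mul_natCast (by positivity),
      ← Real.rpow_mul_natCast (by positivity), one_div_mul_cancel hm0.ne', Real.rpow_one,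
      div_mul_cancel₀ _ hm0.ne', Real.rpow_natCast]
    gcongr
    exact le_self_pow₀ hK1 (by omega)
  rcases Nat.eq_zero_or_pos n with rfl | hn
  · simp
    positivity
  · have hn0 : (0 : ℝ) < n := by exact_mod_cast hn
    rw [Real.rpow_add hn0, Real.rpow_one]
    calc (n : ℝ) * Δ ≤ n * (K * (n : ℝ) ^ (1 / (m : ℝ)) * (F : ℝ) ^ ((a : ℝ) / m)) := by gcongr
      _ = _ := by ring

/-- A factor inside a power with exponent at most one can be pulled out in front. -/
lemma const_mul_rpow_le {c f s : ℝ} (hc : 1 ≤ c) (hf : 0 ≤ f) (hs : s ≤ 1) :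
    (c * f) ^ s ≤ c * f ^ s := by
  rw [Real.mul_rpow (by linarith) hf]
  gcongr
  exact (Real.rpow_le_rpow_of_exponent_le hc hs).trans_eq (Real.rpow_one c)

end Exponents

/-- For every odd positive integer `k` there is a constant `C_k > 0` such
that for every positive integer `f` and every weighted graph `G` on `n` vertices, there
exists an `f`-EFT `(2k−1)`-emulator `H` of `G` with
`|E(H)| ≤ C_k·(n^{1+1/k} + n^{1+1/(k+2)}·f^{k/(k+2)} + n^{1+1/(k+1)}·f^{1/2} + f·n)`. -/
theorem statement_1 (k : ℕ) (hk : Odd k) :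
    ∃ C : ℝ, 0 < C ∧
      ∀ (f : ℕ), 0 < f →
        ∀ (V : Type) [Fintype V], ∀ (G : SimpleGraph V) (w : Sym2 V → ℝ≥0∞),
          (∀ e ∈ G.edgeSet, 0 < w e ∧ w e ≠ ⊤) →
          ∃ H : SimpleGraph V,
            IsEFTEmulator G w H f ((2 * k - 1 : ℕ) : ℝ≥0∞) ∧
            (H.edgeSet.ncard : ℝ) ≤
              C * ((Fintype.card V : ℝ) ^ (1 + 1 / (k : ℝ))
                + (Fintype.card V : ℝ) ^ (1 + 1 / ((k : ℝ) + 2)) * (f : ℝ) ^ ((k : ℝ) / ((k : ℝ) + 2))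
                + (Fintype.card V : ℝ) ^ (1 + 1 / ((k : ℝ) + 1)) * (f : ℝ) ^ ((1 : ℝ) / 2)
                + (f : ℝ) * (Fintype.card V : ℝ)) := by
  obtain ⟨r, rfl⟩ := hk
  rcases Nat.eq_zero_or_pos r with rfl | hr
  · refine ⟨1, one_pos, fun f _ V _ G w _ => ?_⟩
    obtain ⟨H, -, -, hH, -⟩ := exists_greedy_emulator G w f (k := 2 * 0 + 1) le_rfl
    refine ⟨H, hH, ?_⟩
    classical
    have hE : H.edgeSet.ncard ≤ Fintype.card V ^ 2 := by
      rw [← coe_edgeFinset, Set.ncard_coe_finset]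
      refine H.card_edgeFinset_le_card_choose_two.trans (Nat.choose_le_pow _ _)
    have hE' : (H.edgeSet.ncard : ℝ) ≤ (Fintype.card V : ℝ) ^ 2 := by exact_mod_cast hE
    have hpow : (Fintype.card V : ℝ) ^ (1 + 1 / ((2 * 0 + 1 : ℕ) : ℝ)) =
        (Fintype.card V : ℝ) ^ 2 := by
      rw [← Real.rpow_natCast]
      norm_num
    rw [one_mul, hpow, add_assoc, add_assoc]
    exact hE'.trans (le_add_of_nonneg_right (by positivity))
  · obtain ⟨K, hK, hbound⟩ := exists_edge_bound r hr
    have hK0 : (0 : ℝ) < K := by exact_mod_cast hK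
    refine ⟨12 * K, by positivity, fun f hf V _ G w _ => ?_⟩
    obtain ⟨H, π, Φ, hH, hπ, hΦ, hsingle, hdouble⟩ :=
      exists_greedy_emulator G w f (k := 2 * r + 1) (by omega)
    refine ⟨H, hH, ?_⟩
    obtain ⟨H', R, hcard, hR⟩ := exists_isBlocked_le H π Φ hπ hΦ hsingle hdouble
    rcases Nat.eq_zero_or_pos (Fintype.card V) with hn | hn
    · have := Fintype.card_eq_zero_iff.1 hn
      rw [Subsingleton.elim H ⊥, edgeSet_bot, Set.ncard_empty, Nat.cast_zero]
      positivity
    have hcard' : (H.edgeSet.ncard : ℝ) ≤ 2 * H'.edgeSet.ncard := by exact_mod_cast hcard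
    set n := Fintype.card V
    set T₁ := (n : ℝ) ^ (1 + 1 / ((2 * r + 1 : ℕ) : ℝ)) with hT₁
    set T₂ := (n : ℝ) ^ (1 + 1 / (((2 * r + 1 : ℕ) : ℝ) + 2)) *
      (f : ℝ) ^ (((2 * r + 1 : ℕ) : ℝ) / (((2 * r + 1 : ℕ) : ℝ) + 2)) with hT₂
    set T₃ := (n : ℝ) ^ (1 + 1 / (((2 * r + 1 : ℕ) : ℝ) + 1)) * (f : ℝ) ^ ((1 : ℝ) / 2) with hT₃
    have h₁ : 0 ≤ K * T₁ := by positivity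
    have h₂ : 0 ≤ K * T₂ := by positivity
    have h₃ : 0 ≤ K * T₃ := by positivity
    have h₄ : 0 ≤ K * ((f : ℝ) * n) := by positivity
    have hpull : ∀ {s N : ℝ}, 0 ≤ N → s ≤ 1 →
        K * (N * ((3 * f : ℕ) : ℝ) ^ s) ≤ 3 * (K * (N * (f : ℝ) ^ s)) := fun {s N} hN hs => by
      have := const_mul_rpow_le (c := 3) (by norm_num) (Nat.cast_nonneg' f) hs
      push_cast
      calc K * (N * (3 * (f : ℝ)) ^ s) ≤ K * (N * (3 * (f : ℝ) ^ s)) := by gcongr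
        _ = _ := by ring
    rcases hbound V H' π R (3 * f) hR (by omega) hn with hE | ⟨Δ, hE, hΔ⟩
    · have hE' : (H'.edgeSet.ncard : ℝ) ≤ K * (3 * f) * n := by exact_mod_cast hE
      linarith
    · have hE' : (H'.edgeSet.ncard : ℝ) ≤ 2 * n * Δ := by exact_mod_cast hE
      rcases hΔ with hΔ | hΔ | hΔ
      · have := mul_le_of_pow_le (K := K) (n := n) (m := 2 * r + 1) (F := 1) (a := 0) (by omega) hK
          (by simpa using hΔ)
        rw [Nat.cast_one, Real.one_rpow, mul_one, ← hT₁] at this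
        linarith
      · have h := mul_le_of_pow_le (by omega) hK hΔ
        have hm : ((2 * r + 2 : ℕ) : ℝ) = ((2 * r + 1 : ℕ) : ℝ) + 1 := by push_cast; ring
        have ha : ((r + 1 : ℕ) : ℝ) / ((2 * r + 2 : ℕ) : ℝ) = 1 / 2 := by
          push_cast
          field_simp
        rw [ha, hm] at h
        have := h.trans (hpull (by positivity) (by norm_num))
        rw [← hT₃] at this
        linarith
      · have h := mul_le_of_pow_le (by omega) hK hΔ
        have hm : ((2 * r + 3 : ℕ) : ℝ) = ((2 * r + 1 : ℕ) : ℝ) + 2 := by push_cast; ring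
        rw [hm] at h
        have := h.trans (hpull (by positivity) (div_le_one_of_le₀ (by linarith) (by positivity)))
        rw [← hT₂] at this
        linarith
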